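/- (Sato–Tate for CM elliptic curves over the CM field) Let K be an imaginary quadratic field with a fixed embedding K ↪ ℂ, 𝔑 a nonzero ideal of O_K, and ψ an algebraic Hecke character of K modulo 𝔑 of infinity type 1 (such as the Hecke character attached by Deuring to an elliptic curve E/K with CM by K and conductor 𝔑, for which a_𝔭 = ψ(𝔭) + conj(ψ(𝔭))). Then the sequence of normalized traces (ψ(𝔭_i) + conj(ψ(𝔭_i)))/√N(𝔭_i), where (𝔭_i) is an enumeration by norm of the prime ideals of O_K coprime to 𝔑, is equidistributed on [−2,2] with respect to the measure μ_cm = (1/π)·dz/√(4 − z²), dz being the Lebesgue measure restricted to [−2,2]. -/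

import Mathlib

open Filter MeasureTheory NumberField

namespace SatoTateCM

/-- The Fejér kernel of bandwidth `l`. -/
noncomputable def fejer (l v : ℝ) : ℝ := l * Real.sinc (l * v / 2) ^ 2

lemma continuous_fejer (l : ℝ) : Continuous (fejer l) := by
  unfold fejer
  have := Real.continuous_sinc
  fun_prop

lemma fejer_nonneg {l : ℝ} (hl : 0 ≤ l) (v : ℝ) : 0 ≤ fejer l v := by
  unfold fejer; positivity

lemma fejer_le {l : ℝ} (hl : 0 ≤ l) (v : ℝ) : fejer l v ≤ l := by
  unfold fejer
  have h : Real.sinc (l * v / 2) ^ 2 ≤ 1 := by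
    rw [← sq_abs]
    exact pow_le_one₀ (abs_nonneg _) (Real.abs_sinc_le_one _)
  nlinarith

lemma fejer_of_ne_zero {l v : ℝ} (hl : 0 < l) (hv : v ≠ 0) :
    fejer l v = 4 * Real.sin (l * v / 2) ^ 2 / (l * v ^ 2) := by
  unfold fejer
  rw [Real.sinc_of_ne_zero (by positivity)]
  field_simp
  ring

lemma fejer_le_inv_sq {l v : ℝ} (hl : 0 < l) (hv : v ≠ 0) :
    fejer l v ≤ 4 / l * (v ^ 2)⁻¹ := by
  rw [fejer_of_ne_zero hl hv, ← div_div, ← div_eq_mul_inv]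
  have := Real.sin_sq_le_one (l * v / 2)
  gcongr
  linarith

lemma fejer_neg (l v : ℝ) : fejer l (-v) = fejer l v := by
  unfold fejer
  rw [show l * -v / 2 = -(l * v / 2) by ring, Real.sinc_neg]

lemma integrable_fejer {l : ℝ} (hl : 0 < l) : Integrable (fejer l) := by
  have h1 : IntegrableOn (fejer l) (Set.Ioi 1) := by
    have := (integrableOn_Ioi_rpow_of_lt (show (-2 : ℝ) < -1 by norm_num)
      zero_lt_one).const_mul (4 / l)
    refine Integrable.mono' this (continuous_fejer l).aestronglyMeasurable ?_
    filter_upwards [ae_restrict_mem measurableSet_Ioi] with v hv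
    have hv' : (0 : ℝ) < v := lt_trans one_pos hv
    rw [Real.norm_of_nonneg (fejer_nonneg hl.le v)]
    refine (fejer_le_inv_sq hl hv'.ne').trans (le_of_eq ?_)
    rw [Real.rpow_neg hv'.le, Real.rpow_two]
  have h2 : IntegrableOn (fejer l) (Set.Iio (-1)) := by
    have := (Measure.measurePreserving_neg (volume : Measure ℝ)).integrableOn_comp_preimage
      (MeasurableEquiv.neg ℝ).measurableEmbedding (f := fejer l) (s := Set.Iio (-1))
    rw [← this]
    simpa [Function.comp_def, fejer_neg] using h1
  have h3 : IntegrableOn (fejer l) (Set.Icc (-1) 1) :=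
    (continuous_fejer l).continuousOn.integrableOn_Icc
  have h4 : (Set.univ : Set ℝ) = Set.Iio (-1) ∪ Set.Icc (-1) 1 ∪ Set.Ioi 1 := by
    ext x
    simp only [Set.mem_univ, Set.mem_union, Set.mem_Iio, Set.mem_Icc, Set.mem_Ioi, true_iff]
    by_cases h : x < -1
    · exact Or.inl (Or.inl h)
    · by_cases h' : x ≤ 1
      · exact Or.inl (Or.inr ⟨not_lt.1 h, h'⟩)
      · exact Or.inr (not_le.1 h')
  rw [← integrableOn_univ, h4]
  exact (h2.union h3).union h1

lemma integral_fejer {l : ℝ} (hl : 0 < l) : ∫ v, fejer l v = ∫ v, fejer 1 v := by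
  have h : ∀ v, fejer l v = l * fejer 1 (l * v) := by
    intro v; unfold fejer; simp
  simp_rw [h, integral_const_mul, Measure.integral_comp_mul_left (fejer 1) l,
    abs_of_pos (inv_pos.2 hl)]
  simp [hl.ne']

lemma integral_fejer_pos : 0 < ∫ v, fejer 1 v := by
  refine integral_pos_of_integrable_nonneg_nonzero (continuous_fejer 1) (integrable_fejer one_pos)
    (fejer_nonneg zero_le_one) (x := 0) ?_
  simp [fejer]

/-- The mass of the Fejér kernel of bandwidth `l` on `[-δ, δ]` tends to the full mass. -/
lemma tendsto_integral_fejer_window {δ : ℝ} (hδ : 0 < δ) :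
    Tendsto (fun l => ∫ v in Set.Icc (-δ) δ, fejer l v) atTop (nhds (∫ v, fejer 1 v)) := by
  have h : ∀ l > 0, ∫ v in Set.Icc (-δ) δ, fejer l v
      = ∫ v in Set.Icc (-(l * δ)) (l * δ), fejer 1 v := by
    intro l hl
    have h : ∀ v, fejer l v = l * fejer 1 (l * v) := by
      intro v; unfold fejer; simp
    simp_rw [h]
    rw [integral_Icc_eq_integral_Ioc, integral_Icc_eq_integral_Ioc,
      ← intervalIntegral.integral_of_le (by linarith),
      ← intervalIntegral.integral_of_le (by nlinarith), intervalIntegral.integral_const_mul,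
      intervalIntegral.integral_comp_mul_left (fejer 1) hl.ne']
    simp [hl.ne']
  have h2 := (aecover_Icc (μ := (volume : Measure ℝ)) (l := atTop) (a := fun l : ℝ => -(l * δ))
    (b := fun l : ℝ => l * δ) (tendsto_neg_atTop_atBot.comp (tendsto_id.atTop_mul_const hδ))
    (tendsto_id.atTop_mul_const hδ)).integral_tendsto_of_countably_generated
    (integrable_fejer one_pos)
  refine h2.congr' ?_
  filter_upwards [eventually_gt_atTop 0] with l hl using (h l hl).symm

/-- The Fejér kernel is the Fourier transform of a tent function. -/
lemma integral_tent_mul_exp {l : ℝ} (hl : 0 < l) (v : ℝ) :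
    ∫ t in (-l)..l, ((1 - |t| / l : ℝ) : ℂ) * Complex.exp (Complex.I * t * v) = fejer l v := by
  have hlC : (l : ℂ) ≠ 0 := by exact_mod_cast hl.ne'
  have hc : Continuous fun t : ℝ => ((1 - |t| / l : ℝ) : ℂ) * Complex.exp (Complex.I * t * v) := by
    fun_prop
  rw [← intervalIntegral.integral_add_adjacent_intervals (hc.intervalIntegrable (-l) 0)
    (hc.intervalIntegrable 0 l)]
  have e1 : ∫ t in (-l)..0, ((1 - |t| / l : ℝ) : ℂ) * Complex.exp (Complex.I * t * v) =
      ∫ t in (-l)..0, ((1 + t / l : ℝ) : ℂ) * Complex.exp (Complex.I * t * v) := by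
    refine intervalIntegral.integral_congr fun t ht => ?_
    rw [Set.uIcc_of_le (by linarith)] at ht
    simp only [abs_of_nonpos ht.2]
    congr 2
    ring
  have e2 : ∫ t in 0..l, ((1 - |t| / l : ℝ) : ℂ) * Complex.exp (Complex.I * t * v) =
      ∫ t in 0..l, ((1 - t / l : ℝ) : ℂ) * Complex.exp (Complex.I * t * v) := by
    refine intervalIntegral.integral_congr fun t ht => ?_
    rw [Set.uIcc_of_le hl.le] at ht
    simp only [abs_of_nonneg ht.1]
  rw [e1, e2]
  rcases eq_or_ne v 0 with rfl | hv
  · have d1 : ∀ t ∈ Set.uIcc (-l) 0,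
        HasDerivAt (fun t : ℝ => t + t ^ 2 / (2 * l)) (1 + t / l) t := by
      intro t _
      have := (hasDerivAt_id t).add (((hasDerivAt_id t).pow 2).div_const (2 * l))
      refine this.congr_deriv ?_
      simp only [id_eq]
      field_simp
      norm_num
      ring
    have d2 : ∀ t ∈ Set.uIcc 0 l, HasDerivAt (fun t : ℝ => t - t ^ 2 / (2 * l)) (1 - t / l) t := by
      intro t _
      have := (hasDerivAt_id t).sub (((hasDerivAt_id t).pow 2).div_const (2 * l))
      refine this.congr_deriv ?_
      simp only [id_eq]
      field_simp
      norm_num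
      ring
    have i1 := intervalIntegral.integral_eq_sub_of_hasDerivAt d1
      ((by fun_prop : Continuous fun t : ℝ => 1 + t / l).intervalIntegrable _ _)
    have i2 := intervalIntegral.integral_eq_sub_of_hasDerivAt d2
      ((by fun_prop : Continuous fun t : ℝ => 1 - t / l).intervalIntegrable _ _)
    simp only [Complex.ofReal_zero, mul_zero, Complex.exp_zero, mul_one]
    rw [intervalIntegral.integral_ofReal, intervalIntegral.integral_ofReal, i1, i2,
      ← Complex.ofReal_add]
    congr 1
    simp only [fejer, mul_zero, zero_div, Real.sinc_zero]
    field_simp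
    ring
  · have hvC : (v : ℂ) ≠ 0 := by exact_mod_cast hv
    have hE : ∀ t : ℝ, HasDerivAt (fun t : ℝ => Complex.exp (Complex.I * t * v))
        (Complex.exp (Complex.I * t * v) * (Complex.I * v)) t := by
      intro t
      have h1 : HasDerivAt (fun t : ℝ => Complex.I * (t : ℂ) * v) (Complex.I * v) t := by
        have := ((Complex.ofRealCLM.hasDerivAt (x := t)).const_mul Complex.I).mul_const (v : ℂ)
        simpa using this
      exact h1.cexp
    have hT : ∀ (c : ℂ) (t : ℝ), HasDerivAt (fun t : ℝ => 1 + c * (t : ℂ)) c t := by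
      intro c t
      have := ((Complex.ofRealCLM.hasDerivAt (x := t)).const_mul c).const_add 1
      simpa using this
    have hd : ∀ (c : ℂ) (t : ℝ),
        HasDerivAt (fun t : ℝ => (1 + c * t) * Complex.exp (Complex.I * t * v)
        / (Complex.I * v) - c * Complex.exp (Complex.I * t * v) / (Complex.I * v) ^ 2)
        ((1 + c * t) * Complex.exp (Complex.I * t * v)) t := by
      intro c t
      have := (((hT c t).mul (hE t)).div_const (Complex.I * v)).sub
        (((hE t).const_mul c).div_const ((Complex.I * v) ^ 2))
      refine this.congr_deriv ?_
      have := Complex.I_ne_zero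
      field_simp
      ring
    have i := fun (c : ℂ) (a b : ℝ) => intervalIntegral.integral_eq_sub_of_hasDerivAt
      (a := a) (b := b) (fun t _ => hd c t)
      ((by fun_prop : Continuous fun t : ℝ => (1 + c * t) * Complex.exp (Complex.I * t * v)
        ).intervalIntegrable _ _)
    have r1 : ∀ t : ℝ, ((1 + t / l : ℝ) : ℂ) = 1 + (1 / l : ℂ) * t := by
      intro t; push_cast; ring
    have r2 : ∀ t : ℝ, ((1 - t / l : ℝ) : ℂ) = 1 + (-(1 / l) : ℂ) * t := by
      intro t; push_cast; ring
    simp_rw [r1, r2]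
    rw [i, i, fejer_of_ne_zero hl hv]
    have hcos : Complex.exp (Complex.I * l * v) + Complex.exp (-(Complex.I * l * v)) =
        2 - 4 * (Complex.sin (l * v / 2)) ^ 2 := by
      have h1 : Complex.cos (l * v) = 1 - 2 * Complex.sin (l * v / 2) ^ 2 := by
        rw [show (l * v : ℂ) = 2 * (l * v / 2) by ring, Complex.cos_two_mul, Complex.cos_sq']
        ring_nf
      have h2 : 2 * Complex.cos (l * v) = _ := Complex.two_cos (l * v : ℂ)
      rw [h1] at h2
      rw [show Complex.I * l * v = (l * v : ℂ) * Complex.I by ring, ← neg_mul, ← h2]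
      ring
    have hI : (Complex.I) ^ 2 = -1 := Complex.I_sq
    have hS : Complex.sin (l * v / 2) ^ 2 = (2 - (Complex.exp (Complex.I * l * v) +
        Complex.exp (-(Complex.I * l * v)))) / 4 := by
      rw [hcos]; ring
    push_cast
    rw [hS, mul_pow, hI]
    have e0 : Complex.I * (-l : ℂ) * v = -(Complex.I * l * v) := by ring
    rw [e0]
    have := Complex.I_ne_zero
    simp only [mul_zero, zero_mul, Complex.exp_zero]
    field_simp
    ring

lemma integral_tent_mul_laplace {l : ℝ} (hl : 0 < l) {H : ℝ → ℂ}
    (hH : IntegrableOn H (Set.Ioi 0)) (y : ℝ) :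
    ∫ t in (-l)..l, ((1 - |t| / l : ℝ) : ℂ) * Complex.exp (Complex.I * t * y) *
      (∫ u in Set.Ioi (0 : ℝ), H u * Complex.exp (-(Complex.I * t * u))) =
    ∫ u in Set.Ioi (0 : ℝ), H u * (fejer l (y - u) : ℂ) := by
  have hle : -l ≤ l := by linarith
  have hk : Continuous fun t : ℝ => ((1 - |t| / l : ℝ) : ℂ) := by fun_prop
  have hk' : IntegrableOn (fun t : ℝ => ((1 - |t| / l : ℝ) : ℂ)) (Set.Ioc (-l) l) :=
    (hk.integrableOn_Icc (a := -l) (b := l)).mono_set Set.Ioc_subset_Icc_self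
  have hprod := Integrable.mul_prod hk' hH
  have hphase : Continuous fun z : ℝ × ℝ => Complex.exp (Complex.I * z.1 * (y - z.2 : ℝ)) := by
    fun_prop
  have h_int : Integrable (Function.uncurry fun t u : ℝ => ((1 - |t| / l : ℝ) : ℂ) * H u *
      Complex.exp (Complex.I * t * (y - u : ℝ)))
      ((volume.restrict (Set.Ioc (-l) l)).prod (volume.restrict (Set.Ioi 0))) := by
    refine hprod.mono (hprod.aestronglyMeasurable.mul hphase.aestronglyMeasurable) ?_
    refine Eventually.of_forall fun z => ?_
    simp only [Function.uncurry, norm_mul]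
    rw [show Complex.I * (z.1 : ℂ) * ((y - z.2 : ℝ) : ℂ) =
        ((z.1 * (y - z.2) : ℝ) : ℂ) * Complex.I by
      push_cast; ring, Complex.norm_exp_ofReal_mul_I, mul_one]
  have hswap := integral_integral_swap h_int
  rw [intervalIntegral.integral_of_le hle]
  calc _ = ∫ t in Set.Ioc (-l) l, ∫ u in Set.Ioi (0 : ℝ), ((1 - |t| / l : ℝ) : ℂ) * H u *
      Complex.exp (Complex.I * t * (y - u : ℝ)) := by
        refine integral_congr_ae (Eventually.of_forall fun t => ?_)
        simp only
        rw [← integral_const_mul]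
        refine integral_congr_ae (Eventually.of_forall fun u => ?_)
        simp only
        rw [show Complex.I * (t : ℂ) * ((y - u : ℝ) : ℂ) =
            Complex.I * t * y + -(Complex.I * t * u) by
          push_cast; ring, Complex.exp_add]
        ring
    _ = _ := hswap
    _ = _ := by
        refine integral_congr_ae (Eventually.of_forall fun u => ?_)
        simp only
        rw [← integral_tent_mul_exp hl, ← intervalIntegral.integral_of_le hle,
          ← intervalIntegral.integral_const_mul]
        refine intervalIntegral.integral_congr fun t _ => ?_
        ring

/-- The Fourier integral against the tent function of a function of `t`. -/
noncomputable def tentIntegral (l : ℝ) (g : ℝ → ℂ) (y : ℝ) : ℂ :=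
  ∫ t in (-l)..l, ((1 - |t| / l : ℝ) : ℂ) * Complex.exp (Complex.I * t * y) * g t

lemma tendsto_tentIntegral_atTop {l : ℝ} (hl : 0 < l) (g : ℝ → ℂ) :
    Tendsto (tentIntegral l g) atTop (nhds 0) := by
  have h := Real.tendsto_integral_exp_smul_cocompact
    ((Set.Ioc (-l) l).indicator fun t : ℝ => ((1 - |t| / l : ℝ) : ℂ) * g t)
  have h2 : Tendsto (fun y : ℝ => -(y / (2 * Real.pi))) atTop (cocompact ℝ) := by
    refine Tendsto.mono_right ?_ atBot_le_cocompact
    exact tendsto_neg_atTop_atBot.comp (tendsto_id.atTop_div_const (by positivity))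
  refine (h.comp h2).congr fun y => ?_
  simp only [Function.comp_apply]
  rw [tentIntegral, intervalIntegral.integral_of_le (by linarith),
    ← integral_indicator measurableSet_Ioc]
  refine integral_congr_ae (Eventually.of_forall fun t => ?_)
  simp only [Set.indicator_apply]
  split_ifs
  · rw [Circle.smul_def, Real.fourierChar_apply, smul_eq_mul,
      show ((2 * Real.pi * -(t * -(y / (2 * Real.pi))) : ℝ) : ℂ) * Complex.I
        = Complex.I * t * y by push_cast; field_simp]
    ring
  · simp

lemma tendsto_tentIntegral_nhdsGT {l : ℝ} (hl : 0 < l) {G : ℝ → ℝ → ℂ}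
    (hG : ContinuousOn (Function.uncurry G) (Set.Ici 0 ×ˢ Set.univ)) (y : ℝ) :
    Tendsto (fun ε => tentIntegral l (G ε) y) (nhdsWithin 0 (Set.Ioi 0))
      (nhds (tentIntegral l (G 0) y)) := by
  obtain ⟨M, hM⟩ := ((isCompact_Icc (a := (0 : ℝ)) (b := 1)).prod
    (isCompact_Icc (a := -l) (b := l))).exists_bound_of_continuousOn
    (hG.mono (Set.prod_mono (fun x hx => hx.1) (Set.subset_univ _)))
  have hsec : ∀ ε, 0 ≤ ε → Continuous (G ε) := fun ε hε => by
    have : ContinuousOn (fun t : ℝ => Function.uncurry G (ε, t)) Set.univ :=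
      hG.comp (by fun_prop) (fun t _ => ⟨hε, trivial⟩)
    exact continuousOn_univ.1 this
  refine intervalIntegral.tendsto_integral_filter_of_dominated_convergence (fun _ => M) ?_ ?_ ?_ ?_
  · filter_upwards [self_mem_nhdsWithin] with ε hε
    have := hsec ε (le_of_lt hε)
    exact Continuous.aestronglyMeasurable (by fun_prop)
  · filter_upwards [Ioc_mem_nhdsGT (zero_lt_one : (0 : ℝ) < 1)] with ε hε
    refine Eventually.of_forall fun t ht => ?_
    rw [Set.uIoc_of_le (by linarith)] at ht
    rw [norm_mul, norm_mul, show Complex.I * (t : ℂ) * (y : ℂ) = ((t * y : ℝ) : ℂ) * Complex.I by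
      push_cast; ring, Complex.norm_exp_ofReal_mul_I, mul_one, Complex.norm_real]
    have h1 : ‖(1 - |t| / l : ℝ)‖ ≤ 1 := by
      have : |t| ≤ l := abs_le.2 ⟨ht.1.le, ht.2⟩
      have h3 : |t| / l ≤ 1 := (div_le_one hl).2 this
      have h4 : 0 ≤ |t| / l := by positivity
      rw [Real.norm_of_nonneg (by linarith)]
      linarith
    have h2 := hM (ε, t) ⟨⟨hε.1.le, hε.2⟩, ht.1.le, ht.2⟩
    simp only [Function.uncurry] at h2
    calc _ ≤ 1 * M := mul_le_mul h1 h2 (norm_nonneg _) zero_le_one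
      _ = M := one_mul M
  · exact intervalIntegrable_const
  · refine Eventually.of_forall fun t ht => Tendsto.const_mul _ ?_
    have h1 : ContinuousWithinAt (Function.uncurry G) (Set.Ici 0 ×ˢ Set.univ) (0, t) :=
      hG _ ⟨Set.mem_Ici.2 le_rfl, trivial⟩
    have h2 : Tendsto (fun ε : ℝ => (ε, t)) (nhdsWithin 0 (Set.Ioi 0))
        (nhdsWithin (0, t) (Set.Ici 0 ×ˢ Set.univ)) := by
      refine tendsto_nhdsWithin_iff.2 ⟨?_, ?_⟩
      · exact ((by fun_prop : Continuous fun ε : ℝ => (ε, t)).tendsto 0).mono_left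
          nhdsWithin_le_nhds
      · filter_upwards [self_mem_nhdsWithin] with ε hε
        exact ⟨Set.mem_Ici.2 (le_of_lt hε), trivial⟩
    exact Tendsto.comp h1 h2

/-- Hypotheses of the Wiener–Ikehara theorem, in logarithmic variables. -/
structure TauberianData (B : ℝ → ℝ) (A : ℝ) (G : ℝ → ℝ → ℂ) : Prop where
  nonneg : ∀ u, 0 ≤ B u
  mono : ∀ u v, u ≤ v → B u * Real.exp u ≤ B v * Real.exp v
  integrable : ∀ ε > 0, IntegrableOn (fun u => B u * Real.exp (-ε * u)) (Set.Ioi 0)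
  nonneg_residue : 0 ≤ A
  continuousOn : ContinuousOn (Function.uncurry G) (Set.Ici 0 ×ˢ Set.univ)
  laplace : ∀ ε : ℝ, 0 < ε → ∀ t : ℝ, ∫ u in Set.Ioi (0 : ℝ), (B u : ℂ) *
    Complex.exp (-((ε + Complex.I * t) * u)) = A / (ε + Complex.I * t) + G ε t

namespace TauberianData

variable {B : ℝ → ℝ} {A : ℝ} {G : ℝ → ℝ → ℂ}

lemma integrable_exp {ε : ℝ} (hε : 0 < ε) :
    IntegrableOn (fun u : ℝ => Real.exp (-ε * u)) (Set.Ioi 0) :=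
  integrableOn_exp_mul_Ioi (by linarith) 0

lemma laplace_one {ε : ℝ} (hε : 0 < ε) (t : ℝ) :
    ∫ u in Set.Ioi (0 : ℝ), Complex.exp (-((ε + Complex.I * t) * u)) = 1 / (ε + Complex.I * t) := by
  have := integral_exp_mul_complex_Ioi (a := -(ε + Complex.I * t)) (by simpa using hε) 0
  simp only [neg_mul] at this
  rw [this]
  simp [neg_div_neg_eq, -neg_add_rev]

lemma integrable_mul_fejer {ε l : ℝ} (hl : 0 < l) {f : ℝ → ℝ}
    (hf : IntegrableOn (fun u => f u * Real.exp (-ε * u)) (Set.Ioi 0)) (y : ℝ) :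
    IntegrableOn (fun u => f u * Real.exp (-ε * u) * fejer l (y - u)) (Set.Ioi 0) := by
  refine Integrable.mul_bdd (c := l) hf ?_ ?_
  · exact ((continuous_fejer l).comp (by fun_prop)).aestronglyMeasurable
  · refine Eventually.of_forall fun u => ?_
    rw [Real.norm_of_nonneg (fejer_nonneg hl.le _)]
    exact fejer_le hl.le _

lemma fejer_identity (h : TauberianData B A G) {l ε : ℝ} (hl : 0 < l) (hε : 0 < ε) (y : ℝ) :
    ∫ u in Set.Ioi (0 : ℝ), B u * Real.exp (-ε * u) * fejer l (y - u) =
      A * (∫ u in Set.Ioi (0 : ℝ), Real.exp (-ε * u) * fejer l (y - u)) +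
      (tentIntegral l (G ε) y).re := by
  have key : ∀ f : ℝ → ℝ, IntegrableOn (fun u => f u * Real.exp (-ε * u)) (Set.Ioi 0) →
      tentIntegral l (fun t => ∫ u in Set.Ioi (0 : ℝ), (f u : ℂ) *
        Complex.exp (-((ε + Complex.I * t) * u))) y =
      ((∫ u in Set.Ioi (0 : ℝ), f u * Real.exp (-ε * u) * fejer l (y - u) : ℝ) : ℂ) := by
    intro f hf
    have h1 := integral_tent_mul_laplace hl (H := fun u => ((f u * Real.exp (-ε * u) : ℝ) : ℂ))
      hf.ofReal y
    rw [← integral_complex_ofReal]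
    simp only [Complex.ofReal_mul] at h1 ⊢
    rw [← h1, tentIntegral]
    congr 1; ext t; congr 2; ext u
    rw [mul_assoc]
    congr 1
    rw [Complex.ofReal_exp, ← Complex.exp_add]
    congr 1
    push_cast
    ring
  have hB := key B (h.integrable ε hε)
  have h1 := key (fun _ => 1) (by simpa using integrable_exp hε)
  simp only [Complex.ofReal_one, one_mul] at h1
  simp_rw [laplace_one hε] at h1
  simp_rw [h.laplace ε hε] at hB
  have hsplit : tentIntegral l (fun t => (A : ℂ) / (ε + Complex.I * t) + G ε t) y =
      A * tentIntegral l (fun t => 1 / (ε + Complex.I * t)) y + tentIntegral l (G ε) y := by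
    unfold tentIntegral
    have hne : ∀ t : ℝ, (ε : ℂ) + Complex.I * t ≠ 0 := by
      intro t h0
      have := congrArg Complex.re h0
      simp at this
      exact hε.ne' this
    have hGc : Continuous (G ε) := by
      have : ContinuousOn (fun t : ℝ => Function.uncurry G (ε, t)) Set.univ :=
        h.continuousOn.comp (by fun_prop) (fun t _ => ⟨hε.le, trivial⟩)
      exact continuousOn_univ.1 this
    have hc : Continuous fun t : ℝ => 1 / ((ε : ℂ) + Complex.I * t) :=
      continuous_const.div (by fun_prop) hne
    rw [← intervalIntegral.integral_const_mul, ← intervalIntegral.integral_add]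
    · refine intervalIntegral.integral_congr fun t _ => ?_
      ring
    · exact Continuous.intervalIntegrable (by fun_prop) _ _
    · exact Continuous.intervalIntegrable (by fun_prop) _ _
  rw [hsplit, h1] at hB
  have := congrArg Complex.re hB
  simp only [Complex.add_re, Complex.ofReal_re] at this
  rw [← this, ← Complex.ofReal_mul, Complex.ofReal_re]

lemma integral_window_comp (l y δ : ℝ) :
    ∫ u in Set.Icc (y - δ) (y + δ), fejer l (y - u) = ∫ v in Set.Icc (-δ) δ, fejer l v := by
  by_cases hδ : 0 ≤ δ
  · rw [integral_Icc_eq_integral_Ioc, integral_Icc_eq_integral_Ioc,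
      ← intervalIntegral.integral_of_le (by linarith),
      ← intervalIntegral.integral_of_le (by linarith),
      intervalIntegral.integral_comp_sub_left (fejer l) y]
    simp
  · rw [Set.Icc_eq_empty (by linarith), Set.Icc_eq_empty (by linarith)]
    simp

lemma integrable_fejer_sub {l : ℝ} (hl : 0 < l) (y : ℝ) : Integrable fun u => fejer l (y - u) :=
  (integrable_fejer hl).comp_sub_left y

lemma integral_fejer_sub {l : ℝ} (hl : 0 < l) (y : ℝ) :
    ∫ u, fejer l (y - u) = ∫ v, fejer 1 v := by
  rw [integral_sub_left_eq_self (fejer l) volume y, integral_fejer hl]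

lemma window_upper (h : TauberianData B A G) {l δ y : ℝ} (hl : 0 < l) (hy : δ < y) :
    B (y - δ) * Real.exp (-(2 * δ)) * ∫ v in Set.Icc (-δ) δ, fejer l v ≤
      A * (∫ v, fejer 1 v) + ‖tentIntegral l (G 0) y‖ := by
  set C := ∫ v in Set.Icc (-δ) δ, fejer l v with hC
  have hC0 : 0 ≤ C := setIntegral_nonneg measurableSet_Icc fun v _ => fejer_nonneg hl.le v
  have key : ∀ ε > 0, B (y - δ) * Real.exp (-(2 * δ)) * Real.exp (-ε * (y + δ)) * C ≤
      A * (∫ v, fejer 1 v) + ‖tentIntegral l (G ε) y‖ := by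
    intro ε hε
    have hsub : Set.Icc (y - δ) (y + δ) ⊆ Set.Ioi 0 := fun u hu => by
      have := hu.1; simp only [Set.mem_Ioi]; linarith
    have h1 : B (y - δ) * Real.exp (-(2 * δ)) * Real.exp (-ε * (y + δ)) * C ≤
        ∫ u in Set.Ioi (0 : ℝ), B u * Real.exp (-ε * u) * fejer l (y - u) := by
      rw [hC, ← integral_window_comp l y δ, ← integral_const_mul]
      refine (setIntegral_mono_on ?_ ?_ measurableSet_Icc ?_).trans
        (setIntegral_mono_set (integrable_mul_fejer hl (h.integrable ε hε) y) ?_ hsub.eventuallyLE)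
      · exact ((integrable_fejer_sub hl y).const_mul _).integrableOn
      · exact (integrable_mul_fejer hl (h.integrable ε hε) y).mono_set hsub
      · intro u hu
        refine mul_le_mul_of_nonneg_right ?_ (fejer_nonneg hl.le _)
        refine mul_le_mul ?_ ?_ (Real.exp_pos _).le (h.nonneg _)
        · have h2 := h.mono _ _ hu.1
          have h3 : Real.exp u ≤ Real.exp (y - δ) * Real.exp (2 * δ) := by
            rw [← Real.exp_add]; exact Real.exp_le_exp.2 (by linarith [hu.2])
          have h4 : B u * Real.exp u ≤ B u * (Real.exp (y - δ) * Real.exp (2 * δ)) :=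
            mul_le_mul_of_nonneg_left h3 (h.nonneg u)
          rw [Real.exp_neg, ← div_eq_mul_inv, div_le_iff₀ (Real.exp_pos _)]
          have h5 : B (y - δ) * Real.exp (y - δ) ≤ B u * Real.exp (2 * δ) * Real.exp (y - δ) := by
            linarith
          exact le_of_mul_le_mul_right h5 (Real.exp_pos _)
        · exact Real.exp_le_exp.2 (by nlinarith [hu.2])
      · filter_upwards [ae_restrict_mem measurableSet_Ioi] with u hu
        have := h.nonneg u
        have := fejer_nonneg hl.le (y - u)
        simp only [Pi.zero_apply]
        positivity
    rw [h.fejer_identity hl hε] at h1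
    refine h1.trans (add_le_add (mul_le_mul_of_nonneg_left ?_ h.nonneg_residue)
      (Complex.re_le_norm _))
    rw [← integral_fejer_sub hl y]
    refine (setIntegral_mono_on (g := fun u => fejer l (y - u)) ?_ ?_ measurableSet_Ioi ?_).trans
      (setIntegral_le_integral (integrable_fejer_sub hl y)
        (Eventually.of_forall fun u => fejer_nonneg hl.le _))
    · simpa using integrable_mul_fejer hl (f := fun _ => 1) (by simpa using integrable_exp hε) y
    · exact (integrable_fejer_sub hl y).integrableOn
    · intro u hu
      have : Real.exp (-ε * u) ≤ 1 := Real.exp_le_one_iff.2 (by nlinarith [Set.mem_Ioi.1 hu])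
      exact mul_le_of_le_one_left (fejer_nonneg hl.le _) this
  have t1 : Tendsto (fun ε => B (y - δ) * Real.exp (-(2 * δ)) * Real.exp (-ε * (y + δ)) * C)
      (nhdsWithin 0 (Set.Ioi 0)) (nhds (B (y - δ) * Real.exp (-(2 * δ)) * C)) := by
    have : Continuous fun ε : ℝ =>
        B (y - δ) * Real.exp (-(2 * δ)) * Real.exp (-ε * (y + δ)) * C := by
      fun_prop
    have := (this.tendsto 0).mono_left (nhdsWithin_le_nhds (s := Set.Ioi 0))
    simpa using this
  have t2 := (tendsto_tentIntegral_nhdsGT hl h.continuousOn y).norm.const_add (A * ∫ v, fejer 1 v)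
  refine le_of_tendsto_of_tendsto t1 t2 ?_
  filter_upwards [self_mem_nhdsWithin] with ε hε using key ε hε

lemma window_lower (h : TauberianData B A G) {l δ y M : ℝ} (hl : 0 < l) (hy : δ < y)
    (hM : ∀ u, 0 < u → B u ≤ M) :
    A * (∫ v in Set.Icc (-δ) δ, fejer l v) - ‖tentIntegral l (G 0) y‖ ≤
      M * ((∫ v, fejer 1 v) - ∫ v in Set.Icc (-δ) δ, fejer l v) +
      B (y + δ) * Real.exp (2 * δ) * ∫ v in Set.Icc (-δ) δ, fejer l v := by
  set C := ∫ v in Set.Icc (-δ) δ, fejer l v with hC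
  have hM0 : 0 ≤ M := (h.nonneg 1).trans (hM 1 one_pos)
  have hC0 : 0 ≤ C := setIntegral_nonneg measurableSet_Icc fun v _ => fejer_nonneg hl.le v
  have key : ∀ ε > 0, A * (Real.exp (-ε * (y + δ)) * C) - ‖tentIntegral l (G ε) y‖ ≤
      M * ((∫ v, fejer 1 v) - C) + B (y + δ) * Real.exp (2 * δ) * C := by
    intro ε hε
    have hsub : Set.Icc (y - δ) (y + δ) ⊆ Set.Ioi 0 := fun u hu => by
      have := hu.1; simp only [Set.mem_Ioi]; linarith
    have hiB := integrable_mul_fejer hl (h.integrable ε hε) y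
    have hi1 : IntegrableOn (fun u => Real.exp (-ε * u) * fejer l (y - u)) (Set.Ioi 0) := by
      simpa using integrable_mul_fejer hl (f := fun _ => 1) (by simpa using integrable_exp hε) y
    have hif := integrable_fejer_sub hl y
    have h1 : Real.exp (-ε * (y + δ)) * C ≤
        ∫ u in Set.Ioi (0 : ℝ), Real.exp (-ε * u) * fejer l (y - u) := by
      rw [hC, ← integral_window_comp l y δ, ← integral_const_mul]
      refine (setIntegral_mono_on ?_ ?_ measurableSet_Icc ?_).trans
        (setIntegral_mono_set hi1 ?_ hsub.eventuallyLE)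
      · exact (hif.const_mul _).integrableOn
      · exact hi1.mono_set hsub
      · intro u hu
        refine mul_le_mul_of_nonneg_right ?_ (fejer_nonneg hl.le _)
        exact Real.exp_le_exp.2 (by nlinarith [hu.2])
      · filter_upwards with u
        have := fejer_nonneg hl.le (y - u)
        simp only [Pi.zero_apply]
        positivity
    have h2 : ∫ u in Set.Ioi (0 : ℝ), B u * Real.exp (-ε * u) * fejer l (y - u) ≤
        M * ((∫ v, fejer 1 v) - C) + B (y + δ) * Real.exp (2 * δ) * C := by
      have hexp : ∀ u, 0 < u → Real.exp (-ε * u) ≤ 1 := fun u hu =>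
        Real.exp_le_one_iff.2 (by nlinarith)
      rw [← integral_inter_add_sdiff (s := Set.Ioi 0) (t := Set.Icc (y - δ) (y + δ))
        measurableSet_Icc hiB,
        Set.inter_eq_self_of_subset_right hsub, add_comm]
      refine add_le_add ?_ ?_
      · have h3 : (∫ v, fejer 1 v) - C = ∫ u in (Set.Icc (y - δ) (y + δ))ᶜ, fejer l (y - u) := by
          rw [hC, ← integral_window_comp l y δ, ← integral_fejer_sub hl y,
            ← integral_add_compl measurableSet_Icc hif]
          ring
        rw [h3, ← integral_const_mul]
        refine (setIntegral_mono_on (hiB.mono_set Set.sdiff_subset) (hif.const_mul M).integrableOn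
          (measurableSet_Ioi.diff measurableSet_Icc) ?_).trans (setIntegral_mono_set
          (hif.const_mul M).integrableOn ?_ (Set.sdiff_subset_compl _ _).eventuallyLE)
        · intro u hu
          refine mul_le_mul_of_nonneg_right ?_ (fejer_nonneg hl.le _)
          calc _ ≤ M * 1 := mul_le_mul (hM u hu.1) (hexp u hu.1) (Real.exp_pos _).le hM0
            _ = M := mul_one M
        · filter_upwards with u
          have := fejer_nonneg hl.le (y - u)
          simp only [Pi.zero_apply]
          positivity
      · rw [hC, ← integral_window_comp l y δ, ← integral_const_mul]
        refine setIntegral_mono_on (hiB.mono_set hsub) (hif.const_mul _).integrableOn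
          measurableSet_Icc ?_
        intro u hu
        refine mul_le_mul_of_nonneg_right ?_ (fejer_nonneg hl.le _)
        have h3 := h.mono _ _ hu.2
        have h4 : Real.exp (y + δ) ≤ Real.exp (2 * δ) * Real.exp u := by
          rw [← Real.exp_add]; exact Real.exp_le_exp.2 (by linarith [hu.1])
        have h5 : B u * Real.exp u ≤ B (y + δ) * Real.exp (2 * δ) * Real.exp u := by
          refine h3.trans ?_
          rw [mul_assoc]
          exact mul_le_mul_of_nonneg_left h4 (h.nonneg _)
        have h6 := le_of_mul_le_mul_right h5 (Real.exp_pos _)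
        exact (mul_le_of_le_one_right (h.nonneg _) (hexp u (hsub hu))).trans h6
    rw [h.fejer_identity hl hε] at h2
    have h3 := mul_le_mul_of_nonneg_left h1 h.nonneg_residue
    have h4 := (abs_le.1 (Complex.abs_re_le_norm (tentIntegral l (G ε) y))).1
    linarith
  have t1 : Tendsto (fun ε => A * (Real.exp (-ε * (y + δ)) * C))
      (nhdsWithin 0 (Set.Ioi 0)) (nhds (A * C)) := by
    have : Continuous fun ε : ℝ => A * (Real.exp (-ε * (y + δ)) * C) := by
      fun_prop
    have := (this.tendsto 0).mono_left (nhdsWithin_le_nhds (s := Set.Ioi 0))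
    simpa using this
  have t2 := (tendsto_tentIntegral_nhdsGT hl h.continuousOn y).norm
  refine le_of_tendsto (t1.sub t2) ?_
  filter_upwards [self_mem_nhdsWithin] with ε hε using key ε hε

lemma exists_bound (h : TauberianData B A G) : ∃ M, ∀ u, 0 < u → B u ≤ M := by
  have hw : 0 < ∫ v in Set.Icc (-1 : ℝ) 1, fejer 1 v := by
    rw [integral_Icc_eq_integral_Ioc, ← intervalIntegral.integral_of_le (by norm_num)]
    refine intervalIntegral.integral_pos (by norm_num) (continuous_fejer 1).continuousOn
      (fun v _ => fejer_nonneg zero_le_one v) ⟨0, by simp, by simp [fejer]⟩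
  set W := ∫ v in Set.Icc (-1 : ℝ) 1, fejer 1 v
  have ht := (tendsto_tentIntegral_atTop one_pos (G 0)).norm
  rw [norm_zero] at ht
  obtain ⟨Y, hY⟩ := eventually_atTop.1 (ht.eventually (eventually_le_nhds (zero_lt_one' ℝ)))
  set y₀ := max Y 2
  refine ⟨max (B y₀ * Real.exp y₀) ((A * (∫ v, fejer 1 v) + 1) / (Real.exp (-2) * W)),
    fun u hu => ?_⟩
  rcases le_total u y₀ with h1 | h1
  · refine le_max_of_le_left ((?_ : B u ≤ B u * Real.exp u).trans (h.mono _ _ h1))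
    exact le_mul_of_one_le_right (h.nonneg u) (Real.one_le_exp hu.le)
  · refine le_max_of_le_right ?_
    rw [le_div_iff₀ (by positivity)]
    have h2 := h.window_upper one_pos (δ := 1) (y := u + 1) (by linarith)
    have h3 := hY (u + 1) ((le_max_left _ _).trans (by linarith : y₀ ≤ u + 1))
    simp only [add_sub_cancel_right, mul_one] at h2
    rw [← mul_assoc]
    linarith

/-- **Wiener–Ikehara theorem** in logarithmic variables. -/
theorem tendsto (h : TauberianData B A G) : Tendsto B atTop (nhds A) := by
  obtain ⟨M, hM⟩ := h.exists_bound
  have hC := integral_fejer_pos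
  set C := ∫ v, fejer 1 v with hCdef
  rw [tendsto_order]
  constructor
  · intro a ha
    obtain ⟨δ, hδ, hδa⟩ : ∃ δ > 0, a < A * Real.exp (-(2 * δ)) := by
      have : Tendsto (fun δ : ℝ => A * Real.exp (-(2 * δ)))
          (nhdsWithin 0 (Set.Ioi 0)) (nhds A) := by
        have h1 : Continuous fun δ : ℝ => A * Real.exp (-(2 * δ)) := by fun_prop
        simpa using (h1.tendsto 0).mono_left (nhdsWithin_le_nhds (s := Set.Ioi 0))
      obtain ⟨δ, h1, h2⟩ :=
        ((this.eventually (eventually_gt_nhds ha)).and self_mem_nhdsWithin).exists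
      exact ⟨δ, h2, h1⟩
    have hw := tendsto_integral_fejer_window hδ
    have h1 : Tendsto (fun l => (A * (∫ v in Set.Icc (-δ) δ, fejer l v) -
        M * (C - ∫ v in Set.Icc (-δ) δ, fejer l v)) * Real.exp (-(2 * δ)) -
        a * ∫ v in Set.Icc (-δ) δ, fejer l v) atTop
        (nhds ((A * C - M * (C - C)) * Real.exp (-(2 * δ)) - a * C)) :=
      (((hw.const_mul A).sub ((hw.const_sub C).const_mul M)).mul_const _).sub (hw.const_mul a)
    have hpos : 0 < (A * C - M * (C - C)) * Real.exp (-(2 * δ)) - a * C := by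
      have : (A * C - M * (C - C)) * Real.exp (-(2 * δ)) - a * C =
        (A * Real.exp (-(2 * δ)) - a) * C := by ring
      rw [this]
      exact mul_pos (by linarith) hC
    obtain ⟨l, ⟨h2, hWl⟩, hl⟩ := (((h1.eventually (eventually_gt_nhds hpos)).and
      (hw.eventually (eventually_gt_nhds hC))).and (eventually_gt_atTop 0)).exists
    set W := ∫ v in Set.Icc (-δ) δ, fejer l v
    have ht := (tendsto_tentIntegral_atTop hl (G 0)).norm.mul_const (Real.exp (-(2 * δ)))
    rw [norm_zero, zero_mul] at ht
    have h3 := (ht.comp (tendsto_atTop_add_const_right atTop (-δ) tendsto_id)).eventually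
      (eventually_lt_nhds h2)
    filter_upwards [h3, eventually_gt_atTop (2 * δ)] with u hu hu2
    have h4 := h.window_lower hl (δ := δ) (y := u + -δ) (by linarith) hM
    simp only [Function.comp_apply, id_eq] at hu
    rw [neg_add_cancel_right] at h4
    have hee : Real.exp (2 * δ) * Real.exp (-(2 * δ)) = 1 := by rw [← Real.exp_add]; simp
    have h5 := mul_le_mul_of_nonneg_right h4 (Real.exp_pos (-(2 * δ))).le
    have h6 : (M * (C - W) + B u * Real.exp (2 * δ) * W) * Real.exp (-(2 * δ)) =
      M * (C - W) * Real.exp (-(2 * δ)) +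
        B u * W * (Real.exp (2 * δ) * Real.exp (-(2 * δ))) := by ring
    rw [h6, hee] at h5
    have h7 : a * W < B u * W := by nlinarith
    exact lt_of_mul_lt_mul_right h7 hWl.le
  · intro a ha
    obtain ⟨δ, hδ, hδa⟩ : ∃ δ > 0, A < a * Real.exp (-(2 * δ)) := by
      have : Tendsto (fun δ : ℝ => a * Real.exp (-(2 * δ)))
          (nhdsWithin 0 (Set.Ioi 0)) (nhds a) := by
        have h1 : Continuous fun δ : ℝ => a * Real.exp (-(2 * δ)) := by fun_prop
        simpa using (h1.tendsto 0).mono_left (nhdsWithin_le_nhds (s := Set.Ioi 0))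
      obtain ⟨δ, h1, h2⟩ :=
        ((this.eventually (eventually_gt_nhds ha)).and self_mem_nhdsWithin).exists
      exact ⟨δ, h2, h1⟩
    have hw := tendsto_integral_fejer_window hδ
    have h1 : Tendsto
        (fun l => a * Real.exp (-(2 * δ)) * (∫ v in Set.Icc (-δ) δ, fejer l v) - A * C)
        atTop (nhds (a * Real.exp (-(2 * δ)) * C - A * C)) := (hw.const_mul _).sub_const _
    have hpos : 0 < a * Real.exp (-(2 * δ)) * C - A * C := by nlinarith
    obtain ⟨l, ⟨h2, hWl⟩, hl⟩ := (((h1.eventually (eventually_gt_nhds hpos)).and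
      (hw.eventually (eventually_gt_nhds hC))).and (eventually_gt_atTop 0)).exists
    set W := ∫ v in Set.Icc (-δ) δ, fejer l v
    have ht := (tendsto_tentIntegral_atTop hl (G 0)).norm
    rw [norm_zero] at ht
    have h3 := (ht.comp (tendsto_atTop_add_const_right atTop δ tendsto_id)).eventually
      (eventually_lt_nhds h2)
    filter_upwards [h3, eventually_gt_atTop 0] with u hu hu2
    have h4 := h.window_upper hl (δ := δ) (y := u + δ) (by linarith)
    simp only [Function.comp_apply, id_eq] at hu
    rw [add_sub_cancel_right] at h4
    have h5 : B u * (Real.exp (-(2 * δ)) * W) < a * (Real.exp (-(2 * δ)) * W) := by nlinarith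
    exact lt_of_mul_lt_mul_right h5 (by positivity)

end TauberianData

section PartialSum

variable {ι E : Type*} [NormedAddCommGroup E]

/-- The sum of `b i` over the indices `i` with `ℓ i ≤ u`. -/
noncomputable def partialSum (ℓ : ι → ℝ) (b : ι → E) (u : ℝ) : E :=
  ∑' i, if ℓ i ≤ u then b i else 0

variable {ℓ : ι → ℝ}

lemma norm_ite_le (b : ι → E) {σ : ℝ} (hσ : 0 ≤ σ) (u : ℝ) (i : ι) :
    ‖if ℓ i ≤ u then b i else 0‖ ≤ Real.exp (σ * u) * (‖b i‖ * Real.exp (-σ * ℓ i)) := by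
  split_ifs with h
  · have h1 : 1 ≤ Real.exp (σ * u) * Real.exp (-σ * ℓ i) := by
      rw [← Real.exp_add]
      exact Real.one_le_exp (by nlinarith)
    calc ‖b i‖ = ‖b i‖ * 1 := (mul_one _).symm
      _ ≤ ‖b i‖ * (Real.exp (σ * u) * Real.exp (-σ * ℓ i)) :=
        mul_le_mul_of_nonneg_left h1 (norm_nonneg _)
      _ = _ := by ring
  · rw [norm_zero]; positivity

lemma norm_partialSum_le {b : ι → E} {σ : ℝ} (hσ : 0 ≤ σ)
    (hs : Summable fun i => ‖b i‖ * Real.exp (-σ * ℓ i)) (u : ℝ) :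
    ‖partialSum ℓ b u‖ ≤ Real.exp (σ * u) * ∑' i, ‖b i‖ * Real.exp (-σ * ℓ i) :=
  tsum_of_norm_bounded (hs.hasSum.mul_left _) (norm_ite_le b hσ u)

lemma summable_partialSum [CompleteSpace E] {b : ι → E} {σ : ℝ} (hσ : 0 ≤ σ)
    (hs : Summable fun i => ‖b i‖ * Real.exp (-σ * ℓ i)) (u : ℝ) :
    Summable fun i => if ℓ i ≤ u then b i else 0 :=
  Summable.of_norm_bounded (hs.mul_left _) (norm_ite_le b hσ u)

lemma measurable_partialSum [Countable ι] (b : ι → ℂ) :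
    Measurable (partialSum ℓ b) :=
  Measurable.tsum fun _ => Measurable.ite measurableSet_Ici measurable_const measurable_const

lemma ofReal_partialSum (b : ι → ℝ) (u : ℝ) :
    ((partialSum ℓ b u : ℝ) : ℂ) = partialSum ℓ (fun i => (b i : ℂ)) u := by
  simp only [partialSum, Complex.ofReal_tsum]
  congr 1; ext i
  split_ifs <;> simp

lemma norm_cexp_neg_mul (s : ℂ) (u : ℝ) : ‖Complex.exp (-s * u)‖ = Real.exp (-s.re * u) := by
  simp [Complex.norm_exp]

lemma integrableOn_partialSum_mul_cexp [Countable ι] {b : ι → ℂ} {σ : ℝ} (hσ : 0 ≤ σ)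
    (hs : Summable fun i => ‖b i‖ * Real.exp (-σ * ℓ i)) {s : ℂ} (h : σ < s.re) :
    IntegrableOn (fun u : ℝ => partialSum ℓ b u * Complex.exp (-s * u)) (Set.Ioi 0) := by
  have h1 : IntegrableOn (fun u : ℝ => Real.exp ((σ - s.re) * u) *
      ∑' i, ‖b i‖ * Real.exp (-σ * ℓ i)) (Set.Ioi 0) :=
    (integrableOn_exp_mul_Ioi (by linarith) 0).mul_const _
  refine Integrable.mono' h1 ?_ (Eventually.of_forall fun u => ?_)
  · exact ((measurable_partialSum b).mul (by fun_prop)).aestronglyMeasurable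
  · rw [norm_mul, norm_cexp_neg_mul]
    refine (mul_le_mul_of_nonneg_right (norm_partialSum_le hσ hs u) (Real.exp_pos _).le).trans
      (le_of_eq ?_)
    rw [show (σ - s.re) * u = σ * u + -s.re * u by ring, Real.exp_add]
    ring

lemma integral_indicator_cexp {s : ℂ} (hs : 0 < s.re) {a : ℝ} (ha : 0 ≤ a) (c : ℂ) :
    IntegrableOn (fun u : ℝ => (if a ≤ u then c else 0) * Complex.exp (-s * u)) (Set.Ioi 0) ∧
    (∫ u in Set.Ioi (0 : ℝ), (if a ≤ u then c else 0) * Complex.exp (-s * u)) =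
      c * Complex.exp (-s * a) / s := by
  have e : (fun u : ℝ => (if a ≤ u then c else 0) * Complex.exp (-s * u)) =
      (Set.Ici a).indicator (fun u : ℝ => c * Complex.exp (-s * u)) := by
    ext u
    by_cases h : a ≤ u <;> simp [h]
  have e2 : (Set.Ioi (0 : ℝ) ∩ Set.Ici a : Set ℝ) =ᵐ[volume] Set.Ioi a := by
    have h1 : (Set.Ioi (0 : ℝ) ∩ Set.Ici a : Set ℝ) =ᵐ[volume] (Set.Ioi 0 ∩ Set.Ioi a : Set ℝ) :=
      (ae_eq_refl _).inter Ioi_ae_eq_Ici.symm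
    rwa [Set.Ioi_inter_Ioi, sup_eq_right.2 ha] at h1
  have hs' : (-s).re < 0 := by simpa using hs
  rw [e]
  constructor
  · rw [IntegrableOn, integrable_indicator_iff measurableSet_Ici, IntegrableOn,
      Measure.restrict_restrict measurableSet_Ici, Set.inter_comm, Measure.restrict_congr_set e2]
    exact (integrableOn_exp_mul_complex_Ioi hs' a).const_mul c
  · rw [setIntegral_indicator measurableSet_Ici, Measure.restrict_congr_set e2,
      integral_const_mul, integral_exp_mul_complex_Ioi hs' a, neg_div_neg_eq, mul_div_assoc]

lemma integral_partialSum_mul_cexp [Countable ι] (hℓ : ∀ i, 0 ≤ ℓ i) {b : ι → ℂ} {s : ℂ}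
    (h : 0 < s.re) (hs : Summable fun i => ‖b i‖ * Real.exp (-s.re * ℓ i)) :
    ∫ u in Set.Ioi (0 : ℝ), partialSum ℓ b u * Complex.exp (-s * u) =
      (∑' i, b i * Complex.exp (-s * ℓ i)) / s := by
  have h1 := hasSum_integral_of_summable_integral_norm
    (μ := volume.restrict (Set.Ioi (0 : ℝ)))
    (F := fun i (u : ℝ) => (if ℓ i ≤ u then b i else 0) * Complex.exp (-s * u))
    (fun i => (integral_indicator_cexp h (hℓ i) (b i)).1) ?_
  · have h2 : ∀ u : ℝ, ∑' i, (if ℓ i ≤ u then b i else 0) * Complex.exp (-s * u) =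
        partialSum ℓ b u * Complex.exp (-s * u) := fun u => tsum_mul_right
    simp only [h2] at h1
    rw [← h1.tsum_eq, ← tsum_div_const]
    exact tsum_congr fun i => (integral_indicator_cexp h (hℓ i) (b i)).2
  · have h2 : ∀ i, ∫ u in Set.Ioi (0 : ℝ),
        ‖(if ℓ i ≤ u then b i else 0) * Complex.exp (-s * u)‖ =
        ‖b i‖ * Real.exp (-s.re * ℓ i) / s.re := by
      intro i
      have h3 := (integral_indicator_cexp (s := s.re) (by simpa using h) (hℓ i) (‖b i‖ : ℂ)).2
      rw [← Complex.ofReal_inj, ← integral_complex_ofReal]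
      rw [show (((‖b i‖ * Real.exp (-s.re * ℓ i) / s.re : ℝ)) : ℂ) =
        ‖b i‖ * Complex.exp (-s.re * ℓ i) / s.re by push_cast; ring_nf, ← h3]
      congr 1; ext u
      rw [norm_mul, norm_cexp_neg_mul]
      split_ifs <;> simp
    simp only [h2]
    exact hs.div_const _

end PartialSum

/-- A Tauberian theorem of Wiener–Ikehara type for generalized Dirichlet series with nonnegative
coefficients. -/
theorem tendsto_partialSum_of_dirichlet {ι : Type*} [Countable ι] {ℓ b : ι → ℝ}
    (hℓ : ∀ i, 0 ≤ ℓ i) (hb : ∀ i, 0 ≤ b i)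
    (hs : ∀ σ : ℝ, 1 < σ → Summable fun i => b i * Real.exp (-σ * ℓ i))
    {A : ℝ} (hA : 0 ≤ A) {G : ℂ → ℂ} (hG : ContinuousOn G {s | 1 ≤ s.re})
    (hF : ∀ s : ℂ, 1 < s.re → ∑' i, (b i : ℂ) * Complex.exp (-s * ℓ i) = A / (s - 1) + G s) :
    Tendsto (fun u => Real.exp (-u) * partialSum ℓ b u) atTop (nhds A) := by
  have hs' : ∀ σ : ℝ, 1 < σ → Summable fun i => ‖b i‖ * Real.exp (-σ * ℓ i) := fun σ hσ => by
    simpa only [Real.norm_of_nonneg (hb _)] using hs σ hσ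
  have hs'' : ∀ σ : ℝ, 1 < σ → Summable fun i => ‖(b i : ℂ)‖ * Real.exp (-σ * ℓ i) := fun σ hσ => by
    simpa only [Complex.norm_real] using hs' σ hσ
  have hnn : ∀ u, 0 ≤ partialSum ℓ b u := fun u => tsum_nonneg fun i => by
    split_ifs <;> simp [hb]
  have h_int : ∀ ε : ℝ, 0 < ε → ∀ t : ℝ, ∀ u : ℝ,
      ((Real.exp (-u) * partialSum ℓ b u : ℝ) : ℂ) * Complex.exp (-((ε + Complex.I * t) * u)) =
      partialSum ℓ (fun i => (b i : ℂ)) u * Complex.exp (-(1 + ε + Complex.I * t) * u) := by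
    intro ε hε t u
    rw [Complex.ofReal_mul, ofReal_partialSum,
      show -(1 + ε + Complex.I * t) * u = ((-u : ℝ) : ℂ) + -((ε + Complex.I * t) * u) by
        push_cast; ring, Complex.exp_add, Complex.ofReal_exp]
    ring
  refine TauberianData.tendsto (B := fun u => Real.exp (-u) * partialSum ℓ b u) (A := A)
    (G := fun ε t => (G (1 + ε + Complex.I * t) - A) / (1 + ε + Complex.I * t)) ?_
  refine ⟨fun u => mul_nonneg (Real.exp_pos _).le (hnn u), ?_, ?_, hA, ?_, ?_⟩
  · intro u v huv
    have e : ∀ u, Real.exp (-u) * partialSum ℓ b u * Real.exp u = partialSum ℓ b u := fun u => by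
      rw [mul_right_comm, ← Real.exp_add]; simp
    rw [e, e]
    refine (summable_partialSum (by norm_num) (hs' 2 (by norm_num)) u).tsum_le_tsum (fun i => ?_)
      (summable_partialSum (by norm_num) (hs' 2 (by norm_num)) v)
    split_ifs with h1 h2
    · rfl
    · exact absurd (h1.trans huv) h2
    · exact hb i
    · rfl
  · intro ε hε
    have h1 := integrableOn_partialSum_mul_cexp (s := 1 + ε) (by linarith)
      (hs'' (1 + ε / 2) (by linarith)) (by simpa using hε)
    have h2 := h1.norm
    refine h2.congr (Eventually.of_forall fun u => ?_)
    have h3 := h_int ε hε 0 u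
    simp only [Complex.ofReal_zero, mul_zero, add_zero] at h3
    simp only
    rw [← h3, norm_mul, Complex.norm_real, Real.norm_of_nonneg
      (mul_nonneg (Real.exp_pos _).le (hnn u)), ← neg_mul, norm_cexp_neg_mul]
    simp
  · have hc : Continuous fun p : ℝ × ℝ => (1 + p.1 + Complex.I * p.2 : ℂ) := by fun_prop
    have hmaps : Set.MapsTo (fun p : ℝ × ℝ => (1 + p.1 + Complex.I * p.2 : ℂ))
        (Set.Ici 0 ×ˢ Set.univ) {s | 1 ≤ s.re} := by
      rintro ⟨x, y⟩ h
      simpa using h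
    refine ((hG.comp hc.continuousOn hmaps).sub continuousOn_const).div hc.continuousOn ?_
    intro p hp h0
    have h1 : 1 ≤ (1 + p.1 + Complex.I * p.2 : ℂ).re := hmaps hp
    rw [h0] at h1
    norm_num at h1
  · intro ε hε t
    have hre : (1 + ε + Complex.I * t : ℂ).re = 1 + ε := by simp
    simp only [h_int ε hε t]
    have h0 : (ε + Complex.I * t : ℂ) ≠ 0 := fun h => by
      have := congrArg Complex.re h; simp at this; linarith
    have h1 : (1 + ε + Complex.I * t : ℂ) ≠ 0 := fun h => by
      have := congrArg Complex.re h; rw [hre] at this; simp at this; linarith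
    rw [integral_partialSum_mul_cexp hℓ (by rw [hre]; linarith)
      (by rw [hre]; exact hs'' _ (by linarith)), hF _ (by rw [hre]; linarith)]
    rw [show (1 + ε + Complex.I * t - 1 : ℂ) = ε + Complex.I * t by ring]
    field_simp
    ring

/-- A generalized Dirichlet series whose coefficients have mean value `c` with a power-saving error
term extends analytically, up to a simple pole at `1`, beyond the line `re s = 1`. -/
theorem exists_continuation_of_mean_value {ι : Type*} [Countable ι] {ℓ : ι → ℝ} {b : ι → ℂ}
    (hℓ : ∀ i, 0 ≤ ℓ i)
    (hs : ∀ σ : ℝ, 1 < σ → Summable fun i => ‖b i‖ * Real.exp (-σ * ℓ i))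
    {c : ℂ} {C r : ℝ} 
    (hmean : ∀ u, 0 < u → ‖partialSum ℓ b u - c * Real.exp u‖ ≤ C * Real.exp (r * u)) :
    ∃ E : ℂ → ℂ, DifferentiableOn ℂ E {s | r < s.re} ∧
      ∀ s : ℂ, 1 < s.re → ∑' i, b i * Complex.exp (-s * ℓ i) = s * E s + c * s / (s - 1) := by
  set D : ℝ → ℂ := fun u => partialSum ℓ b u - c * Real.exp u with hD
  have hDm : Measurable D := (measurable_partialSum b).sub (by fun_prop)
  refine ⟨fun s => ∫ u in Set.Ioi (0 : ℝ), D u * Complex.exp (-s * u), ?_, ?_⟩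
  · intro s₀ hs₀
    rw [Set.mem_ofPred_eq] at hs₀
    set δ := (s₀.re - r) / 4 with hδ
    have hδ0 : 0 < δ := by rw [hδ]; linarith
    have hbd : IntegrableOn (fun u : ℝ => C * δ⁻¹ * Real.exp (-δ * u)) (Set.Ioi 0) :=
      (integrableOn_exp_mul_Ioi (by linarith) 0).const_mul _
    have hmain := hasDerivAt_integral_of_dominated_loc_of_deriv_le
      (μ := volume.restrict (Set.Ioi (0 : ℝ))) (F := fun s (u : ℝ) => D u * Complex.exp (-s * u))
      (F' := fun s (u : ℝ) => D u * (Complex.exp (-s * u) * (-u))) (x₀ := s₀)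
      (s := Metric.ball s₀ δ) (bound := fun u => C * δ⁻¹ * Real.exp (-δ * u))
      (Metric.ball_mem_nhds _ hδ0) ?_ ?_ ?_ ?_ hbd ?_
    · exact hmain.2.differentiableAt.differentiableWithinAt
    · exact Eventually.of_forall fun s => (hDm.mul (by fun_prop)).aestronglyMeasurable
    · refine Integrable.mono' (g := fun u : ℝ => C * Real.exp ((r - s₀.re) * u)) ?_
        (hDm.mul (by fun_prop)).aestronglyMeasurable ?_
      · exact (integrableOn_exp_mul_Ioi (by linarith) 0).const_mul _
      · refine (ae_restrict_iff' measurableSet_Ioi).2 (Eventually.of_forall fun u hu => ?_)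
        rw [norm_mul, norm_cexp_neg_mul]
        refine (mul_le_mul_of_nonneg_right (hmean u hu) (Real.exp_pos _).le).trans (le_of_eq ?_)
        rw [sub_mul, sub_eq_add_neg, Real.exp_add, neg_mul]
        ring
    · exact (hDm.mul (by fun_prop)).aestronglyMeasurable
    · refine (ae_restrict_iff' measurableSet_Ioi).2 (Eventually.of_forall fun u hu s hsb => ?_)
      have hu' : (0 : ℝ) < u := hu
      have hre : s₀.re - δ < s.re := by
        have h1 := Complex.abs_re_le_norm (s - s₀)
        rw [Metric.mem_ball, dist_eq_norm] at hsb
        have := (abs_lt.1 (h1.trans_lt hsb)).1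
        rw [Complex.sub_re] at this
        linarith
      rw [norm_mul, norm_mul, norm_cexp_neg_mul, norm_neg, Complex.norm_real,
        Real.norm_of_nonneg hu'.le]
      have hC : 0 ≤ C * Real.exp (r * u) := (norm_nonneg _).trans (hmean u hu)
      have h2 : u ≤ δ⁻¹ * Real.exp (δ * u) := by
        rw [inv_mul_eq_div, le_div_iff₀ hδ0]
        linarith [Real.add_one_le_exp (δ * u)]
      calc ‖D u‖ * (Real.exp (-s.re * u) * u)
          ≤ (C * Real.exp (r * u)) * (Real.exp ((-s₀.re + δ) * u) * (δ⁻¹ * Real.exp (δ * u))) := by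
            refine mul_le_mul (hmean u hu) (mul_le_mul (Real.exp_le_exp.2 ?_) h2 hu'.le
              (Real.exp_pos _).le) (by positivity) hC
            nlinarith
        _ = C * δ⁻¹ * (Real.exp (r * u) * Real.exp ((-s₀.re + δ) * u) * Real.exp (δ * u)) := by ring
        _ = C * δ⁻¹ * Real.exp ((-2 * δ) * u) := by
            rw [← Real.exp_add, ← Real.exp_add]
            congr 2
            rw [hδ]; ring
        _ ≤ C * δ⁻¹ * Real.exp (-δ * u) := by
            refine mul_le_mul_of_nonneg_left (Real.exp_le_exp.2 (by nlinarith)) ?_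
            have : 0 ≤ C := nonneg_of_mul_nonneg_left hC (Real.exp_pos _)
            positivity
    · refine Eventually.of_forall fun u s _ => ?_
      have h1 : HasDerivAt (fun s : ℂ => -s * (u : ℂ)) (-(u : ℂ)) s := by
        simpa using (hasDerivAt_id s).neg.mul_const (u : ℂ)
      exact (h1.cexp).const_mul (D u)
  · intro s hs1
    have hs0 : s ≠ 0 := by rintro rfl; norm_num at hs1
    have hs2 : s - 1 ≠ 0 := fun h => by
      rw [sub_eq_zero] at h; rw [h] at hs1; norm_num at hs1
    have i1 := integrableOn_partialSum_mul_cexp (σ := (1 + s.re) / 2) (by linarith)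
      (hs _ (by linarith)) (s := s) (by linarith)
    have e2 : ∀ u : ℝ, c * Real.exp u * Complex.exp (-s * u) = c * Complex.exp ((1 - s) * u) := by
      intro u
      rw [mul_assoc, Complex.ofReal_exp, ← Complex.exp_add]
      ring_nf
    have hre : (1 - s).re < 0 := by simpa using hs1
    have i2 : IntegrableOn (fun u : ℝ => c * Real.exp u * Complex.exp (-s * u)) (Set.Ioi 0) := by
      simp only [e2]
      exact (integrableOn_exp_mul_complex_Ioi hre 0).const_mul c
    have h3 : ∫ u in Set.Ioi (0 : ℝ), D u * Complex.exp (-s * u) =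
        (∑' i, b i * Complex.exp (-s * ℓ i)) / s - c / (s - 1) := by
      simp only [hD, sub_mul]
      rw [integral_sub i1 i2, integral_partialSum_mul_cexp hℓ (by linarith) (hs _ hs1)]
      simp only [e2]
      rw [integral_const_mul, integral_exp_mul_complex_Ioi hre 0]
      rw [show (1 - s) = -(s - 1) by ring, neg_div_neg_eq]
      simp [div_eq_mul_inv]
    simp only [h3]
    field_simp
    ring

/-- A counting function bounded by `C * exp u` yields convergence of the associated Dirichlet series
to the right of `1`. -/
lemma summable_of_card_le {ι : Type*} {ℓ : ι → ℝ} (hℓ : ∀ i, 0 ≤ ℓ i)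
    {C : ℝ} (hC : ∀ (F : Finset ι) (u : ℝ), 0 < u →
      ((F.filter fun i => ℓ i ≤ u).card : ℝ) ≤ C * Real.exp u) {σ : ℝ} (hσ : 1 < σ) :
    Summable fun i => Real.exp (-σ * ℓ i) := by
  refine summable_of_sum_le (c := σ * (C / (σ - 1))) (fun i => (Real.exp_pos _).le) fun F => ?_
  have hσ0 : (σ : ℂ) ≠ 0 := by exact_mod_cast (by linarith : σ ≠ 0)
  have h1 := integral_partialSum_mul_cexp (ι := F) (ℓ := fun i => ℓ i) (b := fun _ => 1) (s := σ)
    (fun i => hℓ i) (by simp; linarith) (Summable.of_finite)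
  rw [tsum_fintype, Finset.sum_coe_sort F (fun i => (1 : ℂ) * Complex.exp (-(σ : ℂ) * ℓ i)),
    eq_div_iff hσ0] at h1
  have h2 : ((∑ i ∈ F, Real.exp (-σ * ℓ i) : ℝ) : ℂ) =
      ∑ i ∈ F, (1 : ℂ) * Complex.exp (-(σ : ℂ) * ℓ i) := by
    push_cast; simp
  have hi : IntegrableOn (fun u : ℝ => C * Real.exp ((1 - σ) * u)) (Set.Ioi 0) :=
    (integrableOn_exp_mul_Ioi (by linarith) 0).const_mul C
  have h3 : ‖∫ u in Set.Ioi (0 : ℝ), partialSum (fun i : F => ℓ i) (fun _ => (1 : ℂ)) u *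
      Complex.exp (-(σ : ℂ) * u)‖ ≤ ∫ u in Set.Ioi (0 : ℝ), C * Real.exp ((1 - σ) * u) := by
    refine norm_integral_le_of_norm_le hi ((ae_restrict_iff' measurableSet_Ioi).2
      (Eventually.of_forall fun u hu => ?_))
    rw [norm_mul, norm_cexp_neg_mul, sub_mul, sub_eq_add_neg, Real.exp_add, ← neg_mul, one_mul,
      Complex.ofReal_re, ← mul_assoc]
    refine mul_le_mul_of_nonneg_right (le_trans (le_of_eq ?_) (hC F u hu)) (Real.exp_pos _).le
    rw [partialSum, tsum_fintype, Finset.sum_coe_sort F (fun i => if ℓ i ≤ u then (1 : ℂ) else 0),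
      Finset.sum_boole]
    simp
  rw [integral_const_mul, integral_exp_mul_Ioi (by linarith)] at h3
  calc ∑ i ∈ F, Real.exp (-σ * ℓ i) = ‖((∑ i ∈ F, Real.exp (-σ * ℓ i) : ℝ) : ℂ)‖ := by
        rw [Complex.norm_real,
          Real.norm_of_nonneg (Finset.sum_nonneg fun i _ => (Real.exp_pos _).le)]
    _ ≤ σ * (C / (σ - 1)) := by
        rw [h2, ← h1, norm_mul, mul_comm, Complex.norm_real, Real.norm_of_nonneg (by linarith)]
        refine mul_le_mul_of_nonneg_left (h3.trans (le_of_eq ?_)) (by linarith)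
        rw [show 1 - σ = -(σ - 1) by ring, neg_div_neg_eq]
        simp [div_eq_mul_inv]

section LSeries

variable {K : Type*} [Field K] [NumberField K]

instance countable_ideal : Countable (Ideal (𝓞 K)) := by
  have h : (Set.univ : Set (Ideal (𝓞 K))) = ⋃ n : ℕ, {I | Ideal.absNorm I ≤ n} := by
    ext I
    simpa using ⟨Ideal.absNorm I, le_rfl⟩
  rw [← Set.countable_univ_iff, h]
  exact Set.countable_iUnion fun n => (Ideal.finite_setOfPred_absNorm_le n).countable

/-- The logarithm of the absolute norm of an ideal. -/
noncomputable def logNorm (𝔞 : Ideal (𝓞 K)) : ℝ := Real.log (Ideal.absNorm 𝔞)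

lemma logNorm_nonneg (𝔞 : Ideal (𝓞 K)) : 0 ≤ logNorm 𝔞 := Real.log_natCast_nonneg _

lemma logNorm_mul {𝔞 𝔟 : Ideal (𝓞 K)} (ha : 𝔞 ≠ ⊥) (hb : 𝔟 ≠ ⊥) :
    logNorm (𝔞 * 𝔟) = logNorm 𝔞 + logNorm 𝔟 := by
  rw [logNorm, map_mul, Nat.cast_mul, Real.log_mul]
  · rfl
  · simpa [Ideal.absNorm_eq_zero_iff] using ha
  · simpa [Ideal.absNorm_eq_zero_iff] using hb

lemma logNorm_pow {𝔞 : Ideal (𝓞 K)} (j : ℕ) : logNorm (𝔞 ^ j) = j * logNorm 𝔞 := by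
  rw [logNorm, map_pow, Nat.cast_pow, Real.log_pow]; rfl

lemma two_le_absNorm {𝔭 : Ideal (𝓞 K)} (h0 : 𝔭 ≠ ⊥) (h1 : 𝔭 ≠ ⊤) :
    2 ≤ Ideal.absNorm 𝔭 := by
  have := Ideal.absNorm_eq_zero_iff.not.2 h0
  have := Ideal.absNorm_eq_one_iff.not.2 h1
  omega

omit [NumberField K] in
lemma prime_ne_top {𝔭 : Ideal (𝓞 K)} (h : Prime 𝔭) : 𝔭 ≠ ⊤ := fun h' =>
  h.not_isUnit (by rw [h', ← Ideal.one_eq_top]; exact isUnit_one)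

lemma log_two_le_logNorm {𝔭 : Ideal (𝓞 K)} (h0 : 𝔭 ≠ ⊥) (h1 : 𝔭 ≠ ⊤) :
    Real.log 2 ≤ logNorm 𝔭 :=
  Real.log_le_log (by norm_num) (by exact_mod_cast two_le_absNorm h0 h1)

lemma exp_logNorm {𝔞 : Ideal (𝓞 K)} (h : 𝔞 ≠ ⊥) :
    Real.exp (logNorm 𝔞) = Ideal.absNorm 𝔞 :=
  Real.exp_log (by exact_mod_cast Nat.pos_of_ne_zero (Ideal.absNorm_eq_zero_iff.not.2 h))

lemma logNorm_le_iff {𝔞 : Ideal (𝓞 K)} {u : ℝ} (hu : 0 ≤ u) :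
    logNorm 𝔞 ≤ u ↔ (Ideal.absNorm 𝔞 : ℝ) ≤ Real.exp u := by
  by_cases h : 𝔞 = ⊥
  · simp [h, logNorm, hu, Real.exp_nonneg]
  · rw [← exp_logNorm h, Real.exp_le_exp]

lemma finite_logNorm_le (K : Type*) [Field K] [NumberField K] (u : ℝ) :
    {𝔞 : Ideal (𝓞 K) | logNorm 𝔞 ≤ u}.Finite := by
  refine (Ideal.finite_setOfPred_absNorm_le (S := 𝓞 K) ⌈Real.exp (max u 0)⌉₊).subset fun I hI => ?_
  have h1 : logNorm I ≤ max u 0 := le_trans hI (le_max_left _ _)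
  rw [logNorm_le_iff (le_max_right _ _)] at h1
  exact_mod_cast h1.trans (Nat.le_ceil _)

lemma exists_card_logNorm_le (K : Type*) [Field K] [NumberField K] :
    ∃ C : ℝ, ∀ (F : Finset (Ideal (𝓞 K))) (u : ℝ), 0 < u →
      ((F.filter fun i => logNorm i ≤ u).card : ℝ) ≤ C * Real.exp u := by
  have h := NumberField.Ideal.tendsto_norm_le_div_atTop K
  obtain ⟨c, hc⟩ := h.isBoundedUnder_le
  rw [eventually_map, eventually_atTop] at hc
  obtain ⟨s₀, hs₀⟩ := hc
  set s₁ := max s₀ 1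
  have hfin : ∀ s : ℝ, Finite {I : Ideal (𝓞 K) // (Ideal.absNorm I : ℝ) ≤ s} := fun s => by
    refine ((Ideal.finite_setOfPred_absNorm_le (S := 𝓞 K) ⌈s⌉₊).subset fun I hI => ?_)
    have hI : (Ideal.absNorm I : ℝ) ≤ s := hI
    exact_mod_cast hI.trans (Nat.le_ceil _)
  have hle : ∀ s : ℝ, s₁ ≤ s →
      (Nat.card {I : Ideal (𝓞 K) // (Ideal.absNorm I : ℝ) ≤ s} : ℝ) ≤ c * s :=
    fun s hs => (div_le_iff₀ (by linarith [le_max_right s₀ 1])).1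
      (hs₀ s ((le_max_left _ _).trans hs))
  have h1 : (1 : ℝ) ≤ s₁ := le_max_right _ _
  have hc0 : 0 ≤ c := by
    have := (Nat.cast_nonneg _).trans (hle s₁ le_rfl)
    exact nonneg_of_mul_nonneg_left this (by linarith)
  refine ⟨c * s₁, fun F u hu => ?_⟩
  have hu1 : 1 ≤ Real.exp u := Real.one_le_exp hu.le
  have h2 : (F.filter fun i => logNorm i ≤ u).card ≤
      Nat.card {I : Ideal (𝓞 K) // (Ideal.absNorm I : ℝ) ≤ s₁ * Real.exp u} := by
    have hf : {I : Ideal (𝓞 K) | (Ideal.absNorm I : ℝ) ≤ s₁ * Real.exp u}.Finite :=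
      hfin (s₁ * Real.exp u)
    have h := Set.ncard_le_ncard (s := (F.filter fun i => logNorm i ≤ u : Finset (Ideal (𝓞 K))))
      (fun I hI => ?_) hf
    · rwa [Set.ncard_coe_finset] at h
    · have h3 := (logNorm_le_iff hu.le).1 (Finset.mem_filter.1 hI).2
      exact h3.trans (by nlinarith)
  have h3 : ((F.filter fun i => logNorm i ≤ u).card : ℝ) ≤
      Nat.card {I : Ideal (𝓞 K) // (Ideal.absNorm I : ℝ) ≤ s₁ * Real.exp u} := by exact_mod_cast h2
  rw [mul_assoc]
  exact h3.trans (hle _ (by nlinarith))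

lemma summable_exp_logNorm (K : Type*) [Field K] [NumberField K] {σ : ℝ} (hσ : 1 < σ) :
    Summable fun 𝔞 : Ideal (𝓞 K) => Real.exp (-σ * logNorm 𝔞) := by
  obtain ⟨C, hC⟩ := exists_card_logNorm_le K
  exact summable_of_card_le logNorm_nonneg hC hσ

lemma summable_logNorm_mul_exp (K : Type*) [Field K] [NumberField K] {σ : ℝ} (hσ : 1 < σ) :
    Summable fun 𝔞 : Ideal (𝓞 K) => logNorm 𝔞 * Real.exp (-σ * logNorm 𝔞) := by
  set δ := (σ - 1) / 2 with hδ
  have hδ0 : 0 < δ := by rw [hδ]; linarith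
  refine Summable.of_nonneg_of_le (fun 𝔞 => mul_nonneg (logNorm_nonneg _) (Real.exp_pos _).le)
    (fun 𝔞 => ?_) ((summable_exp_logNorm K (σ := σ - δ) (by linarith)).mul_left δ⁻¹)
  have h2 : logNorm 𝔞 ≤ δ⁻¹ * Real.exp (δ * logNorm 𝔞) := by
    rw [inv_mul_eq_div, le_div_iff₀ hδ0]
    linarith [Real.add_one_le_exp (δ * logNorm 𝔞)]
  calc _ ≤ δ⁻¹ * Real.exp (δ * logNorm 𝔞) * Real.exp (-σ * logNorm 𝔞) :=
        mul_le_mul_of_nonneg_right h2 (Real.exp_pos _).le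
    _ = _ := by rw [mul_assoc, ← Real.exp_add]; ring_nf

/-- The term of the `L`-series of `χ` at `s` indexed by `𝔞`. -/
noncomputable def lterm (χ : Ideal (𝓞 K) →*₀ ℂ) (s : ℂ) (𝔞 : Ideal (𝓞 K)) : ℂ :=
  χ 𝔞 * Complex.exp (-s * logNorm 𝔞)

/-- The `L`-series of a completely multiplicative function on ideals. -/
noncomputable def lseries (χ : Ideal (𝓞 K) →*₀ ℂ) (s : ℂ) : ℂ := ∑' 𝔞, lterm χ s 𝔞

/-- Pairs `(𝔭, j)` stand for the prime power `𝔭 ^ (j + 1)`. -/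
abbrev PrimePow (K : Type*) [Field K] [NumberField K] := {𝔭 : Ideal (𝓞 K) // Prime 𝔭} × ℕ

/-- The von Mangoldt series of a completely multiplicative function on ideals. -/
noncomputable def pseries (χ : Ideal (𝓞 K) →*₀ ℂ) (s : ℂ) : ℂ :=
  ∑' q : PrimePow K, (logNorm q.1.1 : ℂ) * lterm χ s (q.1.1 ^ (q.2 + 1))

variable {χ : Ideal (𝓞 K) →*₀ ℂ}

lemma lterm_bot (s : ℂ) : lterm χ s ⊥ = 0 := by
  rw [lterm, ← Ideal.zero_eq_bot, map_zero, zero_mul]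

lemma lterm_mul (s : ℂ) (𝔞 𝔟 : Ideal (𝓞 K)) : lterm χ s (𝔞 * 𝔟) = lterm χ s 𝔞 * lterm χ s 𝔟 := by
  by_cases ha : 𝔞 = ⊥
  · simp [ha, lterm_bot]
  by_cases hb : 𝔟 = ⊥
  · simp [hb, lterm_bot]
  rw [lterm, logNorm_mul ha hb, map_mul, Complex.ofReal_add, mul_add, Complex.exp_add, lterm, lterm]
  ring

lemma norm_lterm_le (hχ : ∀ 𝔞, ‖χ 𝔞‖ ≤ 1) (s : ℂ) (𝔞 : Ideal (𝓞 K)) :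
    ‖lterm χ s 𝔞‖ ≤ Real.exp (-s.re * logNorm 𝔞) := by
  rw [lterm, norm_mul, norm_cexp_neg_mul]
  exact mul_le_of_le_one_left (Real.exp_pos _).le (hχ _)

lemma summable_lterm (hχ : ∀ 𝔞, ‖χ 𝔞‖ ≤ 1) {s : ℂ} (hs : 1 < s.re) :
    Summable fun 𝔞 => ‖lterm χ s 𝔞‖ :=
  Summable.of_nonneg_of_le (fun _ => norm_nonneg _) (norm_lterm_le hχ s)
    (summable_exp_logNorm K hs)

lemma hasDerivAt_lseries (hχ : ∀ 𝔞, ‖χ 𝔞‖ ≤ 1) {s : ℂ} (hs : 1 < s.re) :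
    HasDerivAt (lseries χ) (-∑' 𝔞, (logNorm 𝔞 : ℂ) * lterm χ s 𝔞) s := by
  set σ := (1 + s.re) / 2 with hσ
  have hσ1 : 1 < σ := by rw [hσ]; linarith
  have h1 := hasDerivAt_tsum_of_isPreconnected (t := {z : ℂ | σ < z.re}) (y₀ := s) (y := s)
    (g := fun 𝔞 z => lterm χ z 𝔞) (g' := fun 𝔞 z => -((logNorm 𝔞 : ℂ) * lterm χ z 𝔞))
    (summable_logNorm_mul_exp K hσ1)
    (isOpen_lt continuous_const Complex.continuous_re)
    (convex_halfSpace_re_gt σ).isPreconnected ?_ ?_ ?_ ?_ ?_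
  · rwa [tsum_neg] at h1
  · intro 𝔞 z _
    have h1 : HasDerivAt (fun s : ℂ => -s * (logNorm 𝔞 : ℂ)) (-(logNorm 𝔞 : ℂ)) z := by
      simpa using (hasDerivAt_id z).neg.mul_const (logNorm 𝔞 : ℂ)
    have h2 := (h1.cexp).const_mul (χ 𝔞)
    refine h2.congr_deriv ?_
    rw [lterm]; ring
  · intro 𝔞 z hz
    rw [norm_neg, norm_mul, Complex.norm_real, Real.norm_of_nonneg (logNorm_nonneg _)]
    refine mul_le_mul_of_nonneg_left ((norm_lterm_le hχ z 𝔞).trans (Real.exp_le_exp.2 ?_))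
      (logNorm_nonneg _)
    have : σ < z.re := hz
    nlinarith [logNorm_nonneg 𝔞]
  · change σ < s.re
    rw [hσ]; linarith
  · exact (summable_lterm hχ hs).of_norm
  · change σ < s.re
    rw [hσ]; linarith

lemma exp_primePow_le (q : PrimePow K) {σ : ℝ} (hσ : 1 ≤ σ) :
    Real.exp (-σ * logNorm (q.1.1 ^ (q.2 + 1))) ≤
      Real.exp (-σ * logNorm q.1.1) * (1 / 2) ^ q.2 := by
  have h4 : ((1 : ℝ) / 2) = Real.exp (-Real.log 2) := by
    rw [Real.exp_neg, Real.exp_log (by norm_num)]; norm_num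
  rw [logNorm_pow, h4, ← Real.exp_nat_mul, ← Real.exp_add, Real.exp_le_exp]
  have h5 := log_two_le_logNorm q.1.2.ne_zero (prime_ne_top q.1.2)
  have h6 := logNorm_nonneg q.1.1
  have h7 : (q.2 : ℝ) * Real.log 2 ≤ q.2 * (σ * logNorm q.1.1) := by
    refine mul_le_mul_of_nonneg_left ?_ (Nat.cast_nonneg _)
    nlinarith
  push_cast
  nlinarith

lemma summable_vonMangoldt (K : Type*) [Field K] [NumberField K] {σ : ℝ} (hσ : 1 < σ) :
    Summable fun q : PrimePow K =>
      logNorm q.1.1 * Real.exp (-σ * logNorm (q.1.1 ^ (q.2 + 1))) := by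
  have h1 : Summable fun p : {𝔭 : Ideal (𝓞 K) // Prime 𝔭} =>
      logNorm p.1 * Real.exp (-σ * logNorm p.1) :=
    (summable_logNorm_mul_exp K hσ).comp_injective Subtype.val_injective
  refine Summable.of_nonneg_of_le (fun _ => mul_nonneg (logNorm_nonneg _) (Real.exp_pos _).le)
    (fun q => ?_) (h1.mul_of_nonneg summable_geometric_two
      (fun p => mul_nonneg (logNorm_nonneg _) (Real.exp_pos _).le) (fun j => by positivity))
  rw [mul_assoc]
  exact mul_le_mul_of_nonneg_left (exp_primePow_le q hσ.le) (logNorm_nonneg _)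

lemma norm_logNorm_mul_lterm_le (hχ : ∀ 𝔞, ‖χ 𝔞‖ ≤ 1) {s : ℂ} {σ : ℝ} (hs : σ ≤ s.re)
    (𝔭 𝔞 : Ideal (𝓞 K)) :
    ‖(logNorm 𝔭 : ℂ) * lterm χ s 𝔞‖ ≤ logNorm 𝔭 * Real.exp (-σ * logNorm 𝔞) := by
  rw [norm_mul, Complex.norm_real, Real.norm_of_nonneg (logNorm_nonneg _)]
  refine mul_le_mul_of_nonneg_left ((norm_lterm_le hχ s _).trans (Real.exp_le_exp.2 ?_))
    (logNorm_nonneg _)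
  nlinarith [logNorm_nonneg 𝔞]

lemma summable_pseries (hχ : ∀ 𝔞, ‖χ 𝔞‖ ≤ 1) {s : ℂ} (hs : 1 < s.re) :
    Summable fun q : PrimePow K => ‖(logNorm q.1.1 : ℂ) * lterm χ s (q.1.1 ^ (q.2 + 1))‖ :=
  Summable.of_nonneg_of_le (fun _ => norm_nonneg _)
    (fun _ => norm_logNorm_mul_lterm_le hχ le_rfl _ _) (summable_vonMangoldt K hs)

lemma continuous_lterm (𝔞 : Ideal (𝓞 K)) : Continuous fun s => lterm χ s 𝔞 := by
  unfold lterm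
  fun_prop

lemma continuousOn_pseries (hχ : ∀ 𝔞, ‖χ 𝔞‖ ≤ 1) {σ : ℝ} (hσ : 1 < σ) :
    ContinuousOn (pseries χ) {s | σ ≤ s.re} :=
  continuousOn_tsum (fun _ => (continuous_const.mul (continuous_lterm _)).continuousOn)
    (summable_vonMangoldt K hσ) fun _ _ hs => norm_logNorm_mul_lterm_le hχ hs _ _

lemma tsum_primePow_dvd {𝔞 : Ideal (𝓞 K)} (ha : 𝔞 ≠ ⊥) :
    ∑' q : PrimePow K,
      (open Classical in if q.1.1 ^ (q.2 + 1) ∣ 𝔞 then (logNorm q.1.1 : ℂ) else 0) =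
      logNorm 𝔞 := by
  classical
  set nf := UniqueFactorizationMonoid.normalizedFactors 𝔞 with hnf
  have hprime : ∀ p ∈ nf, Prime p := fun p hp =>
    UniqueFactorizationMonoid.prime_of_normalized_factor p hp
  have hdvd : ∀ q : PrimePow K, q.1.1 ^ (q.2 + 1) ∣ 𝔞 ↔ q.2 < nf.count q.1.1 := by
    intro q
    rw [pow_dvd_iff_le_emultiplicity,
      UniqueFactorizationMonoid.emultiplicity_eq_count_normalizedFactors q.1.2.irreducible ha,
      normalize_eq, Nat.cast_le]
    exact Nat.succ_le_iff
  simp only [hdvd]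
  have hle : ∀ p, nf.count p ≤ Multiset.card nf := fun p => Multiset.count_le_card p nf
  rw [tsum_eq_sum (s := (nf.toFinset.subtype Prime) ×ˢ Finset.range (Multiset.card nf))]
  · rw [Finset.sum_product]
    have h1 : ∀ p : {𝔭 : Ideal (𝓞 K) // Prime 𝔭}, (∑ j ∈ Finset.range (Multiset.card nf),
        if j < nf.count p.1 then (logNorm p.1 : ℂ) else 0) = nf.count p.1 • (logNorm p.1 : ℂ) := by
      intro p
      rw [← Finset.sum_filter, Finset.sum_const]
      congr 1
      have : (Finset.range (Multiset.card nf)).filter (fun j => j < nf.count p.1) =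
          Finset.range (nf.count p.1) := by
        ext j
        simp only [Finset.mem_filter, Finset.mem_range]
        exact ⟨fun h => h.2, fun h => ⟨h.trans_le (hle _), h⟩⟩
      rw [this, Finset.card_range]
    simp only [h1]
    rw [Finset.sum_subtype_of_mem (f := fun p => nf.count p • (logNorm p : ℂ))
      (fun p hp => hprime p (Multiset.mem_toFinset.1 hp)), ← Finset.sum_multiset_map_count]
    have h2 : ∀ m : Multiset (Ideal (𝓞 K)), (∀ p ∈ m, p ≠ ⊥) →
        (m.map fun p => (logNorm p : ℂ)).sum = logNorm m.prod := by
      intro m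
      induction m using Multiset.induction_on with
      | empty => simp [logNorm]
      | cons p m ih =>
        intro h
        rw [Multiset.map_cons, Multiset.sum_cons, Multiset.prod_cons, logNorm_mul (h p (by simp)),
          ih fun p' hp' => h p' (by simp [hp'])]
        · push_cast; rfl
        · intro h0
          rw [← Ideal.zero_eq_bot, Multiset.prod_eq_zero_iff] at h0
          exact h 0 (Multiset.mem_cons_of_mem h0) rfl
    rw [h2 nf fun p hp => (hprime p hp).ne_zero,
      associated_iff_eq.1 (UniqueFactorizationMonoid.prod_normalizedFactors ha)]
  · intro q hq
    rw [if_neg]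
    intro h
    refine hq (Finset.mem_product.2 ⟨Finset.mem_subtype.2 (Multiset.mem_toFinset.2 ?_),
      Finset.mem_range.2 (h.trans_le (hle _))⟩)
    exact Multiset.count_pos.1 (by omega)

lemma pseries_mul_lseries (hχ : ∀ 𝔞, ‖χ 𝔞‖ ≤ 1) {s : ℂ} (hs : 1 < s.re) :
    pseries χ s * lseries χ s = ∑' 𝔞, (logNorm 𝔞 : ℂ) * lterm χ s 𝔞 := by
  classical
  have hP := summable_pseries hχ hs
  have hL := summable_lterm hχ hs
  rw [pseries, lseries, tsum_mul_tsum_of_summable_norm hP hL]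
  have h1 := ((summable_mul_of_summable_norm hP hL).hasSum).tsum_fiberwise
    (fun x : PrimePow K × Ideal (𝓞 K) => x.1.1.1 ^ (x.1.2 + 1) * x.2)
  rw [← h1.tsum_eq]
  refine tsum_congr fun 𝔞 => ?_
  set m : PrimePow K × Ideal (𝓞 K) → Ideal (𝓞 K) := fun x => x.1.1.1 ^ (x.1.2 + 1) * x.2 with hm
  have h2 : ∀ x : (m ⁻¹' {𝔞}), (logNorm x.1.1.1.1 : ℂ) * lterm χ s (x.1.1.1.1 ^ (x.1.1.2 + 1)) *
      lterm χ s x.1.2 = logNorm x.1.1.1.1 * lterm χ s 𝔞 := by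
    intro x
    rw [mul_assoc, ← lterm_mul]
    congr 2
    exact x.2
  simp only [h2]
  rw [tsum_mul_right]
  by_cases ha : 𝔞 = ⊥
  · rw [ha, lterm_bot, mul_zero, mul_zero]
  congr 1
  rw [← tsum_primePow_dvd ha]
  have hinj : Function.Injective (fun x : (m ⁻¹' {𝔞}) => x.1.1) := by
    rintro ⟨⟨q, b⟩, hx⟩ ⟨⟨q', b'⟩, hx'⟩ h
    simp only at h
    subst h
    have hx : q.1.1 ^ (q.2 + 1) * b = 𝔞 := hx
    have hx' : q.1.1 ^ (q.2 + 1) * b' = 𝔞 := hx'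
    have := mul_left_cancel₀ (pow_ne_zero _ q.1.2.ne_zero) (hx.trans hx'.symm)
    subst this
    rfl
  rw [← hinj.tsum_eq]
  · refine tsum_congr fun x => ?_
    rw [if_pos (Dvd.intro _ x.2)]
  · intro q hq
    rw [Function.mem_support, ne_eq, ite_eq_right_iff, not_forall] at hq
    obtain ⟨⟨b, hb⟩, _⟩ := hq
    exact ⟨⟨(q, b), hb.symm⟩, rfl⟩

lemma hasDerivAt_lseries' (hχ : ∀ 𝔞, ‖χ 𝔞‖ ≤ 1) {s : ℂ} (hs : 1 < s.re) :
    HasDerivAt (lseries χ) (-(pseries χ s * lseries χ s)) s := by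
  rw [pseries_mul_lseries hχ hs]
  exact hasDerivAt_lseries hχ hs

lemma tendsto_lseries_atTop (hχ : ∀ 𝔞, ‖χ 𝔞‖ ≤ 1) :
    Tendsto (fun σ : ℝ => lseries χ σ) atTop (nhds 1) := by
  classical
  have h1 : Tendsto (fun σ : ℝ => ∑' 𝔞, lterm χ σ 𝔞) atTop
      (nhds (∑' 𝔞 : Ideal (𝓞 K), if 𝔞 = ⊤ then 1 else 0)) := by
    refine tendsto_tsum_of_dominated_convergence (summable_exp_logNorm K (σ := 2) (by norm_num))
      (fun 𝔞 => ?_) ?_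
    · split_ifs with h
      · subst h
        simp [lterm, logNorm, ← Ideal.one_eq_top]
      · by_cases h0 : 𝔞 = ⊥
        · subst h0; simp [lterm_bot]
        have h2 : 0 < logNorm 𝔞 := (Real.log_pos (by norm_num)).trans_le (log_two_le_logNorm h0 h)
        refine squeeze_zero_norm (a := fun σ : ℝ => Real.exp (-σ * logNorm 𝔞)) (fun σ => by
          simpa using norm_lterm_le hχ σ 𝔞) ?_
        refine Real.tendsto_exp_atBot.comp ?_
        simp only [neg_mul]
        exact tendsto_neg_atTop_atBot.comp (tendsto_id.atTop_mul_const h2)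
    · filter_upwards [eventually_ge_atTop 2] with σ hσ 𝔞
      refine (norm_lterm_le hχ σ 𝔞).trans (Real.exp_le_exp.2 ?_)
      rw [Complex.ofReal_re]
      nlinarith [logNorm_nonneg 𝔞]
  rwa [tsum_ite_eq] at h1

end LSeries

/-- The logarithmic derivative detects the order of vanishing along a horizontal ray. -/
lemma exists_tendsto_mul_logDeriv {g : ℂ → ℂ} {z₀ : ℂ} (hg : AnalyticAt ℂ g z₀)
    (h0 : ¬ ∀ᶠ z in nhds z₀, g z = 0) :
    ∃ m : ℕ, (m = 0 → g z₀ ≠ 0) ∧ (g z₀ ≠ 0 → m = 0) ∧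
      (∀ᶠ x : ℝ in nhdsWithin 0 (Set.Ioi 0), g (z₀ + x) ≠ 0) ∧
      Tendsto (fun x : ℝ => x * (deriv g (z₀ + x) / g (z₀ + x))) (nhdsWithin 0 (Set.Ioi 0))
        (nhds (m : ℂ)) := by
  obtain ⟨m, h, hh, hh0, heq⟩ := (hg.exists_eventuallyEq_pow_smul_nonzero_iff).2 h0
  simp only [smul_eq_mul] at heq
  have hval := heq.self_of_nhds
  have hray : Tendsto (fun x : ℝ => z₀ + x) (nhdsWithin 0 (Set.Ioi 0)) (nhds z₀) := by
    have : Continuous fun x : ℝ => z₀ + (x : ℂ) := by fun_prop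
    have h1 := this.tendsto 0
    rw [Complex.ofReal_zero, add_zero] at h1
    exact h1.mono_left nhdsWithin_le_nhds
  have hpos : ∀ᶠ x : ℝ in nhdsWithin 0 (Set.Ioi 0), 0 < x := self_mem_nhdsWithin
  have hne : ∀ᶠ z in nhds z₀, h z ≠ 0 := hh.continuousAt.eventually_ne hh0
  have han : ∀ᶠ z in nhds z₀, AnalyticAt ℂ h z := hh.eventually_analyticAt
  refine ⟨m, ?_, ?_, ?_, ?_⟩
  · rintro rfl
    rw [hval]; simpa using hh0
  · intro h1
    by_contra hm
    rw [hval, sub_self, zero_pow hm, zero_mul] at h1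
    exact h1 rfl
  · filter_upwards [hpos, hray.eventually heq, hray.eventually hne] with x hx h1 h2
    rw [h1, add_sub_cancel_left]
    exact mul_ne_zero (pow_ne_zero _ (by exact_mod_cast hx.ne')) h2
  · have hlim : Tendsto (fun x : ℝ => (m : ℂ) + x * (deriv h (z₀ + x) / h (z₀ + x)))
        (nhdsWithin 0 (Set.Ioi 0)) (nhds (m + 0 * (deriv h z₀ / h z₀))) := by
      refine tendsto_const_nhds.add (Tendsto.mul ?_ ?_)
      · have : Continuous fun x : ℝ => (x : ℂ) := by fun_prop
        simpa using (this.tendsto 0).mono_left (nhdsWithin_le_nhds (s := Set.Ioi 0))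
      · exact (hh.deriv.continuousAt.tendsto.comp hray).div (hh.continuousAt.tendsto.comp hray) hh0
    rw [zero_mul, add_zero] at hlim
    refine hlim.congr' ?_
    filter_upwards [hpos, hray.eventually heq.eventually_nhds, hray.eventually hne,
      hray.eventually han] with x hx h1 h2 h3
    have hx' : (x : ℂ) ≠ 0 := by exact_mod_cast hx.ne'
    have hd : deriv g (z₀ + x) = m * (x : ℂ) ^ (m - 1) * h (z₀ + x) + x ^ m * deriv h (z₀ + x) := by
      rw [EventuallyEq.deriv_eq h1]
      have e1 : HasDerivAt (fun z : ℂ => (z - z₀) ^ m) (m * (z₀ + x - z₀) ^ (m - 1) * 1) (z₀ + x) :=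
        ((hasDerivAt_id _).sub_const z₀).pow m
      have e2 := (e1.mul h3.differentiableAt.hasDerivAt).deriv
      rw [add_sub_cancel_left, mul_one] at e2
      exact e2
    rw [hd, h1.self_of_nhds, add_sub_cancel_left]
    rcases Nat.eq_zero_or_pos m with hm | hm
    · subst hm; simp
    · obtain ⟨k, rfl⟩ : ∃ k, m = k + 1 := ⟨m - 1, by omega⟩
      rw [Nat.add_sub_cancel]
      field_simp
      ring

section LContinuation

variable {K : Type*} [Field K] [NumberField K]

/-- `g` continues `(s - 1) ^ δ * L(χ, s)` analytically beyond the line `re s = 1`. -/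
structure LContinuation (χ : Ideal (𝓞 K) →*₀ ℂ) (δ : ℕ) (r : ℝ) (g : ℂ → ℂ) : Prop where
  norm_le : ∀ 𝔞, ‖χ 𝔞‖ ≤ 1
  lt_one : r < 1
  differentiableOn : DifferentiableOn ℂ g {s | r < s.re}
  eq : ∀ s : ℂ, 1 < s.re → g s = (s - 1) ^ δ * lseries χ s

namespace LContinuation

variable {χ : Ideal (𝓞 K) →*₀ ℂ} {δ : ℕ} {r : ℝ} {g : ℂ → ℂ}

lemma analyticOnNhd (h : LContinuation χ δ r g) : AnalyticOnNhd ℂ g {s | r < s.re} :=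
  h.differentiableOn.analyticOnNhd (isOpen_lt continuous_const Complex.continuous_re)

lemma not_eventually_zero (h : LContinuation χ δ r g) {z : ℂ} (hz : r < z.re) :
    ¬ ∀ᶠ w in nhds z, g w = 0 := by
  intro h0
  have h1 := h.analyticOnNhd.eqOn_zero_of_preconnected_of_eventuallyEq_zero
    (convex_halfSpace_re_gt r).isPreconnected hz h0
  have h2 : ∀ᶠ σ : ℝ in atTop, lseries χ σ = 0 := by
    filter_upwards [eventually_gt_atTop 1] with σ hσ
    have h3 : g σ = 0 := h1 (show r < (σ : ℂ).re by rw [Complex.ofReal_re]; linarith [h.lt_one])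
    rw [h.eq _ (by simpa using hσ), mul_eq_zero] at h3
    refine h3.resolve_left (pow_ne_zero _ ?_)
    rw [sub_ne_zero]
    exact_mod_cast hσ.ne'
  have h3 := (tendsto_lseries_atTop h.norm_le).congr' (h2.mono fun σ hσ => hσ)
  exact one_ne_zero (tendsto_nhds_unique h3 tendsto_const_nhds)

lemma deriv_eq (h : LContinuation χ δ r g) {s : ℂ} (hs : 1 < s.re) :
    deriv g s = (δ / (s - 1) - pseries χ s) * g s := by
  have h1 : g =ᶠ[nhds s] fun z => (z - 1) ^ δ * lseries χ z := by
    filter_upwards [(isOpen_lt continuous_const Complex.continuous_re).mem_nhds hs] with z hz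
    exact h.eq z hz
  have hs1 : s - 1 ≠ 0 := fun h0 => by
    rw [sub_eq_zero] at h0; rw [h0] at hs; norm_num at hs
  rw [h1.deriv_eq, h.eq s hs]
  have e1 : HasDerivAt (fun z : ℂ => (z - 1) ^ δ) (δ * (s - 1) ^ (δ - 1) * 1) s :=
    ((hasDerivAt_id _).sub_const 1).pow δ
  have e2 : HasDerivAt (fun z : ℂ => (z - 1) ^ δ * lseries χ z) _ s :=
    e1.mul (hasDerivAt_lseries' h.norm_le hs)
  rw [e2.deriv]
  rcases Nat.eq_zero_or_pos δ with hm | hm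
  · subst hm; simp
  · obtain ⟨k, rfl⟩ : ∃ k, δ = k + 1 := ⟨δ - 1, by omega⟩
    rw [Nat.add_sub_cancel]
    field_simp
    ring

lemma ne_zero_of_one_lt (h : LContinuation χ δ r g) {s : ℂ} (hs : 1 < s.re) : g s ≠ 0 := by
  have hrs : r < s.re := h.lt_one.trans hs
  obtain ⟨m, hm, -, hne, hlim⟩ := exists_tendsto_mul_logDeriv (h.analyticOnNhd s hrs)
    (h.not_eventually_zero hrs)
  refine hm ?_
  have hs1 : s - 1 ≠ 0 := fun h0 => by
    rw [sub_eq_zero] at h0; rw [h0] at hs; norm_num at hs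
  have hray : Tendsto (fun x : ℝ => s + x) (nhdsWithin 0 (Set.Ioi 0)) (nhds s) := by
    have : Continuous fun x : ℝ => s + (x : ℂ) := by fun_prop
    have h1 := this.tendsto 0
    rw [Complex.ofReal_zero, add_zero] at h1
    exact h1.mono_left nhdsWithin_le_nhds
  have hPc : ContinuousAt (pseries χ) s := by
    refine (continuousOn_pseries h.norm_le (σ := (1 + s.re) / 2) (by linarith)).continuousAt ?_
    filter_upwards [(isOpen_lt continuous_const Complex.continuous_re).mem_nhds
      (show (1 + s.re) / 2 < s.re by linarith)] with z hz using le_of_lt hz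
  have hx0 : Tendsto (fun x : ℝ => (x : ℂ)) (nhdsWithin 0 (Set.Ioi 0)) (nhds 0) := by
    have : Continuous fun x : ℝ => (x : ℂ) := by fun_prop
    simpa using (this.tendsto 0).mono_left (nhdsWithin_le_nhds (s := Set.Ioi 0))
  have hlim2 : Tendsto (fun x : ℝ => x * (deriv g (s + x) / g (s + x)))
      (nhdsWithin 0 (Set.Ioi 0)) (nhds 0) := by
    have h1 : ContinuousAt (fun z : ℂ => (δ : ℂ) / (z - 1)) s :=
      continuousAt_const.div (by fun_prop) hs1
    have h4 : Tendsto (fun x : ℝ => δ / (s + (x : ℂ) - 1) - pseries χ (s + x))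
        (nhdsWithin 0 (Set.Ioi 0)) (nhds (δ / (s - 1) - pseries χ s)) :=
      (h1.tendsto.comp hray).sub (hPc.tendsto.comp hray)
    have h3 := hx0.mul h4
    rw [zero_mul] at h3
    refine h3.congr' ?_
    filter_upwards [hne, self_mem_nhdsWithin] with x hx hxpos
    have hxpos : (0 : ℝ) < x := hxpos
    rw [h.deriv_eq (by rw [Complex.add_re, Complex.ofReal_re]; linarith),
      mul_div_cancel_right₀ _ hx]
  exact_mod_cast tendsto_nhds_unique hlim hlim2

/-- The von Mangoldt series has residue `[t = 0] δ - m` at `1 + it`, with `m` the order of `g`. -/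
lemma exists_order (h : LContinuation χ δ r g) (t : ℝ) :
    ∃ m : ℕ, (m = 0 → g (1 + Complex.I * t) ≠ 0) ∧ (g (1 + Complex.I * t) ≠ 0 → m = 0) ∧
      Tendsto (fun x : ℝ => x * pseries χ (1 + Complex.I * t + x)) (nhdsWithin 0 (Set.Ioi 0))
        (nhds ((if t = 0 then (δ : ℂ) else 0) - m)) := by
  set s : ℂ := 1 + Complex.I * t with hs
  have hre : s.re = 1 := by simp [hs]
  have hrs : r < s.re := by rw [hre]; exact h.lt_one
  obtain ⟨m, hm, hm', hne, hlim⟩ := exists_tendsto_mul_logDeriv (h.analyticOnNhd s hrs)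
    (h.not_eventually_zero hrs)
  refine ⟨m, hm, hm', ?_⟩
  have hlim1 : Tendsto (fun x : ℝ => (x : ℂ) * (δ / (s + x - 1))) (nhdsWithin 0 (Set.Ioi 0))
      (nhds (if t = 0 then (δ : ℂ) else 0)) := by
    split_ifs with ht
    · refine tendsto_const_nhds.congr' ?_
      filter_upwards [self_mem_nhdsWithin] with x hx
      have hx0 : (x : ℂ) ≠ 0 := by exact_mod_cast (Set.mem_Ioi.1 hx).ne'
      rw [show s + x - 1 = (x : ℂ) by rw [hs, ht]; simp, mul_div_cancel₀ _ hx0]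
    · have hc : ContinuousAt (fun x : ℝ => (x : ℂ) * (δ / (s + x - 1))) 0 := by
        refine ContinuousAt.mul (by fun_prop) (continuousAt_const.div (by fun_prop) ?_)
        simp [hs, ht]
      have := hc.tendsto.mono_left (nhdsWithin_le_nhds (s := Set.Ioi 0))
      simpa using this
  refine (hlim1.sub hlim).congr' ?_
  filter_upwards [hne, self_mem_nhdsWithin] with x hx hx0
  have hx0 : (0 : ℝ) < x := hx0
  rw [h.deriv_eq (by rw [Complex.add_re, hre, Complex.ofReal_re]; linarith),
    mul_div_cancel_right₀ _ hx]
  ring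

end LContinuation

lemma re_three_four_one {w : ℂ} (hw : ‖w‖ = 0 ∨ ‖w‖ = 1) :
    0 ≤ 3 * ‖w‖ + 4 * w.re + (w ^ 2).re := by
  rcases hw with h | h
  · rw [norm_eq_zero] at h; simp [h]
  · have h1 : w.re ^ 2 + w.im ^ 2 = 1 := by
      have := Complex.sq_norm w
      rw [h, Complex.normSq_apply] at this
      nlinarith
    have h2 : (w ^ 2).re = w.re ^ 2 - w.im ^ 2 := by
      rw [sq, Complex.mul_re]; ring
    rw [h, h2]
    nlinarith [sq_nonneg (1 + w.re)]

lemma pseries_three_four_one {χ χ₀ χ₂ : Ideal (𝓞 K) →*₀ ℂ}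
    (hχ : ∀ 𝔞, ‖χ 𝔞‖ = 0 ∨ ‖χ 𝔞‖ = 1) (h₀ : ∀ 𝔞, χ₀ 𝔞 = (‖χ 𝔞‖ : ℝ)) (h₂ : ∀ 𝔞, χ₂ 𝔞 = χ 𝔞 ^ 2)
    {σ : ℝ} (hσ : 1 < σ) (t : ℝ) :
    0 ≤ 3 * (pseries χ₀ σ).re + 4 * (pseries χ (σ + Complex.I * t)).re +
      (pseries χ₂ (σ + Complex.I * (2 * t))).re := by
  have b : ∀ 𝔞, ‖χ 𝔞‖ ≤ 1 := fun 𝔞 => by rcases hχ 𝔞 with h | h <;> rw [h]; norm_num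
  have b₀ : ∀ 𝔞, ‖χ₀ 𝔞‖ ≤ 1 := fun 𝔞 => by rw [h₀]; simpa using b 𝔞
  have b₂ : ∀ 𝔞, ‖χ₂ 𝔞‖ ≤ 1 := fun 𝔞 => by
    rw [h₂, norm_pow]; exact pow_le_one₀ (norm_nonneg _) (b 𝔞)
  have s := (summable_pseries b (s := σ + Complex.I * t) (by simpa using hσ)).of_norm.hasSum
  have s₀ := (summable_pseries b₀ (s := σ) (by simpa using hσ)).of_norm.hasSum
  have s₂ := (summable_pseries b₂ (s := σ + Complex.I * (2 * t)) (by simpa using hσ)).of_norm.hasSum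
  refine HasSum.nonneg ?_ (((Complex.hasSum_re s₀).mul_left 3).add
    ((Complex.hasSum_re s).mul_left 4) |>.add (Complex.hasSum_re s₂))
  intro q
  set 𝔞 := q.1.1 ^ (q.2 + 1)
  set w := χ 𝔞 * Complex.exp (-(Complex.I * t) * logNorm 𝔞) with hw
  have hwn : ‖w‖ = ‖χ 𝔞‖ := by
    rw [hw, norm_mul, norm_cexp_neg_mul]; simp
  have key := re_three_four_one (w := w) (by rw [hwn]; exact hχ 𝔞)
  set e : ℝ := Real.exp (-σ * logNorm 𝔞) with he
  have hee : (e : ℂ) = Complex.exp (-σ * logNorm 𝔞) := by rw [he]; push_cast; rfl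
  have e0 : (logNorm q.1.1 : ℂ) * lterm χ₀ σ 𝔞 = ((logNorm q.1.1 * e * ‖w‖ : ℝ) : ℂ) := by
    rw [lterm, h₀, hwn, ← hee]; push_cast; ring
  have e1 : (logNorm q.1.1 : ℂ) * lterm χ (σ + Complex.I * t) 𝔞 =
      ((logNorm q.1.1 * e : ℝ) : ℂ) * w := by
    rw [lterm, hw, show -((σ : ℂ) + Complex.I * t) * logNorm 𝔞 =
      -σ * logNorm 𝔞 + -(Complex.I * t) * logNorm 𝔞 by ring, Complex.exp_add, ← hee]
    push_cast; ring
  have e2 : (logNorm q.1.1 : ℂ) * lterm χ₂ (σ + Complex.I * (2 * t)) 𝔞 =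
      ((logNorm q.1.1 * e : ℝ) : ℂ) * w ^ 2 := by
    rw [lterm, hw, h₂, mul_pow, ← Complex.exp_nat_mul,
      show -((σ : ℂ) + Complex.I * (2 * t)) * logNorm 𝔞 =
      -σ * logNorm 𝔞 + (2 : ℕ) * (-(Complex.I * t) * logNorm 𝔞) by push_cast; ring,
      Complex.exp_add, ← hee]
    push_cast; ring
  simp only [e0, e1, e2, Complex.ofReal_re, Complex.re_ofReal_mul]
  have : 0 ≤ logNorm q.1.1 * e := mul_nonneg (logNorm_nonneg _) (Real.exp_pos _).le
  nlinarith

namespace LContinuation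

variable {χ χ₀ χ₂ : Ideal (𝓞 K) →*₀ ℂ} {δ δ₂ : ℕ} {r r₀ r₂ : ℝ} {g g₀ g₂ : ℂ → ℂ}

lemma ne_zero_on_line (h : LContinuation χ δ r g) (h₀ : LContinuation χ₀ 1 r₀ g₀)
    (h₂ : LContinuation χ₂ δ₂ r₂ g₂) (hχ : ∀ 𝔞, ‖χ 𝔞‖ = 0 ∨ ‖χ 𝔞‖ = 1)
    (e₀ : ∀ 𝔞, χ₀ 𝔞 = (‖χ 𝔞‖ : ℝ)) (e₂ : ∀ 𝔞, χ₂ 𝔞 = χ 𝔞 ^ 2) (hg₀ : g₀ 1 ≠ 0) {t : ℝ}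
    (ht : t = 0 → δ = 0 ∧ δ₂ = 0) : g (1 + Complex.I * t) ≠ 0 := by
  obtain ⟨m, hm, -, hlim⟩ := h.exists_order t
  obtain ⟨m₀, -, hm₀, hlim₀⟩ := h₀.exists_order 0
  obtain ⟨m₂, -, -, hlim₂⟩ := h₂.exists_order (2 * t)
  refine hm ?_
  rw [hm₀ (by simpa using hg₀)] at hlim₀
  have c1 : (if t = 0 then (δ : ℂ) else 0) = 0 := by
    split_ifs with h1
    · rw [(ht h1).1]; simp
    · rfl
  have c2 : (if 2 * t = 0 then (δ₂ : ℂ) else 0) = 0 := by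
    split_ifs with h1
    · rw [(ht (by linarith)).2]; simp
    · rfl
  rw [c1] at hlim
  rw [c2] at hlim₂
  have hre := fun {f : ℝ → ℂ} {a : ℂ} (h : Tendsto f (nhdsWithin 0 (Set.Ioi 0)) (nhds a)) =>
    (Complex.continuous_re.tendsto a).comp h
  have hsum := (((hre hlim₀).const_mul 3).add ((hre hlim).const_mul 4)).add (hre hlim₂)
  have hnn := ge_of_tendsto hsum (b := 0) ?_
  · simp at hnn
    have h4 : 4 * m + m₂ ≤ 3 := by
      have : (4 * m + m₂ : ℝ) ≤ 3 := by linarith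
      exact_mod_cast this
    omega
  · filter_upwards [self_mem_nhdsWithin] with x hx
    have hx : (0 : ℝ) < x := hx
    have h1 := pseries_three_four_one hχ e₀ e₂ (σ := 1 + x) (by linarith) t
    simp only [Function.comp_apply, Complex.re_ofReal_mul]
    have q0 : (1 + Complex.I * ((0 : ℝ) : ℂ) + x) = ((1 + x : ℝ) : ℂ) := by push_cast; ring
    have q1 : (1 + Complex.I * t + x : ℂ) = ((1 + x : ℝ) : ℂ) + Complex.I * t := by push_cast; ring
    have q2 : (1 + Complex.I * ((2 * t : ℝ) : ℂ) + x : ℂ) =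
      ((1 + x : ℝ) : ℂ) + Complex.I * (2 * t) := by push_cast; ring
    rw [q0, q1, q2]
    nlinarith

lemma exists_pseries_eq (h : LContinuation χ δ r g)
    (hline : ∀ t : ℝ, g (1 + Complex.I * t) ≠ 0) :
    ∃ G : ℂ → ℂ, ContinuousOn G {s | 1 ≤ s.re} ∧
      ∀ s : ℂ, 1 < s.re → pseries χ s = δ / (s - 1) + G s := by
  have hne : ∀ s : ℂ, 1 ≤ s.re → g s ≠ 0 := by
    intro s hs
    rcases hs.eq_or_lt with h1 | h1
    · have := hline s.im
      rwa [show (1 + Complex.I * s.im : ℂ) = s by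
        apply Complex.ext <;> simp [← h1]] at this
    · exact h.ne_zero_of_one_lt h1
  have hsub : {s : ℂ | 1 ≤ s.re} ⊆ {s | r < s.re} := fun s hs => h.lt_one.trans_le hs
  refine ⟨fun s => -(deriv g s / g s), ?_, fun s hs => ?_⟩
  · exact ((h.analyticOnNhd.deriv.continuousOn.mono hsub).div
      (h.analyticOnNhd.continuousOn.mono hsub) hne).neg
  · simp only
    rw [h.deriv_eq hs, mul_div_cancel_right₀ _ (hne s hs.le)]
    ring

lemma exists_prime_sum_eq (h : LContinuation χ δ r g)
    (hline : ∀ t : ℝ, g (1 + Complex.I * t) ≠ 0) :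
    ∃ G : ℂ → ℂ, ContinuousOn G {s | 1 ≤ s.re} ∧
      ∀ s : ℂ, 1 < s.re → ∑' p : {𝔭 : Ideal (𝓞 K) // Prime 𝔭}, (logNorm p.1 : ℂ) * lterm χ s p.1 =
        δ / (s - 1) + G s := by
  obtain ⟨G, hG, hGe⟩ := h.exists_pseries_eq hline
  set R : ℂ → ℂ := fun s => ∑' q : PrimePow K, (logNorm q.1.1 : ℂ) * lterm χ s (q.1.1 ^ (q.2 + 2))
    with hR
  have hle : ∀ q : PrimePow K, logNorm q.1.1 * Real.exp (-1 * logNorm (q.1.1 ^ (q.2 + 2))) ≤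
      logNorm q.1.1 * Real.exp (-2 * logNorm q.1.1) * (1 / 2) ^ q.2 := by
    intro q
    rw [mul_assoc]
    refine mul_le_mul_of_nonneg_left ?_ (logNorm_nonneg _)
    have h1 := exp_primePow_le q (le_refl 1)
    have h2 : Real.exp (-1 * logNorm (q.1.1 ^ (q.2 + 2))) =
        Real.exp (-1 * logNorm (q.1.1 ^ (q.2 + 1))) * Real.exp (-1 * logNorm q.1.1) := by
      rw [← Real.exp_add, logNorm_pow, logNorm_pow]
      push_cast; ring_nf
    rw [h2]
    refine (mul_le_mul_of_nonneg_right h1 (Real.exp_pos _).le).trans (le_of_eq ?_)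
    rw [mul_right_comm, ← Real.exp_add]
    ring_nf
  have hsum : Summable fun q : PrimePow K =>
      logNorm q.1.1 * Real.exp (-1 * logNorm (q.1.1 ^ (q.2 + 2))) := by
    have h1 : Summable fun p : {𝔭 : Ideal (𝓞 K) // Prime 𝔭} =>
        logNorm p.1 * Real.exp (-2 * logNorm p.1) :=
      (summable_logNorm_mul_exp K (σ := 2) (by norm_num)).comp_injective Subtype.val_injective
    exact Summable.of_nonneg_of_le (fun _ => mul_nonneg (logNorm_nonneg _) (Real.exp_pos _).le)
      hle (h1.mul_of_nonneg summable_geometric_two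
        (fun p => mul_nonneg (logNorm_nonneg _) (Real.exp_pos _).le) (fun j => by positivity))
  refine ⟨fun s => G s - R s, hG.sub (continuousOn_tsum
    (fun q => (continuous_const.mul (continuous_lterm _)).continuousOn) hsum
    fun q s hs => norm_logNorm_mul_lterm_le h.norm_le hs _ _), fun s hs => ?_⟩
  have h1 : pseries χ s = (∑' p : {𝔭 : Ideal (𝓞 K) // Prime 𝔭}, (logNorm p.1 : ℂ) * lterm χ s p.1)
      + R s := by
    have hs1 := (summable_pseries h.norm_le hs).of_norm
    have hs2 : Summable fun q : PrimePow K =>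
        (logNorm q.1.1 : ℂ) * lterm χ s (q.1.1 ^ (q.2 + 2)) :=
      Summable.of_norm_bounded hsum fun q => norm_logNorm_mul_lterm_le h.norm_le hs.le _ _
    rw [pseries, hs1.tsum_prod, hR]
    simp only
    rw [hs2.tsum_prod, ← Summable.tsum_add]
    · refine tsum_congr fun p => ?_
      rw [(hs1.prod_factor p).tsum_eq_zero_add]
      simp
    · have := ((summable_logNorm_mul_exp K hs).comp_injective
        (Subtype.val_injective (p := fun 𝔭 : Ideal (𝓞 K) => Prime 𝔭)))
      exact Summable.of_norm_bounded this fun p => norm_logNorm_mul_lterm_le h.norm_le le_rfl _ _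
    · exact hs2.prod
  rw [← sub_eq_iff_eq_add.2 h1, hGe s hs]
  ring

end LContinuation

end LContinuation

section PrimeSums

variable {K : Type*} [Field K] [NumberField K] {χ χ₀ χ₂ : Ideal (𝓞 K) →*₀ ℂ}

lemma exists_LContinuation_one (hχ : ∀ 𝔞, ‖χ 𝔞‖ ≤ 1) {c : ℂ} {C r : ℝ} (hr : r < 1)
    (hmean : ∀ u, 0 < u → ‖partialSum logNorm χ u - c * Real.exp u‖ ≤ C * Real.exp (r * u)) :
    ∃ g, LContinuation χ 1 r g ∧ g 1 = c := by
  obtain ⟨E, hE, hEe⟩ := exists_continuation_of_mean_value logNorm_nonneg (fun σ hσ =>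
    Summable.of_nonneg_of_le (fun 𝔞 => mul_nonneg (norm_nonneg _) (Real.exp_pos _).le)
      (fun 𝔞 => mul_le_of_le_one_left (Real.exp_pos _).le (hχ 𝔞))
      (summable_exp_logNorm K hσ)) hmean
  refine ⟨fun s => s * (s - 1) * E s + c * s, ⟨hχ, hr, ?_, fun s hs => ?_⟩, by simp⟩
  · have h1 : Differentiable ℂ fun s : ℂ => s * (s - 1) := by fun_prop
    have h2 : Differentiable ℂ fun s : ℂ => c * s := by fun_prop
    exact (h1.differentiableOn.mul hE).add h2.differentiableOn
  · have hs1 : s - 1 ≠ 0 := fun h0 => by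
      rw [sub_eq_zero] at h0; rw [h0] at hs; norm_num at hs
    have h1 : lseries χ s = s * E s + c * s / (s - 1) := hEe s hs
    rw [h1]
    field_simp

lemma exists_LContinuation_zero (hχ : ∀ 𝔞, ‖χ 𝔞‖ ≤ 1) {C r : ℝ} (hr : r < 1)
    (hmean : ∀ u, 0 < u → ‖partialSum logNorm χ u‖ ≤ C * Real.exp (r * u)) :
    ∃ g, LContinuation χ 0 r g := by
  obtain ⟨E, hE, hEe⟩ := exists_continuation_of_mean_value (c := 0) logNorm_nonneg (fun σ hσ =>
    Summable.of_nonneg_of_le (fun 𝔞 => mul_nonneg (norm_nonneg _) (Real.exp_pos _).le)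
      (fun 𝔞 => mul_le_of_le_one_left (Real.exp_pos _).le (hχ 𝔞))
      (summable_exp_logNorm K hσ)) (by simpa using hmean)
  refine ⟨fun s => s * E s, hχ, hr, differentiableOn_id.mul hE, fun s hs => ?_⟩
  have h1 : lseries χ s = s * E s + 0 * s / (s - 1) := hEe s hs
  rw [h1]
  simp

lemma summable_prime_logNorm (K : Type*) [Field K] [NumberField K] {σ : ℝ} (hσ : 1 < σ) :
    Summable fun p : {𝔭 : Ideal (𝓞 K) // Prime 𝔭} =>
      logNorm p.1 * Real.exp (-σ * logNorm p.1) :=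
  (summable_logNorm_mul_exp K hσ).comp_injective Subtype.val_injective

lemma summable_prime_lterm (hχ : ∀ 𝔞, ‖χ 𝔞‖ ≤ 1) {s : ℂ} (hs : 1 < s.re) :
    Summable fun p : {𝔭 : Ideal (𝓞 K) // Prime 𝔭} => (logNorm p.1 : ℂ) * lterm χ s p.1 :=
  Summable.of_norm_bounded (summable_prime_logNorm K hs)
    fun _ => norm_logNorm_mul_lterm_le hχ le_rfl _ _

lemma summable_prime_mul {b : {𝔭 : Ideal (𝓞 K) // Prime 𝔭} → ℝ} {B : ℝ} (h0 : ∀ p, 0 ≤ b p)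
    (hb : ∀ p, b p ≤ B * logNorm p.1) {σ : ℝ} (hσ : 1 < σ) :
    Summable fun p => b p * Real.exp (-σ * logNorm p.1) := by
  refine Summable.of_nonneg_of_le (fun p => mul_nonneg (h0 p) (Real.exp_pos _).le) (fun p => ?_)
    ((summable_prime_logNorm K hσ).mul_left B)
  rw [← mul_assoc]
  exact mul_le_mul_of_nonneg_right (hb p) (Real.exp_pos _).le

lemma lterm_conj (s : ℂ) (𝔞 : Ideal (𝓞 K)) :
    lterm χ s 𝔞 + starRingEnd ℂ (lterm χ (starRingEnd ℂ s) 𝔞) =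
      ((2 * (χ 𝔞).re : ℝ) : ℂ) * Complex.exp (-s * logNorm 𝔞) := by
  rw [lterm, lterm, map_mul, ← Complex.exp_conj]
  simp only [map_mul, map_neg, Complex.conj_conj, Complex.conj_ofReal]
  rw [← add_mul, Complex.add_conj]

/-- The prime ideal theorem with characters, from power saving mean values. -/
theorem tendsto_prime_sums (hχ : ∀ 𝔞, ‖χ 𝔞‖ = 0 ∨ ‖χ 𝔞‖ = 1)
    (e₀ : ∀ 𝔞, χ₀ 𝔞 = (‖χ 𝔞‖ : ℝ)) (e₂ : ∀ 𝔞, χ₂ 𝔞 = χ 𝔞 ^ 2)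
    {c : ℂ} (hc : c ≠ 0) {C C₀ C₂ r : ℝ} (hr : r < 1)
    (hmean₀ : ∀ u, 0 < u → ‖partialSum logNorm χ₀ u - c * Real.exp u‖ ≤ C₀ * Real.exp (r * u))
    (hmean : ∀ u, 0 < u → ‖partialSum logNorm χ u‖ ≤ C * Real.exp (r * u))
    (hmean₂ : ∀ u, 0 < u → ‖partialSum logNorm χ₂ u‖ ≤ C₂ * Real.exp (r * u)) :
    Tendsto (fun u => Real.exp (-u) * partialSum (fun p : {𝔭 : Ideal (𝓞 K) // Prime 𝔭} =>
      logNorm p.1) (fun p => logNorm p.1 * ‖χ p.1‖) u) atTop (nhds 1) ∧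
    Tendsto (fun u => Real.exp (-u) * partialSum (fun p : {𝔭 : Ideal (𝓞 K) // Prime 𝔭} =>
      logNorm p.1) (fun p => logNorm p.1 * (χ p.1).re) u) atTop (nhds 0) := by
  have b : ∀ 𝔞, ‖χ 𝔞‖ ≤ 1 := fun 𝔞 => by rcases hχ 𝔞 with h | h <;> rw [h]; norm_num
  have b₀ : ∀ 𝔞, ‖χ₀ 𝔞‖ ≤ 1 := fun 𝔞 => by rw [e₀]; simpa using b 𝔞
  have b₂ : ∀ 𝔞, ‖χ₂ 𝔞‖ ≤ 1 := fun 𝔞 => by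
    rw [e₂, norm_pow]; exact pow_le_one₀ (norm_nonneg _) (b 𝔞)
  obtain ⟨g₀, h₀, hg₀⟩ := exists_LContinuation_one b₀ hr hmean₀
  obtain ⟨g, h⟩ := exists_LContinuation_zero b hr hmean
  obtain ⟨g₂, h₂⟩ := exists_LContinuation_zero b₂ hr hmean₂
  have hg₀' : g₀ 1 ≠ 0 := by rwa [hg₀]
  have hχ₀ : ∀ 𝔞, ‖χ₀ 𝔞‖ = ‖χ 𝔞‖ := fun 𝔞 => by rw [e₀]; simp
  obtain ⟨G₀, hG₀, hGe₀⟩ := h₀.exists_prime_sum_eq fun t => by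
    rcases eq_or_ne t 0 with rfl | ht
    · simpa using hg₀'
    · refine h₀.ne_zero_on_line h₀ h₀ (fun 𝔞 => by rw [hχ₀]; exact hχ 𝔞)
        (fun 𝔞 => by rw [hχ₀, e₀]) (fun 𝔞 => ?_) hg₀' fun h => absurd h ht
      rw [e₀]
      rcases hχ 𝔞 with h | h <;> rw [h] <;> simp
  obtain ⟨G, hG, hGe⟩ := h.exists_prime_sum_eq fun t =>
    h.ne_zero_on_line h₀ h₂ hχ e₀ e₂ hg₀' fun _ => ⟨rfl, rfl⟩
  have T₀ : Tendsto (fun u => Real.exp (-u) * partialSum (fun p : {𝔭 : Ideal (𝓞 K) // Prime 𝔭} =>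
      logNorm p.1) (fun p => logNorm p.1 * ‖χ p.1‖) u) atTop (nhds 1) := by
    refine tendsto_partialSum_of_dirichlet (fun p => logNorm_nonneg _)
      (fun p => mul_nonneg (logNorm_nonneg _) (norm_nonneg _)) (fun σ hσ => ?_) zero_le_one hG₀
      fun s hs => ?_
    · refine summable_prime_mul (B := 1) (fun p => mul_nonneg (logNorm_nonneg _) (norm_nonneg _))
        (fun p => ?_) hσ
      rw [one_mul]
      exact mul_le_of_le_one_right (logNorm_nonneg _) (b _)
    · have h1 := hGe₀ s hs
      rw [Nat.cast_one] at h1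
      rw [Complex.ofReal_one, ← h1]
      refine tsum_congr fun p => ?_
      rw [lterm, e₀]
      push_cast
      ring
  refine ⟨T₀, ?_⟩
  set b₁ : {𝔭 : Ideal (𝓞 K) // Prime 𝔭} → ℝ :=
    fun p => logNorm p.1 * ‖χ p.1‖ + logNorm p.1 * (χ p.1).re with hb₁
  have hb0 : ∀ p, 0 ≤ b₁ p := fun p => by
    have h1 := (abs_le.1 (Complex.abs_re_le_norm (χ p.1))).1
    rw [hb₁]; simp only; rw [← mul_add]
    exact mul_nonneg (logNorm_nonneg _) (by linarith)
  have hb2 : ∀ p, b₁ p ≤ 2 * logNorm p.1 := fun p => by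
    have h1 := (abs_le.1 (Complex.abs_re_le_norm (χ p.1))).2
    have h2 := b p.1
    have h3 := logNorm_nonneg p.1
    rw [hb₁]; simp only; nlinarith
  have T₁ : Tendsto (fun u => Real.exp (-u) * partialSum (fun p : {𝔭 : Ideal (𝓞 K) // Prime 𝔭} =>
      logNorm p.1) b₁ u) atTop (nhds 1) := by
    have hGc : ContinuousOn (fun s => starRingEnd ℂ (G (starRingEnd ℂ s))) {s | 1 ≤ s.re} :=
      Complex.continuous_conj.comp_continuousOn (hG.comp Complex.continuous_conj.continuousOn
        fun s hs => by simpa using hs)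
    refine tendsto_partialSum_of_dirichlet (fun p => logNorm_nonneg _) hb0 (fun σ hσ =>
      summable_prime_mul hb0 hb2 hσ) zero_le_one
      (hG₀.add ((continuousOn_const (c := (1 / 2 : ℂ))).mul (hG.add hGc))) fun s hs => ?_
    have hs' : 1 < (starRingEnd ℂ s).re := by simpa using hs
    have h1 := hGe₀ s hs
    have h2 := hGe s hs
    have h3 := congrArg (starRingEnd ℂ) (hGe _ hs')
    rw [Nat.cast_zero, zero_div, zero_add] at h2 h3
    rw [Nat.cast_one] at h1
    rw [Complex.conj_tsum] at h3
    have S₀ := (summable_prime_lterm b₀ hs)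
    have S := (summable_prime_lterm b hs)
    have S' : Summable fun p : {𝔭 : Ideal (𝓞 K) // Prime 𝔭} =>
        starRingEnd ℂ ((logNorm p.1 : ℂ) * lterm χ (starRingEnd ℂ s) p.1) := by
      have := (summable_prime_lterm b hs')
      exact (Complex.summable_conj).2 this
    simp only [Pi.add_apply, Pi.mul_apply]
    rw [← h2, ← h3, ← S.tsum_add S', ← tsum_mul_left, Complex.ofReal_one, ← add_assoc, ← h1,
      ← S₀.tsum_add ((S.add S').mul_left _)]
    refine tsum_congr fun p => ?_
    have := lterm_conj (χ := χ) s p.1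
    rw [map_mul, Complex.conj_ofReal, ← mul_add, this, lterm, e₀, hb₁]
    push_cast
    ring
  have := T₁.sub T₀
  rw [sub_self] at this
  refine this.congr fun u => ?_
  rw [← mul_sub]
  congr 1
  have hsm : ∀ {b : {𝔭 : Ideal (𝓞 K) // Prime 𝔭} → ℝ} {B : ℝ}, (∀ p, 0 ≤ b p) →
      (∀ p, b p ≤ B * logNorm p.1) → Summable fun p => if logNorm p.1 ≤ u then b p else 0 := by
    intro b B h0 hb
    refine summable_of_hasFiniteSupport (((finite_logNorm_le K u).preimage
      Subtype.val_injective.injOn).subset fun p hp => ?_)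
    by_contra h1
    exact hp (if_neg h1)
  unfold partialSum
  rw [← (hsm hb0 hb2).tsum_sub (hsm (B := 1) (fun p => mul_nonneg (logNorm_nonneg _)
    (norm_nonneg _)) fun p => by
      rw [one_mul]; exact mul_le_of_le_one_right (logNorm_nonneg _) (b _))]
  refine tsum_congr fun p => ?_
  split_ifs <;> simp [hb₁]

end PrimeSums

section Lattice

lemma norm_lattice_sum_sub_integral_le (b : Module.Basis (Fin 2) ℝ ℂ) {F : ℂ → ℂ} {M : ℂ → ℝ}
    (hF : Integrable F) (hM : Integrable M) {B : ℝ} (hFB : ∀ z, B < ‖z‖ → F z = 0)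
    (hMB : ∀ z, B < ‖z‖ → M z = 0)
    (hFM : ∀ z, ∀ w ∈ ZSpan.fundamentalDomain b, ‖F (z + w) - F z‖ ≤ M (z + w)) (z₀ : ℂ) :
    ‖(volume.real (ZSpan.fundamentalDomain b) : ℂ) *
      ∑' v : Submodule.span ℤ (Set.range b), F (z₀ + v) - ∫ z, F z‖ ≤ ∫ z, M z := by
  set D := ZSpan.fundamentalDomain b with hD
  have hfd := ZSpan.isAddFundamentalDomain b (volume : Measure ℂ)
  have hinv : VAddInvariantMeasure (Submodule.span ℤ (Set.range b)) ℂ volume :=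
    inferInstanceAs (VAddInvariantMeasure (Submodule.span ℤ (Set.range b)).toAddSubgroup ℂ volume)
  obtain ⟨d, hd⟩ := (ZSpan.fundamentalDomain_isBounded b).exists_norm_le
  have hDv : volume D ≠ ⊤ := (ZSpan.fundamentalDomain_isBounded b).measure_lt_top.ne
  have eF : ∫ z, F z = ∑' v : Submodule.span ℤ (Set.range b), ∫ w in D, F (z₀ + v + w) := by
    rw [← integral_add_left_eq_self F z₀, hfd.integral_eq_tsum'' _ (hF.comp_add_left z₀)]
    simp only [add_assoc]; rfl
  have eM : ∫ z, M z = ∑' v : Submodule.span ℤ (Set.range b), ∫ w in D, M (z₀ + v + w) := by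
    rw [← integral_add_left_eq_self M z₀, hfd.integral_eq_tsum'' _ (hM.comp_add_left z₀)]
    simp only [add_assoc]; rfl
  have hfin : {v : Submodule.span ℤ (Set.range b) | ‖z₀ + v‖ ≤ B + d}.Finite := by
    have h1 := ZSpan.setFinite_inter b (Metric.isBounded_closedBall (x := (0 : ℂ))
      (r := ‖z₀‖ + (B + d)))
    refine (h1.preimage Subtype.val_injective.injOn).subset fun v hv => ⟨?_, v.2⟩
    rw [mem_closedBall_zero_iff]
    calc ‖(v : ℂ)‖ = ‖z₀ + v - z₀‖ := by rw [add_sub_cancel_left]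
      _ ≤ ‖z₀ + v‖ + ‖z₀‖ := norm_sub_le _ _
      _ ≤ _ := by rw [Set.mem_ofPred_eq] at hv; linarith
  have hfar : ∀ v : Submodule.span ℤ (Set.range b), ¬ ‖z₀ + v‖ ≤ B + d → ∀ w ∈ D,
      B < ‖z₀ + v + w‖ := by
    intro v hv w hw
    have h1 := norm_sub_le (z₀ + v + w) w
    rw [add_sub_cancel_right] at h1
    have := hd w hw
    push Not at hv
    linarith
  have d0 : 0 ≤ d := (norm_nonneg _).trans (hd _ (ZSpan.fract_mem_fundamentalDomain b 0))
  have hDm : MeasurableSet D := ZSpan.fundamentalDomain_measurableSet b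
  have sF : Summable fun v : Submodule.span ℤ (Set.range b) => ∫ w in D, F (z₀ + v + w) :=
    summable_of_hasFiniteSupport (hfin.subset fun v hv => by
      by_contra h1
      exact hv (setIntegral_eq_zero_of_forall_eq_zero fun w hw => hFB _ (hfar v h1 w hw)))
  have sM : Summable fun v : Submodule.span ℤ (Set.range b) => ∫ w in D, M (z₀ + v + w) :=
    summable_of_hasFiniteSupport (hfin.subset fun v hv => by
      by_contra h1
      exact hv (setIntegral_eq_zero_of_forall_eq_zero fun w hw => hMB _ (hfar v h1 w hw)))
  have sF' : Summable fun v : Submodule.span ℤ (Set.range b) => F (z₀ + v) :=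
    summable_of_hasFiniteSupport (hfin.subset fun v hv => by
      by_contra h1
      exact hv (hFB _ (by rw [Set.mem_ofPred_eq] at h1; linarith)))
  rw [eF, eM, ← tsum_mul_left, ← (sF'.mul_left _).tsum_sub sF]
  refine tsum_of_norm_bounded sM.hasSum fun v => ?_
  have h1 : (volume.real D : ℂ) * F (z₀ + v) = ∫ w in D, F (z₀ + v) := by
    rw [setIntegral_const]; simp
  have i1 : IntegrableOn (fun _ : ℂ => F (z₀ + v)) D := integrableOn_const hDv
  have i2 : IntegrableOn (fun w : ℂ => F (z₀ + v + w)) D := (hF.comp_add_left _).integrableOn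
  have i3 : IntegrableOn (fun w : ℂ => M (z₀ + v + w)) D := (hM.comp_add_left _).integrableOn
  rw [h1, ← integral_sub i1 i2]
  refine (norm_integral_le_integral_norm _).trans (setIntegral_mono_on (i1.sub i2).norm i3 hDm ?_)
  intro w hw
  rw [norm_sub_rev]
  exact hFM _ w hw

/-- The angular function `z ↦ (z / |z|) ^ k`. -/
noncomputable def angular (k : ℕ) (z : ℂ) : ℂ := (z / ‖z‖) ^ k

lemma norm_div_norm_le (z : ℂ) : ‖z / ‖z‖‖ ≤ 1 := by
  rw [norm_div, Complex.norm_real, norm_norm]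
  exact div_self_le_one _

lemma norm_angular_le (k : ℕ) (z : ℂ) : ‖angular k z‖ ≤ 1 := by
  rw [angular, norm_pow]
  exact pow_le_one₀ (norm_nonneg _) (norm_div_norm_le z)

lemma norm_pow_sub_pow_le {u v : ℂ} (hu : ‖u‖ ≤ 1) (hv : ‖v‖ ≤ 1) (k : ℕ) :
    ‖u ^ k - v ^ k‖ ≤ k * ‖u - v‖ := by
  induction k with
  | zero => simp
  | succ k ih =>
    have : u ^ (k + 1) - v ^ (k + 1) = u ^ k * (u - v) + (u ^ k - v ^ k) * v := by ring
    rw [this]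
    refine (norm_add_le _ _).trans ?_
    rw [norm_mul, norm_mul, norm_pow]
    have h1 : ‖u‖ ^ k ≤ 1 := pow_le_one₀ (norm_nonneg _) hu
    push_cast
    nlinarith [norm_nonneg (u - v), norm_nonneg (u ^ k - v ^ k)]

lemma norm_angular_sub_le (k : ℕ) {y : ℂ} (z : ℂ) (hy : y ≠ 0) :
    ‖angular k y - angular k z‖ ≤ 2 * k * ‖y - z‖ / ‖y‖ := by
  have hy' : 0 < ‖y‖ := norm_pos_iff.2 hy
  have hyc : (‖y‖ : ℂ) ≠ 0 := by exact_mod_cast hy'.ne'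
  have key : ‖y / ‖y‖ - z / ‖z‖‖ ≤ 2 * ‖y - z‖ / ‖y‖ := by
    by_cases hz : z = 0
    · rw [hz]; simp; field_simp; norm_num
    have hz' : 0 < ‖z‖ := norm_pos_iff.2 hz
    have hzc : (‖z‖ : ℂ) ≠ 0 := by exact_mod_cast hz'.ne'
    have h1 : y / ‖y‖ - z / ‖z‖ = (y - z) / ‖y‖ + z / ‖z‖ * (((‖z‖ - ‖y‖ : ℝ) : ℂ) / ‖y‖) := by
      push_cast; field_simp; ring
    rw [h1]
    refine (norm_add_le _ _).trans ?_
    rw [norm_mul, norm_div, norm_div _ (‖y‖ : ℂ), Complex.norm_real, norm_norm, Complex.norm_real,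
      mul_div_assoc, two_mul]
    have h2 : ‖‖z‖ - ‖y‖‖ ≤ ‖y - z‖ := by
      rw [norm_sub_rev]; exact abs_norm_sub_norm_le _ _
    refine add_le_add le_rfl ?_
    refine (mul_le_of_le_one_left (by positivity) (norm_div_norm_le z)).trans ?_
    gcongr
  rw [angular, angular]
  refine (norm_pow_sub_pow_le (norm_div_norm_le y) (norm_div_norm_le z) k).trans ?_
  calc (k : ℝ) * ‖y / ‖y‖ - z / ‖z‖‖ ≤ k * (2 * ‖y - z‖ / ‖y‖) := by gcongr
    _ = _ := by ring

/-- The angular function truncated to the disc of radius `R`. -/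
noncomputable def discAngular (k : ℕ) (R : ℝ) (z : ℂ) : ℂ := if ‖z‖ ≤ R then angular k z else 0

lemma norm_discAngular_le (k : ℕ) (R : ℝ) (z : ℂ) : ‖discAngular k R z‖ ≤ 1 := by
  rw [discAngular]
  split_ifs
  · exact norm_angular_le k z
  · simp

lemma integrable_indicator_closedBall (R : ℝ) :
    Integrable ((Metric.closedBall (0 : ℂ) R).indicator fun _ => (1 : ℝ)) :=
  (integrable_indicator_iff Metric.isClosed_closedBall.measurableSet).2
    (integrableOn_const Metric.isBounded_closedBall.measure_lt_top.ne)

lemma integrable_indicator_ball (R : ℝ) :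
    Integrable ((Metric.ball (0 : ℂ) R).indicator fun _ => (1 : ℝ)) :=
  (integrable_indicator_iff Metric.isOpen_ball.measurableSet).2
    (integrableOn_const Metric.isBounded_ball.measure_lt_top.ne)

lemma integral_indicator_closedBall {R : ℝ} (hR : 0 ≤ R) :
    ∫ z, (Metric.closedBall (0 : ℂ) R).indicator (fun _ => (1 : ℝ)) z = Real.pi * R ^ 2 := by
  rw [integral_indicator Metric.isClosed_closedBall.measurableSet, setIntegral_const, smul_eq_mul,
    mul_one, measureReal_def, Complex.volume_closedBall]
  simp [hR, mul_comm]

lemma le_integral_indicator_ball {R d : ℝ} (hR : 0 ≤ R) (hd : 0 ≤ d) :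
    Real.pi * (R ^ 2 - 2 * d * R) ≤
      ∫ z, (Metric.ball (0 : ℂ) (R - d)).indicator (fun _ => (1 : ℝ)) z := by
  rw [integral_indicator Metric.isOpen_ball.measurableSet, setIntegral_const, smul_eq_mul,
    mul_one, measureReal_def, Complex.volume_ball]
  simp only [ENNReal.toReal_mul, ENNReal.toReal_pow, ENNReal.coe_toReal, NNReal.coe_real_pi]
  rw [mul_comm]
  refine mul_le_mul_of_nonneg_right ?_ Real.pi_pos.le
  rcases le_total d R with h | h
  · rw [ENNReal.toReal_ofReal (by linarith)]; nlinarith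
  · have : R ^ 2 - 2 * d * R ≤ 0 := by nlinarith
    exact this.trans (by positivity)

lemma measurable_discAngular (k : ℕ) (R : ℝ) : Measurable (discAngular k R) := by
  refine Measurable.ite (measurableSet_le measurable_norm measurable_const) ?_ measurable_const
  unfold angular
  fun_prop

lemma integrable_discAngular (k : ℕ) (R : ℝ) : Integrable (discAngular k R) := by
  refine (integrable_indicator_closedBall R).mono' (measurable_discAngular k R).aestronglyMeasurable
    (ae_of_all _ fun z => ?_)
  by_cases h : ‖z‖ ≤ R
  · rw [Set.indicator_of_mem (mem_closedBall_zero_iff.2 h)]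
    exact norm_discAngular_le k R z
  · rw [discAngular, if_neg h, norm_zero]
    exact Set.indicator_nonneg (fun _ _ => zero_le_one) _

lemma integral_discAngular_zero {R : ℝ} (hR : 0 ≤ R) :
    ∫ z, discAngular 0 R z = (Real.pi * R ^ 2 : ℝ) := by
  rw [← integral_indicator_closedBall hR, ← integral_complex_ofReal]
  refine integral_congr_ae (ae_of_all _ fun z => ?_)
  by_cases h : ‖z‖ ≤ R
  · simp [discAngular, angular, h]
  · simp [discAngular, h]

lemma integral_discAngular_of_ne_zero {k : ℕ} (hk : k ≠ 0) (R : ℝ) :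
    ∫ z, discAngular k R z = 0 := by
  set ζ : Circle := Circle.exp (Real.pi / k) with hζ
  have hζk : (ζ : ℂ) ^ k = -1 := by
    rw [hζ, Circle.coe_exp, ← Complex.exp_nat_mul]
    have : (k : ℂ) ≠ 0 := by exact_mod_cast hk
    rw [show (k : ℂ) * (((Real.pi / k : ℝ) : ℂ) * Complex.I) = Real.pi * Complex.I by
      push_cast; field_simp, Complex.exp_pi_mul_I]
  have h1 := (rotation ζ).measurePreserving.integral_comp
    (rotation ζ).toHomeomorph.measurableEmbedding (discAngular k R)
  have h2 : ∀ z, discAngular k R (rotation ζ z) = -discAngular k R z := by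
    intro z
    rw [rotation_apply, discAngular, discAngular, norm_mul, Circle.norm_coe, one_mul]
    split_ifs
    · rw [angular, angular, norm_mul, Circle.norm_coe, one_mul, mul_div_assoc, mul_pow, hζk]; ring
    · simp
  simp only [h2, integral_neg] at h1
  linear_combination (-1 / 2 : ℂ) * h1

theorem exists_lattice_sum_bound (b : Module.Basis (Fin 2) ℝ ℂ) (k : ℕ) :
    ∃ C : ℝ, ∀ R : ℝ, 1 ≤ R → ∀ z₀ : ℂ,
      ‖(volume.real (ZSpan.fundamentalDomain b) : ℂ) *
        ∑' v : Submodule.span ℤ (Set.range b), discAngular k R (z₀ + v) -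
          ∫ z, discAngular k R z‖ ≤ C * (R * Real.sqrt R) := by
  obtain ⟨d, hd⟩ := (ZSpan.fundamentalDomain_isBounded b).exists_norm_le
  have d0 : 0 ≤ d := (norm_nonneg _).trans (hd _ (ZSpan.fract_mem_fundamentalDomain b 0))
  refine ⟨Real.pi * (2 + 2 * (8 * d + 4 * d ^ 2) + 2 * k * d), fun R hR z₀ => ?_⟩
  set S := Real.sqrt R with hS
  have hS1 : 1 ≤ S := Real.one_le_sqrt.2 hR
  have hSS : S * S = R := Real.mul_self_sqrt (by linarith)
  set I : ℝ → ℂ → ℝ := fun T => (Metric.closedBall (0 : ℂ) T).indicator fun _ => (1 : ℝ) with hI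
  set J : ℂ → ℝ := (Metric.ball (0 : ℂ) (R - 2 * d)).indicator fun _ => (1 : ℝ) with hJ
  set M : ℂ → ℝ := fun z => 2 * I S z + 2 * (I (R + 2 * d) z - J z) + 2 * k * d / S * I R z with hM
  have iM : Integrable M := (((integrable_indicator_closedBall S).const_mul 2).add
    (((integrable_indicator_closedBall (R + 2 * d)).sub
      (integrable_indicator_ball _)).const_mul 2)).add
      ((integrable_indicator_closedBall R).const_mul _)
  have h_int : ∫ z, M z ≤ Real.pi * (2 + 2 * (8 * d + 4 * d ^ 2) + 2 * k * d) * (R * S) := by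
    have i1 := (integrable_indicator_closedBall S).const_mul 2
    have i2 := (((integrable_indicator_closedBall (R + 2 * d)).sub
      (integrable_indicator_ball (R - 2 * d)))).const_mul 2
    have i3 := (integrable_indicator_closedBall R).const_mul (2 * k * d / S)
    have e : ∫ z, M z = 2 * (Real.pi * S ^ 2) + 2 * (Real.pi * (R + 2 * d) ^ 2 - ∫ z, J z) +
        2 * k * d / S * (Real.pi * R ^ 2) := by
      have a1 := integral_add (i1.add i2) i3
      have a2 := integral_add i1 i2
      have a3 := integral_sub (integrable_indicator_closedBall (R + 2 * d))
        (integrable_indicator_ball (R - 2 * d))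
      simp only [Pi.add_apply, Pi.sub_apply] at a1 a2 a3
      rw [hM]
      simp only [hI, hJ]
      rw [a1, a2, integral_const_mul, integral_const_mul, integral_const_mul, a3,
        integral_indicator_closedBall (by linarith), integral_indicator_closedBall (by linarith),
        integral_indicator_closedBall (by linarith)]
    have h2 := le_integral_indicator_ball (R := R) (d := 2 * d) (by linarith) (by linarith)
    have h3 : 2 * k * d / S * (Real.pi * R ^ 2) = Real.pi * (2 * k * d) * (R * S) := by
      have : S ≠ 0 := by linarith
      field_simp
      rw [← hSS]; ring
    rw [e, h3]
    have h4 : R ≤ R * S := by nlinarith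
    have h5 : 1 ≤ R * S := by nlinarith
    have h6 : 2 * (Real.pi * S ^ 2) ≤ Real.pi * 2 * (R * S) := by
      rw [sq, hSS]; nlinarith [Real.pi_pos]
    have h7 : Real.pi * (R + 2 * d) ^ 2 - ∫ z, J z ≤ Real.pi * (8 * d + 4 * d ^ 2) * (R * S) := by
      calc Real.pi * (R + 2 * d) ^ 2 - ∫ z, J z
          ≤ Real.pi * (R + 2 * d) ^ 2 - Real.pi * (R ^ 2 - 2 * (2 * d) * R) := by
            linarith
        _ = Real.pi * (8 * d * R + 4 * d ^ 2 * 1) := by ring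
        _ ≤ Real.pi * (8 * d * (R * S) + 4 * d ^ 2 * (R * S)) := by gcongr
        _ = _ := by ring
    linarith
  refine (norm_lattice_sum_sub_integral_le b (integrable_discAngular k R) iM (B := R + 2 * d)
    ?_ ?_ ?_ z₀).trans h_int
  · intro z hz
    rw [discAngular, if_neg (by linarith)]
  · intro z hz
    have n1 : z ∉ Metric.closedBall (0 : ℂ) S := by
      rw [mem_closedBall_zero_iff]; nlinarith
    have n2 : z ∉ Metric.closedBall (0 : ℂ) (R + 2 * d) := by
      rw [mem_closedBall_zero_iff]; linarith
    have n3 : z ∉ Metric.closedBall (0 : ℂ) R := by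
      rw [mem_closedBall_zero_iff]; linarith
    have n4 : z ∉ Metric.ball (0 : ℂ) (R - 2 * d) := by
      rw [mem_ball_zero_iff]; linarith
    simp [hM, hI, hJ, Set.indicator_of_notMem, n1, n2, n3, n4]
  · intro z w hw
    have hwd := hd w hw
    set y := z + w with hy
    have hzy : z = y - w := by rw [hy]; ring
    have hyz : ‖y‖ ≤ ‖z‖ + d := (norm_add_le _ _).trans (by linarith)
    have hzy' : ‖z‖ ≤ ‖y‖ + d := by rw [hzy]; exact (norm_sub_le _ _).trans (by linarith)
    have n1 : ∀ T, 0 ≤ I T y := fun T => Set.indicator_nonneg (fun _ _ => zero_le_one) _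
    have n2 : J y ≤ I (R + 2 * d) y :=
      Set.indicator_le_indicator_of_subset (Metric.ball_subset_closedBall.trans
        (Metric.closedBall_subset_closedBall (by linarith))) (fun _ => zero_le_one) y
    have n3 : 0 ≤ 2 * k * d / S * I R y := mul_nonneg (by positivity) (n1 R)
    have two : ‖discAngular k R y - discAngular k R z‖ ≤ 2 := by
      refine (norm_sub_le _ _).trans ?_
      linarith [norm_discAngular_le k R y, norm_discAngular_le k R z]
    by_cases c1 : ‖y‖ ≤ R + 2 * d
    · have v1 : I (R + 2 * d) y = 1 := Set.indicator_of_mem (mem_closedBall_zero_iff.2 c1) _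
      by_cases c2 : ‖y‖ < R - 2 * d
      · by_cases c3 : ‖y‖ ≤ S
        · have v3 : I S y = 1 := Set.indicator_of_mem (mem_closedBall_zero_iff.2 c3) _
          simp only [hM]
          linarith
        · have v4 : I R y = 1 := Set.indicator_of_mem (mem_closedBall_zero_iff.2 (by linarith)) _
          push Not at c3
          have hy0 : y ≠ 0 := fun h => by rw [h, norm_zero] at c3; linarith
          rw [discAngular, discAngular, if_pos (by linarith), if_pos (by linarith)]
          have h5 : ‖angular k y - angular k z‖ ≤ 2 * k * d / S := by
            refine (norm_angular_sub_le k z hy0).trans ?_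
            rw [hy, add_sub_cancel_left, ← hy]
            gcongr
          simp only [hM]
          rw [v4]
          linarith [n1 S]
      · have v2 : J y = 0 := Set.indicator_of_notMem (by rwa [mem_ball_zero_iff]) _
        simp only [hM]
        linarith [n1 S]
    · rw [discAngular, discAngular, if_neg (by linarith), if_neg (by linarith), sub_zero, norm_zero]
      simp only [hM]
      linarith [n1 S]

end Lattice

section Embedding

variable {K : Type*} [Field K] [NumberField K]

omit [NumberField K] in
lemma conjugate_ne_self (himag : IsEmpty (K →+* ℝ)) (emb : K →+* ℂ) :
    ComplexEmbedding.conjugate emb ≠ emb := fun h =>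
  himag.false (ComplexEmbedding.IsReal.embedding (ComplexEmbedding.isReal_iff.2 h))

lemma univ_embeddings (hdeg : Module.finrank ℚ K = 2) (himag : IsEmpty (K →+* ℝ))
    (emb : K →+* ℂ) [DecidableEq (K →+* ℂ)] :
    (Finset.univ : Finset (K →+* ℂ)) = {ComplexEmbedding.conjugate emb, emb} := by
  refine (Finset.eq_of_subset_of_card_le (Finset.subset_univ _) ?_).symm
  rw [Finset.card_pair (conjugate_ne_self himag emb), Finset.card_univ, Embeddings.card, hdeg]

lemma absNorm_span_singleton_eq (hdeg : Module.finrank ℚ K = 2) (himag : IsEmpty (K →+* ℝ))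
    (emb : K →+* ℂ) (α : 𝓞 K) : (Ideal.absNorm (Ideal.span {α}) : ℝ) = ‖emb α‖ ^ 2 := by
  classical
  have h1 : ((Algebra.norm ℚ (α : K) : ℚ) : ℂ) = ((‖emb α‖ ^ 2 : ℝ) : ℂ) := by
    have h2 := Algebra.norm_eq_prod_embeddings ℚ ℂ (α : K)
    rw [eq_ratCast] at h2
    rw [h2, Fintype.prod_equiv (RingHom.equivRatAlgHom K ℂ).symm (fun σ : K →ₐ[ℚ] ℂ => σ (α : K))
      (fun φ : K →+* ℂ => φ α) (fun σ => rfl), univ_embeddings hdeg himag emb,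
      Finset.prod_pair (conjugate_ne_self himag emb), ComplexEmbedding.conjugate_coe_eq,
      Complex.conj_mul']
    push_cast; rfl
  have h3 : ((Algebra.norm ℚ (α : K) : ℚ) : ℝ) = ‖emb α‖ ^ 2 := by exact_mod_cast h1
  rw [Ideal.absNorm_span_singleton, Nat.cast_natAbs, Int.cast_abs]
  have h4 : ((Algebra.norm ℤ α : ℤ) : ℝ) = ‖emb α‖ ^ 2 := by
    rw [← h3, ← Algebra.coe_norm_int]; push_cast; rfl
  rw [h4, abs_of_nonneg (sq_nonneg _)]

lemma finite_norm_emb_le (hdeg : Module.finrank ℚ K = 2) (himag : IsEmpty (K →+* ℝ))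
    (emb : K →+* ℂ) (R : ℝ) : {α : 𝓞 K | ‖emb α‖ ≤ R}.Finite := by
  classical
  refine ((Embeddings.finite_of_norm_le K ℂ R).preimage
    (RingOfIntegers.coe_injective (K := K)).injOn).subset
      fun α hα => ⟨α.isIntegral_coe, fun φ => ?_⟩
  have h1 : φ ∈ (Finset.univ : Finset (K →+* ℂ)) := Finset.mem_univ _
  rw [univ_embeddings hdeg himag emb, Finset.mem_insert, Finset.mem_singleton] at h1
  rcases h1 with rfl | rfl
  · rw [ComplexEmbedding.conjugate_coe_eq, Complex.norm_conj]; exact hα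
  · exact hα

lemma finite_units (hdeg : Module.finrank ℚ K = 2) (himag : IsEmpty (K →+* ℝ))
    (emb : K →+* ℂ) : Finite (𝓞 K)ˣ := by
  have h1 : {u : (𝓞 K)ˣ | (u : 𝓞 K) ∈ {α : 𝓞 K | ‖emb α‖ ≤ 1}}.Finite :=
    (finite_norm_emb_le hdeg himag emb 1).preimage Units.val_injective.injOn
  refine Set.finite_univ_iff.1 (h1.subset fun u _ => ?_)
  have h2 := absNorm_span_singleton_eq hdeg himag emb (u : 𝓞 K)
  rw [Ideal.span_singleton_eq_top.2 u.isUnit, Ideal.absNorm_top] at h2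
  push_cast at h2
  change ‖emb _‖ ≤ 1
  nlinarith [norm_nonneg (emb ((u : 𝓞 K) : K))]

/-- A nonzero ideal of an imaginary quadratic field is a lattice in `ℂ`. -/
lemma exists_lattice_basis (hdeg : Module.finrank ℚ K = 2) (himag : IsEmpty (K →+* ℝ))
    (emb : K →+* ℂ) {𝔪 : Ideal (𝓞 K)} (h𝔪 : 𝔪 ≠ ⊥) :
    ∃ b : Module.Basis (Fin 2) ℝ ℂ, ∃ e : 𝔪 ≃ Submodule.span ℤ (Set.range b),
      ∀ m : 𝔪, (e m : ℂ) = emb (m : 𝓞 K) := by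
  classical
  have hcard : Fintype.card (Module.Free.ChooseBasisIndex ℤ (𝓞 K)) = 2 := by
    rw [← Module.finrank_eq_card_chooseBasisIndex, RingOfIntegers.rank, hdeg]
  set B : Module.Basis (Fin 2) ℤ 𝔪 :=
    (𝔪.selfBasis (RingOfIntegers.basis K) h𝔪).reindex (Fintype.equivFinOfCardEq hcard) with hB
  set φ : 𝔪 →ₗ[ℤ] ℂ :=
    ((emb.comp (algebraMap (𝓞 K) K)).toAddMonoidHom.toIntLinearMap).comp
      (𝔪.subtype.restrictScalars ℤ) with hφ
  have hφe : ∀ m : 𝔪, φ m = emb ((m : 𝓞 K) : K) := fun m => rfl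
  have hφi : Function.Injective φ := fun m n h => by
    rw [hφe, hφe] at h
    exact Subtype.ext (RingOfIntegers.coe_injective (emb.injective h))
  have hexp : ∀ m : 𝔪, φ m = B.repr m 0 * φ (B 0) + B.repr m 1 * φ (B 1) := by
    intro m
    conv_lhs => rw [← B.sum_repr m]
    rw [Fin.sum_univ_two, map_add, map_smul, map_smul, zsmul_eq_mul, zsmul_eq_mul]
  have hne0 : φ (B 0) ≠ 0 := fun h => B.ne_zero 0 (hφi (by rw [h, map_zero]))
  have hli : LinearIndependent ℝ ![φ (B 0), φ (B 1)] := by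
    rw [LinearIndependent.pair_iff]
    intro s t hst
    simp only [Complex.real_smul] at hst
    by_cases ht : t = 0
    · refine ⟨?_, ht⟩
      rw [ht, Complex.ofReal_zero, zero_mul, add_zero, mul_eq_zero] at hst
      exact_mod_cast hst.resolve_right hne0
    · exfalso
      have htc : (t : ℂ) ≠ 0 := by exact_mod_cast ht
      have h1 : φ (B 1) = ((-s / t : ℝ) : ℂ) * φ (B 0) := by
        push_cast; field_simp; linear_combination hst
      have h_int : ∀ α : 𝓞 K, starRingEnd ℂ (emb α) = emb α := by
        intro α
        have h2 := hexp (α • B 0)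
        rw [h1, hφe] at h2
        have h3 : emb ((α • B 0 : 𝔪) : 𝓞 K) = emb α * φ (B 0) := by
          rw [hφe, Submodule.coe_smul, smul_eq_mul, ← map_mul, ← map_mul]
        rw [h3] at h2
        have h4 : emb α = ((B.repr (α • B 0) 0 + B.repr (α • B 0) 1 * (-s / t) : ℝ) : ℂ) := by
          refine mul_right_cancel₀ hne0 (h2.trans ?_)
          push_cast; ring
        rw [h4, Complex.conj_ofReal]
      refine conjugate_ne_self himag emb (RingHom.ext fun x => ?_)
      obtain ⟨a, d, hd, rfl⟩ := IsFractionRing.div_surjective (A := 𝓞 K) x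
      rw [ComplexEmbedding.conjugate_coe_eq, map_div₀, map_div₀, h_int, h_int]
  set b : Module.Basis (Fin 2) ℝ ℂ := basisOfLinearIndependentOfCardEqFinrank hli
    (by rw [Fintype.card_fin, Complex.finrank_real_complex]) with hb
  have hbr : Set.range b = Set.range (φ ∘ B) := by
    rw [hb, coe_basisOfLinearIndependentOfCardEqFinrank]
    congr 1
    funext i
    fin_cases i <;> rfl
  have hrange : Submodule.span ℤ (Set.range b) = LinearMap.range φ := by
    rw [hbr, Set.range_comp, Submodule.span_image, B.span_eq, Submodule.map_top]
  refine ⟨b, (LinearEquiv.ofInjective φ hφi).toEquiv.trans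
    (LinearEquiv.ofEq _ _ hrange.symm).toEquiv, fun m => rfl⟩

/-- Coset decomposition of the ring of integers. -/
noncomputable def cosetEquiv (𝔪 : Ideal (𝓞 K)) : (𝓞 K ⧸ 𝔪) × 𝔪 ≃ 𝓞 K :=
  Equiv.ofBijective (fun x => x.1.out + x.2) <| by
    have hmk : ∀ x : (𝓞 K ⧸ 𝔪) × 𝔪, Ideal.Quotient.mk 𝔪 (x.1.out + x.2) = x.1 := fun x => by
      rw [map_add, Ideal.Quotient.eq_zero_iff_mem.2 x.2.2, add_zero]
      exact Quotient.out_eq _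
    refine ⟨fun x y h => ?_, fun α => ?_⟩
    · have h1 : x.1 = y.1 := by rw [← hmk x, ← hmk y]; exact congrArg _ h
      refine Prod.ext h1 (Subtype.ext ?_)
      simp only [h1] at h
      exact add_left_cancel h
    · have hm : α - (Ideal.Quotient.mk 𝔪 α).out ∈ 𝔪 :=
        Ideal.Quotient.eq.1 (Quotient.out_eq (Ideal.Quotient.mk 𝔪 α)).symm
      exact ⟨⟨Ideal.Quotient.mk 𝔪 α, ⟨_, hm⟩⟩, add_sub_cancel _ _⟩

omit [NumberField K] in
lemma cosetEquiv_apply {𝔪 : Ideal (𝓞 K)} (q : 𝓞 K ⧸ 𝔪) (m : 𝔪) :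
    cosetEquiv 𝔪 (q, m) = q.out + m := rfl

set_option maxHeartbeats 1000000 in
theorem exists_periodic_sum_bound (hdeg : Module.finrank ℚ K = 2) (himag : IsEmpty (K →+* ℝ))
    (emb : K →+* ℂ) {𝔪 : Ideal (𝓞 K)} (h𝔪 : 𝔪 ≠ ⊥) [Fintype (𝓞 K ⧸ 𝔪)] :
    ∃ c : ℝ, 0 < c ∧ ∀ E : 𝓞 K → ℂ, (∀ α, ∀ m ∈ 𝔪, E (α + m) = E α) → ∀ k : ℕ,
      ∃ C : ℝ, ∀ R : ℝ, 1 ≤ R → ‖∑' α : 𝓞 K, E α * discAngular k R (emb α) -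
        (if k = 0 then c * ∑ q : 𝓞 K ⧸ 𝔪, E q.out else 0) * R ^ 2‖ ≤ C * (R * Real.sqrt R) := by
  obtain ⟨b, e, he⟩ := exists_lattice_basis hdeg himag emb h𝔪
  set V := volume.real (ZSpan.fundamentalDomain b) with hV
  have hV0 : 0 < V := ENNReal.toReal_pos (ZSpan.measure_fundamentalDomain_ne_zero b)
    (ZSpan.fundamentalDomain_isBounded b).measure_lt_top.ne
  refine ⟨Real.pi / V, div_pos Real.pi_pos hV0, fun E hE k => ?_⟩
  obtain ⟨C, hC⟩ := exists_lattice_sum_bound b k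
  refine ⟨(∑ q : 𝓞 K ⧸ 𝔪, ‖E q.out‖) * (C / V), fun R hR => ?_⟩
  have hVc : (V : ℂ) ≠ 0 := by exact_mod_cast hV0.ne'
  have hfs : ∀ {F : 𝓞 K → ℂ}, (∀ α : 𝓞 K, R < ‖emb (α : K)‖ → F α = 0) → Summable F := fun {F} hF =>
    summable_of_hasFiniteSupport ((finite_norm_emb_le hdeg himag emb R).subset fun α hα => by
      by_contra h1
      exact hα (hF α (not_le.1 h1)))
  have hz : ∀ α : 𝓞 K, R < ‖emb α‖ → E α * discAngular k R (emb α) = 0 := fun α hα => by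
    rw [discAngular, if_neg (not_le.2 hα), mul_zero]
  have hs : Summable fun x : (𝓞 K ⧸ 𝔪) × 𝔪 =>
      E (cosetEquiv 𝔪 x) * discAngular k R (emb (cosetEquiv 𝔪 x)) :=
    (cosetEquiv 𝔪).summable_iff.2 (hfs hz)
  have hsum : ∑' α : 𝓞 K, E α * discAngular k R (emb α) = ∑ q : 𝓞 K ⧸ 𝔪, E q.out *
      ∑' v : Submodule.span ℤ (Set.range b), discAngular k R (emb (q.out : 𝓞 K) + v) := by
    rw [← (cosetEquiv 𝔪).tsum_eq, hs.tsum_prod, tsum_fintype]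
    refine Finset.sum_congr rfl fun q _ => ?_
    rw [← e.tsum_eq, ← tsum_mul_left]
    refine tsum_congr fun m => ?_
    have hadd : emb ((q.out + (m : 𝓞 K) : 𝓞 K) : K) = emb (q.out : 𝓞 K) + emb (m : 𝓞 K) :=
      map_add (emb.comp (algebraMap (𝓞 K) K)) _ _
    rw [cosetEquiv_apply, hE _ _ m.2, he, hadd]
  have hmain : (if k = 0 then ((Real.pi / V : ℝ) : ℂ) * ∑ q : 𝓞 K ⧸ 𝔪, E q.out else 0) * R ^ 2 =
      ∑ q : 𝓞 K ⧸ 𝔪, E q.out * ((∫ z, discAngular k R z) / V) := by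
    split_ifs with hk
    · rw [hk, integral_discAngular_zero (by linarith), ← Finset.sum_mul]
      push_cast
      ring
    · rw [integral_discAngular_of_ne_zero hk]; simp
  rw [hsum, hmain, ← Finset.sum_sub_distrib, Finset.sum_mul, Finset.sum_mul]
  refine norm_sum_le_of_le _ fun q _ => ?_
  rw [← mul_sub, norm_mul, mul_assoc]
  refine mul_le_mul_of_nonneg_left ?_ (norm_nonneg _)
  have h1 := hC R hR (emb (q.out : 𝓞 K))
  have h2 : ∀ S I : ℂ, S - I / V = (V * S - I) / V := fun S I => by field_simp
  rw [h2, norm_div, Complex.norm_real, Real.norm_of_nonneg hV0.le, div_mul_eq_mul_div]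
  gcongr

end Embedding

section Hecke

variable {K : Type*} [Field K]

/-- An algebraic Hecke character of infinity type `1` modulo `𝔑`. -/
structure IsHeckeCharacter (emb : K →+* ℂ) (𝔑 : Ideal (𝓞 K)) (ψ : Ideal (𝓞 K) → ℂ) : Prop where
  map_mul : ∀ 𝔞 𝔟 : Ideal (𝓞 K), IsCoprime 𝔞 𝔑 → IsCoprime 𝔟 𝔑 → ψ (𝔞 * 𝔟) = ψ 𝔞 * ψ 𝔟
  ne_zero : ∀ 𝔞 : Ideal (𝓞 K), IsCoprime 𝔞 𝔑 → ψ 𝔞 ≠ 0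
  map_span : ∀ α : 𝓞 K, α - 1 ∈ 𝔑 → ψ (Ideal.span {α}) = emb (α : K)

lemma isCoprime_span_iff {α : 𝓞 K} {𝔑 : Ideal (𝓞 K)} :
    IsCoprime (Ideal.span {α}) 𝔑 ↔ ∃ γ, α * γ - 1 ∈ 𝔑 := by
  rw [Ideal.isCoprime_iff_exists]
  constructor
  · rintro ⟨i, hi, j, hj, h⟩
    obtain ⟨γ, rfl⟩ := Ideal.mem_span_singleton'.1 hi
    refine ⟨γ, ?_⟩
    rw [show α * γ - 1 = -j by linear_combination h]
    exact neg_mem hj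
  · rintro ⟨γ, h⟩
    exact ⟨α * γ, Ideal.mul_mem_right _ _ (Ideal.mem_span_singleton_self α), _, neg_mem h, by ring⟩

lemma angular_mul (k : ℕ) (x y : ℂ) : angular k (x * y) = angular k x * angular k y := by
  rw [angular, angular, angular, norm_mul, Complex.ofReal_mul, mul_div_mul_comm, mul_pow]

lemma norm_angular (k : ℕ) {x : ℂ} (hx : x ≠ 0) : ‖angular k x‖ = 1 := by
  rw [angular, norm_pow, norm_div, Complex.norm_real, norm_norm, div_self (norm_ne_zero_iff.2 hx),
    one_pow]

namespace IsHeckeCharacter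

variable {emb : K →+* ℂ} {𝔑 : Ideal (𝓞 K)} {ψ : Ideal (𝓞 K) → ℂ}

lemma ne_top (h : IsHeckeCharacter emb 𝔑 ψ) : 𝔑 ≠ ⊤ := by
  rintro rfl
  have h1 := h.map_span 0 trivial
  have h2 := h.ne_zero (Ideal.span {0}) (by
    rw [← Ideal.one_eq_top]; exact isCoprime_one_right)
  exact h2 (by rw [h1]; simp)

lemma ne_bot (h : IsHeckeCharacter emb 𝔑 ψ) {𝔞 : Ideal (𝓞 K)} (ha : IsCoprime 𝔞 𝔑) : 𝔞 ≠ ⊥ := by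
  rintro rfl
  rw [← Ideal.zero_eq_bot, isCoprime_zero_left, Ideal.isUnit_iff] at ha
  exact h.ne_top ha

lemma map_one (h : IsHeckeCharacter emb 𝔑 ψ) : ψ 1 = 1 := by
  have h1 := h.map_span 1 (by simp)
  simpa using h1

lemma map_pow (h : IsHeckeCharacter emb 𝔑 ψ) {𝔞 : Ideal (𝓞 K)} (ha : IsCoprime 𝔞 𝔑) (n : ℕ) :
    ψ (𝔞 ^ n) = ψ 𝔞 ^ n := by
  induction n with
  | zero => rw [pow_zero, pow_zero, h.map_one]
  | succ n ih => rw [pow_succ, h.map_mul _ _ ha.pow_left ha, ih, pow_succ]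

lemma map_span_mul_eq (h : IsHeckeCharacter emb 𝔑 ψ) {α β : 𝓞 K}
    (hα : IsCoprime (Ideal.span {α}) 𝔑) (hαβ : β - α ∈ 𝔑) :
    IsCoprime (Ideal.span {β}) 𝔑 ∧
      ψ (Ideal.span {α}) * emb β = ψ (Ideal.span {β}) * emb α := by
  obtain ⟨γ, hγ⟩ := isCoprime_span_iff.1 hα
  have hγβ : β * γ - 1 ∈ 𝔑 := by
    rw [show β * γ - 1 = (α * γ - 1) + γ * (β - α) by ring]
    exact add_mem hγ (Ideal.mul_mem_left _ _ hαβ)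
  have hβ : IsCoprime (Ideal.span {β}) 𝔑 := isCoprime_span_iff.2 ⟨γ, hγβ⟩
  have hc : IsCoprime (Ideal.span {γ}) 𝔑 := isCoprime_span_iff.2 ⟨α, by rwa [mul_comm]⟩
  refine ⟨hβ, ?_⟩
  have e : ∀ x y : 𝓞 K, emb ((x * y : 𝓞 K) : K) = emb x * emb y :=
    _root_.map_mul (emb.comp (algebraMap (𝓞 K) K))
  have h1 := h.map_span _ hγ
  have h2 := h.map_span _ hγβ
  rw [← Ideal.span_singleton_mul_span_singleton, h.map_mul _ _ hα hc, e] at h1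
  rw [← Ideal.span_singleton_mul_span_singleton, h.map_mul _ _ hβ hc, e] at h2
  refine mul_right_cancel₀ (h.ne_zero _ hc) ?_
  linear_combination emb β * h1 - emb α * h2

lemma sq_norm_eq [NumberField K] (h : IsHeckeCharacter emb 𝔑 ψ) (h𝔑 : 𝔑 ≠ ⊥)
    (hdeg : Module.finrank ℚ K = 2) (himag : IsEmpty (K →+* ℝ))
    {𝔞 : Ideal (𝓞 K)} (ha : IsCoprime 𝔞 𝔑) : ‖ψ 𝔞‖ ^ 2 = Ideal.absNorm 𝔞 := by
  classical
  have ha0 := h.ne_bot ha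
  have hprin : (𝔞 ^ Fintype.card (ClassGroup (𝓞 K))).IsPrincipal := by
    rw [← ClassGroup.mk0_eq_one_iff (pow_mem (mem_nonZeroDivisors_of_ne_zero ha0) _),
      ← pow_card_eq_one (x := ClassGroup.mk0 ⟨𝔞, mem_nonZeroDivisors_of_ne_zero ha0⟩),
      ← _root_.map_pow, SubmonoidClass.mk_pow]
  obtain ⟨β, hβ⟩ := hprin
  set n := Fintype.card (ClassGroup (𝓞 K)) with hn
  change _ = Ideal.span {β} at hβ
  have hcop : IsCoprime (Ideal.span {β}) 𝔑 := hβ ▸ ha.pow_left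
  obtain ⟨γ, hγ⟩ := isCoprime_span_iff.1 hcop
  have : Finite (𝓞 K ⧸ 𝔑) := 𝔑.finiteQuotientOfFreeOfNeBot h𝔑
  have hu : IsUnit (Ideal.Quotient.mk 𝔑 β) := by
    refine IsUnit.of_mul_eq_one (Ideal.Quotient.mk 𝔑 γ) ?_
    rw [← _root_.map_mul, ← _root_.map_one (Ideal.Quotient.mk 𝔑)]
    exact Ideal.Quotient.eq.2 hγ
  obtain ⟨u, hu⟩ := hu
  set m := Nat.card (𝓞 K ⧸ 𝔑)ˣ with hm
  have hm0 : m ≠ 0 := Nat.card_pos.ne'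
  have h1 : β ^ m - 1 ∈ 𝔑 := by
    refine Ideal.Quotient.eq.1 ?_
    rw [_root_.map_pow, _root_.map_one, ← hu, ← Units.val_pow_eq_pow_val, pow_card_eq_one',
      Units.val_one]
  have h2 := h.map_span _ h1
  have h3 : Ideal.span {β ^ m} = 𝔞 ^ (n * m) := by
    rw [← Ideal.span_singleton_pow, ← hβ, pow_mul]
  have h4 := absNorm_span_singleton_eq hdeg himag emb (β ^ m)
  rw [← h2, h3, h.map_pow ha, _root_.map_pow, norm_pow] at h4
  push_cast at h4
  refine (pow_left_inj₀ (by positivity) (by positivity)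
    (mul_ne_zero Fintype.card_ne_zero hm0)).1 (Eq.trans ?_ h4.symm)
  rw [← pow_mul, ← pow_mul, mul_comm]

/-- The unitary character `𝔞 ↦ (ψ(𝔞)/|ψ(𝔞)|) ^ k`, extended by zero. -/
noncomputable def angularChar (h : IsHeckeCharacter emb 𝔑 ψ) (k : ℕ) : Ideal (𝓞 K) →*₀ ℂ := by
  classical
  exact
  { toFun := fun 𝔞 => if IsCoprime 𝔞 𝔑 then angular k (ψ 𝔞) else 0
    map_zero' := if_neg fun hc => h.ne_bot hc rfl
    map_one' := by rw [if_pos isCoprime_one_left, h.map_one]; simp [angular]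
    map_mul' := fun 𝔞 𝔟 => by
      by_cases ha : IsCoprime 𝔞 𝔑
      · by_cases hb : IsCoprime 𝔟 𝔑
        · rw [if_pos (ha.mul_left hb), if_pos ha, if_pos hb, h.map_mul _ _ ha hb, angular_mul]
        · rw [if_neg fun hc => hb hc.of_mul_left_right, if_neg hb, mul_zero]
      · rw [if_neg fun hc => ha hc.of_mul_left_left, if_neg ha, zero_mul] }

variable (h : IsHeckeCharacter emb 𝔑 ψ)

lemma angularChar_of_isCoprime (k : ℕ) {𝔞 : Ideal (𝓞 K)} (ha : IsCoprime 𝔞 𝔑) :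
    h.angularChar k 𝔞 = angular k (ψ 𝔞) := if_pos ha

lemma angularChar_of_not_isCoprime (k : ℕ) {𝔞 : Ideal (𝓞 K)} (ha : ¬ IsCoprime 𝔞 𝔑) :
    h.angularChar k 𝔞 = 0 := if_neg ha

lemma norm_angularChar_of_isCoprime (k : ℕ) {𝔞 : Ideal (𝓞 K)} (ha : IsCoprime 𝔞 𝔑) :
    ‖h.angularChar k 𝔞‖ = 1 := by
  rw [angularChar_of_isCoprime h k ha, norm_angular k (h.ne_zero _ ha)]

lemma norm_angularChar_eq (k : ℕ) (𝔞 : Ideal (𝓞 K)) :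
    ‖h.angularChar k 𝔞‖ = 0 ∨ ‖h.angularChar k 𝔞‖ = 1 := by
  by_cases ha : IsCoprime 𝔞 𝔑
  · exact Or.inr (h.norm_angularChar_of_isCoprime k ha)
  · rw [h.angularChar_of_not_isCoprime k ha, norm_zero]; exact Or.inl rfl

lemma angularChar_zero_eq (k : ℕ) (𝔞 : Ideal (𝓞 K)) :
    h.angularChar 0 𝔞 = (‖h.angularChar k 𝔞‖ : ℝ) := by
  by_cases ha : IsCoprime 𝔞 𝔑
  · rw [h.norm_angularChar_of_isCoprime k ha, h.angularChar_of_isCoprime 0 ha, angular, pow_zero,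
      Complex.ofReal_one]
  · rw [h.angularChar_of_not_isCoprime k ha, h.angularChar_of_not_isCoprime 0 ha, norm_zero,
      Complex.ofReal_zero]

lemma angularChar_two_mul (k : ℕ) (𝔞 : Ideal (𝓞 K)) :
    h.angularChar (2 * k) 𝔞 = h.angularChar k 𝔞 ^ 2 := by
  by_cases ha : IsCoprime 𝔞 𝔑
  · rw [h.angularChar_of_isCoprime _ ha, h.angularChar_of_isCoprime _ ha, angular, angular,
      ← pow_mul, mul_comm]
  · rw [h.angularChar_of_not_isCoprime _ ha, h.angularChar_of_not_isCoprime _ ha]; simp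

/-- The finite part of `angularChar` on principal ideals. -/
noncomputable def finitePart (emb : K →+* ℂ) (𝔑 : Ideal (𝓞 K)) (ψ : Ideal (𝓞 K) → ℂ)
    (k : ℕ) (α : 𝓞 K) : ℂ := by
  classical
  exact if IsCoprime (Ideal.span {α}) 𝔑 then angular k (ψ (Ideal.span {α}) / emb α) else 0

include h in
lemma emb_ne_zero {α : 𝓞 K} (hα : IsCoprime (Ideal.span {α}) 𝔑) : emb (α : K) ≠ 0 := by
  have h1 := h.ne_bot hα
  rw [Ne, Ideal.span_singleton_eq_bot] at h1
  rw [Ne, map_eq_zero]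
  exact_mod_cast h1

lemma finitePart_mul (k : ℕ) (α : 𝓞 K) :
    finitePart emb 𝔑 ψ k α * angular k (emb α) =
      h.angularChar k (Ideal.span {α}) := by
  by_cases hα : IsCoprime (Ideal.span {α}) 𝔑
  · rw [finitePart, if_pos hα, ← angular_mul, div_mul_cancel₀ _ (h.emb_ne_zero hα),
      h.angularChar_of_isCoprime k hα]
  · rw [finitePart, if_neg hα, zero_mul, h.angularChar_of_not_isCoprime k hα]

include h in
lemma finitePart_add (k : ℕ) (α : 𝓞 K) {m : 𝓞 K} (hm : m ∈ 𝔑) :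
    finitePart emb 𝔑 ψ k (α + m) =
      finitePart emb 𝔑 ψ k α := by
  by_cases hα : IsCoprime (Ideal.span {α}) 𝔑
  · obtain ⟨h1, h2⟩ := h.map_span_mul_eq hα (β := α + m) (by rwa [add_sub_cancel_left])
    rw [finitePart, finitePart, if_pos hα, if_pos h1]
    congr 1
    rw [div_eq_div_iff (h.emb_ne_zero h1) (h.emb_ne_zero hα), h2]
  · rw [finitePart, finitePart, if_neg hα, if_neg]
    intro h1
    refine hα (h.map_span_mul_eq h1 (β := α) ?_).1
    rw [sub_add_cancel_left]
    exact neg_mem hm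

lemma finitePart_zero_of_isCoprime {α : 𝓞 K} (hα : IsCoprime (Ideal.span {α}) 𝔑) :
    finitePart emb 𝔑 ψ 0 α = 1 := by
  rw [finitePart, if_pos hα, angular, pow_zero]

end IsHeckeCharacter

end Hecke

section Counting

variable {K : Type*} [Field K]

/-- Generators of a nonzero principal ideal correspond to units. -/
noncomputable def unitsEquivGenerators {α : 𝓞 K} (hα : α ≠ 0) :
    (𝓞 K)ˣ ≃ {β : 𝓞 K // Ideal.span {β} = Ideal.span {α}} :=
  Equiv.ofBijective
    (fun u => ⟨α * u, Ideal.span_singleton_eq_span_singleton.2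
      (associated_mul_unit_left α u u.isUnit)⟩) <| by
    refine ⟨fun u v huv => ?_, fun β => ?_⟩
    · exact Units.ext (mul_left_cancel₀ hα (congrArg Subtype.val huv))
    · obtain ⟨u, hu⟩ := (Ideal.span_singleton_eq_span_singleton.1 β.2).symm
      exact ⟨u, Subtype.ext hu⟩

lemma tsum_span_singleton [Finite (𝓞 K)ˣ] {G : Ideal (𝓞 K) → ℂ} (hG : G.support.Finite)
    (hG0 : G ⊥ = 0) [DecidablePred fun 𝔠 : Ideal (𝓞 K) => 𝔠.IsPrincipal] :
    ∑' α : 𝓞 K, G (Ideal.span {α}) =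
      Nat.card (𝓞 K)ˣ * ∑' 𝔠 : Ideal (𝓞 K), if 𝔠.IsPrincipal then G 𝔠 else 0 := by
  have hfib : ∀ 𝔠 ∈ G.support, Finite {α : 𝓞 K // Ideal.span {α} = 𝔠} ∧
      Nat.card {α : 𝓞 K // Ideal.span {α} = 𝔠} =
        if 𝔠.IsPrincipal then Nat.card (𝓞 K)ˣ else 0 := by
    intro 𝔠 h𝔠
    split_ifs with hp
    · obtain ⟨α, rfl⟩ := hp
      have hα : α ≠ 0 := by
        rintro rfl
        exact h𝔠 (by simpa using hG0)
      exact ⟨Finite.of_equiv _ (unitsEquivGenerators hα),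
        Nat.card_congr (unitsEquivGenerators hα).symm⟩
    · have : IsEmpty {α : 𝓞 K // Ideal.span {α} = 𝔠} := ⟨fun α => hp ⟨α.1, α.2.symm⟩⟩
      exact ⟨inferInstance, Nat.card_of_isEmpty⟩
  have hs : Summable fun α : 𝓞 K => G (Ideal.span {α}) :=
    summable_of_hasFiniteSupport <|
      hG.preimage' (f := fun α : 𝓞 K => Ideal.span {α}) fun 𝔠 h𝔠 => by
        have := (hfib 𝔠 h𝔠).1
        exact @Set.toFinite _ {α : 𝓞 K | Ideal.span {α} = 𝔠} this
  have hs' : Summable fun x : (𝔠 : Ideal (𝓞 K)) × {α : 𝓞 K // Ideal.span {α} = 𝔠} =>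
      G (Ideal.span {Equiv.sigmaFiberEquiv (fun α : 𝓞 K => Ideal.span {α}) x}) :=
    (Equiv.sigmaFiberEquiv fun α : 𝓞 K => Ideal.span {α}).summable_iff.2 hs
  rw [← (Equiv.sigmaFiberEquiv fun α : 𝓞 K => Ideal.span {α}).tsum_eq, hs'.tsum_sigma,
    ← tsum_mul_left]
  refine tsum_congr fun 𝔠 => ?_
  have h1 : ∀ x : {α : 𝓞 K // Ideal.span {α} = 𝔠},
      G (Ideal.span {Equiv.sigmaFiberEquiv (fun α : 𝓞 K => Ideal.span {α}) ⟨𝔠, x⟩}) = G 𝔠 :=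
    fun x => congrArg G x.2
  simp only [h1]
  by_cases h𝔠 : G 𝔠 = 0
  · simp [h𝔠]
  · rw [tsum_const, (hfib 𝔠 h𝔠).2]
    split_ifs <;> simp

/-- `F` has mean value `c` over ideals, with a power saving. -/
def HasMean [NumberField K] (F : Ideal (𝓞 K) → ℂ) (c : ℂ) : Prop :=
  ∃ C : ℝ, ∀ u : ℝ, 0 < u →
    ‖partialSum logNorm F u - c * Real.exp u‖ ≤ C * Real.exp (3 / 4 * u)

lemma HasMean.sum [NumberField K] {ι : Type*} (s : Finset ι) {F : ι → Ideal (𝓞 K) → ℂ} {c : ι → ℂ}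
    (h : ∀ i ∈ s, HasMean (F i) (c i)) : HasMean (fun 𝔞 => ∑ i ∈ s, F i 𝔞) (∑ i ∈ s, c i) := by
  classical
  choose! C hC using h
  refine ⟨∑ i ∈ s, C i, fun u hu => ?_⟩
  have h1 : partialSum logNorm (fun 𝔞 => ∑ i ∈ s, F i 𝔞) u =
      ∑ i ∈ s, partialSum logNorm (F i) u := by
    simp only [partialSum]
    rw [← Summable.tsum_finsetSum]
    · refine tsum_congr fun 𝔞 => ?_
      split_ifs <;> simp
    · exact fun i _ => summable_of_hasFiniteSupport
        ((finite_logNorm_le K u).subset fun 𝔞 h𝔞 => by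
          by_contra hu'
          exact h𝔞 (if_neg hu'))
  rw [h1, Finset.sum_mul, ← Finset.sum_sub_distrib, Finset.sum_mul]
  exact norm_sum_le_of_le _ fun i hi => hC i hi u hu

end Counting

namespace IsHeckeCharacter

variable {K : Type*} [Field K] [NumberField K] {emb : K →+* ℂ} {𝔑 : Ideal (𝓞 K)}
  {ψ : Ideal (𝓞 K) → ℂ}

open scoped Classical in
lemma tsum_discAngular_eq (h : IsHeckeCharacter emb 𝔑 ψ)
    (hdeg : Module.finrank ℚ K = 2) (himag : IsEmpty (K →+* ℝ)) {𝔟 : Ideal (𝓞 K)}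
    (h𝔟 : IsCoprime 𝔟 𝔑) (k : ℕ) {u : ℝ} (hu : 0 ≤ u) :
    ∑' α : 𝓞 K, (if α ∈ 𝔟 then finitePart emb 𝔑 ψ k α else 0) *
      discAngular k (Real.sqrt (Real.exp u * Ideal.absNorm 𝔟)) (emb α) =
    Nat.card (𝓞 K)ˣ * (h.angularChar k 𝔟 * partialSum logNorm (fun 𝔞 =>
      if (𝔞 * 𝔟).IsPrincipal then h.angularChar k 𝔞 else 0) u) := by
  have := finite_units hdeg himag emb
  have h𝔟0 := h.ne_bot h𝔟
  have hN : (0 : ℝ) < Ideal.absNorm 𝔟 := by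
    exact_mod_cast Nat.pos_of_ne_zero (Ideal.absNorm_eq_zero_iff.not.2 h𝔟0)
  set X := Real.exp u * Ideal.absNorm 𝔟 with hX
  have hX0 : 0 < X := mul_pos (Real.exp_pos u) hN
  set G : Ideal (𝓞 K) → ℂ := fun 𝔠 =>
    if (Ideal.absNorm 𝔠 : ℝ) ≤ X ∧ 𝔟 ∣ 𝔠 then h.angularChar k 𝔠 else 0 with hG
  have hG0 : G ⊥ = 0 := by
    simp only [hG, ← Ideal.zero_eq_bot, map_zero, ite_self]
  have hGs : G.support.Finite := by
    refine (finite_logNorm_le K (Real.log X)).subset fun 𝔠 h𝔠 => ?_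
    by_contra hc
    refine h𝔠 ?_
    by_cases h𝔠0 : 𝔠 = ⊥
    · rw [h𝔠0, hG0]
    · refine if_neg fun hc' => hc ?_
      exact Real.log_le_log
        (by exact_mod_cast Nat.pos_of_ne_zero (Ideal.absNorm_eq_zero_iff.not.2 h𝔠0)) hc'.1
  have h1 : ∀ α : 𝓞 K, (if α ∈ 𝔟 then finitePart emb 𝔑 ψ k α else 0) *
      discAngular k (Real.sqrt X) (emb α) = G (Ideal.span {α}) := by
    intro α
    have h2 : ‖emb (α : K)‖ ≤ Real.sqrt X ↔ (Ideal.absNorm (Ideal.span {α}) : ℝ) ≤ X := by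
      rw [absNorm_span_singleton_eq hdeg himag emb, Real.le_sqrt (norm_nonneg _)]
      exact hX0.le
    simp only [hG, discAngular, h2, Ideal.dvd_span_singleton, ← h.finitePart_mul]
    by_cases h3 : α ∈ 𝔟 <;>
      by_cases h4 : (Ideal.absNorm (Ideal.span {α}) : ℝ) ≤ X <;>
        simp only [h3, h4, if_true, if_false,
        and_true, and_false, zero_mul, mul_zero]
  rw [tsum_congr h1, tsum_span_singleton hGs hG0, partialSum]
  congr 1
  rw [← tsum_mul_left]
  have hinj : Function.Injective fun 𝔞 : Ideal (𝓞 K) => 𝔞 * 𝔟 := mul_left_injective₀ h𝔟0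
  rw [← hinj.tsum_eq]
  · refine tsum_congr fun 𝔞 => ?_
    have h3 : (Ideal.absNorm (𝔞 * 𝔟) : ℝ) ≤ X ↔ logNorm 𝔞 ≤ u := by
      rw [logNorm_le_iff hu, _root_.map_mul, Nat.cast_mul, hX, mul_le_mul_iff_left₀ hN]
    simp only [hG, h3, dvd_mul_left, and_true, _root_.map_mul (h.angularChar k)]
    split_ifs <;> simp [mul_comm]
  · intro 𝔠 h𝔠
    by_contra hc
    refine h𝔠 ?_
    have h4 : ¬ 𝔟 ∣ 𝔠 := fun ⟨𝔞, h𝔞⟩ => hc ⟨𝔞, by rw [h𝔞, mul_comm]⟩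
    simp [hG, h4]

omit [NumberField K] in
open scoped Classical in
lemma finitePart_indicator_add (h : IsHeckeCharacter emb 𝔑 ψ) (𝔟 : Ideal (𝓞 K)) (k : ℕ) (α : 𝓞 K)
    {m : 𝓞 K} (hm : m ∈ 𝔟 * 𝔑) :
    (if α + m ∈ 𝔟 then finitePart emb 𝔑 ψ k (α + m) else 0) =
      if α ∈ 𝔟 then finitePart emb 𝔑 ψ k α else 0 := by
  have h1 : α + m ∈ 𝔟 ↔ α ∈ 𝔟 := 𝔟.add_mem_iff_left (Ideal.mul_le_left hm)
  simp only [h1, h.finitePart_add k α (Ideal.mul_le_right hm)]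

omit [NumberField K] in
open scoped Classical in
lemma exists_pos_sum_finitePart (h : IsHeckeCharacter emb 𝔑 ψ) {𝔟 : Ideal (𝓞 K)}
    (h𝔟 : IsCoprime 𝔟 𝔑) [Fintype (𝓞 K ⧸ 𝔟 * 𝔑)] : ∃ S : ℝ, 0 < S ∧
      ∑ q : 𝓞 K ⧸ 𝔟 * 𝔑, (if q.out ∈ 𝔟 then finitePart emb 𝔑 ψ 0 q.out else 0) = S := by
  refine ⟨∑ q : 𝓞 K ⧸ 𝔟 * 𝔑, if q.out ∈ 𝔟 ∧ IsCoprime (Ideal.span {q.out}) 𝔑 then 1 else 0, ?_, ?_⟩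
  · obtain ⟨b, hb, n, hn, hbn⟩ := Ideal.isCoprime_iff_exists.1 h𝔟
    have hm : (Ideal.Quotient.mk (𝔟 * 𝔑) b).out - b ∈ 𝔟 * 𝔑 :=
      Ideal.Quotient.eq.1 (Quotient.out_eq (Ideal.Quotient.mk (𝔟 * 𝔑) b))
    have hb1 : IsCoprime (Ideal.span {b}) 𝔑 := isCoprime_span_iff.2 ⟨1, by
      rw [show b * 1 - 1 = -n by linear_combination hbn]; exact neg_mem hn⟩
    have hPb : (Ideal.Quotient.mk (𝔟 * 𝔑) b).out ∈ 𝔟 := by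
      have := add_mem (Ideal.mul_le_left hm) hb
      rwa [sub_add_cancel] at this
    refine Finset.sum_pos' (fun q _ => by split_ifs <;> norm_num)
      ⟨Ideal.Quotient.mk (𝔟 * 𝔑) b, Finset.mem_univ _, ?_⟩
    rw [if_pos ⟨hPb, (h.map_span_mul_eq hb1 (Ideal.mul_le_right hm)).1⟩]
    exact one_pos
  · push_cast
    refine Finset.sum_congr rfl fun q _ => ?_
    by_cases h1 : IsCoprime (Ideal.span {(q.out : 𝓞 K)}) 𝔑
    · rw [finitePart_zero_of_isCoprime h1]
      split_ifs <;> simp_all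
    · rw [finitePart, if_neg h1]; simp [h1]

lemma norm_sub_le_of_lattice_bound {w N e C : ℝ} (hw : 0 < w) (hN : 0 < N) (he : 0 < e)
    {x Z A M : ℂ} (hx : ‖x‖ = 1) (hA : A = w * (x * Z))
    (hb : ‖A - M * Real.sqrt (e * N) ^ 2‖ ≤
      C * (Real.sqrt (e * N) * Real.sqrt (Real.sqrt (e * N)))) :
    ‖Z - M * N / (w * x) * e‖ ≤ C / w * N ^ (3 / 4 : ℝ) * e ^ (3 / 4 : ℝ) := by
  have hX : 0 < e * N := mul_pos he hN
  have h1 : Real.sqrt (e * N) * Real.sqrt (Real.sqrt (e * N)) =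
      N ^ (3 / 4 : ℝ) * e ^ (3 / 4 : ℝ) := by
    rw [Real.sqrt_eq_rpow, Real.sqrt_eq_rpow, ← Real.rpow_mul hX.le, ← Real.rpow_add hX,
      mul_comm e N, Real.mul_rpow hN.le he.le]
    norm_num
  have h2 : ((Real.sqrt (e * N) : ℝ) : ℂ) ^ 2 = e * N := by
    rw [← Complex.ofReal_pow, Real.sq_sqrt hX.le, Complex.ofReal_mul]
  have hx0 : x ≠ 0 := by rintro rfl; simp at hx
  have hwc : (w : ℂ) ≠ 0 := by exact_mod_cast hw.ne'
  have h3 : Z - M * N / (w * x) * e = (A - M * (e * N)) / (w * x) := by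
    rw [hA]; field_simp
  rw [h1, h2] at hb
  rw [h3, norm_div, norm_mul, hx, mul_one, Complex.norm_real, Real.norm_of_nonneg hw.le,
    div_mul_eq_mul_div, div_mul_eq_mul_div, mul_assoc]
  gcongr

open scoped Classical in
lemma exists_hasMean_class (h : IsHeckeCharacter emb 𝔑 ψ) (h𝔑 : 𝔑 ≠ ⊥)
    (hdeg : Module.finrank ℚ K = 2) (himag : IsEmpty (K →+* ℝ)) {𝔟 : Ideal (𝓞 K)}
    (h𝔟 : IsCoprime 𝔟 𝔑) (k : ℕ) :
    ∃ m : ℝ, 0 < m ∧ HasMean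
      (fun 𝔞 => if (𝔞 * 𝔟).IsPrincipal then h.angularChar k 𝔞 else 0)
      (if k = 0 then m else 0) := by
  have := finite_units hdeg himag emb
  have h𝔟0 := h.ne_bot h𝔟
  have h𝔪 : 𝔟 * 𝔑 ≠ ⊥ := mul_ne_zero h𝔟0 h𝔑
  have : Finite (𝓞 K ⧸ 𝔟 * 𝔑) := (𝔟 * 𝔑).finiteQuotientOfFreeOfNeBot h𝔪
  have : Fintype (𝓞 K ⧸ 𝔟 * 𝔑) := Fintype.ofFinite _
  obtain ⟨c, hc, hbound⟩ := exists_periodic_sum_bound hdeg himag emb h𝔪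
  obtain ⟨C, hC⟩ := hbound (fun α => if α ∈ 𝔟 then finitePart emb 𝔑 ψ k α else 0)
    (fun α m hm => h.finitePart_indicator_add 𝔟 k α hm) k
  obtain ⟨S, hS0, hS⟩ := h.exists_pos_sum_finitePart h𝔟
  have hw0 : (0 : ℝ) < Nat.card (𝓞 K)ˣ := by exact_mod_cast Nat.card_pos
  have hN1 : (1 : ℝ) ≤ Ideal.absNorm 𝔟 := by
    exact_mod_cast Nat.pos_of_ne_zero (Ideal.absNorm_eq_zero_iff.not.2 h𝔟0)
  have hN0 : (0 : ℝ) < Ideal.absNorm 𝔟 := one_pos.trans_le hN1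
  refine ⟨c * S * Ideal.absNorm 𝔟 / Nat.card (𝓞 K)ˣ,
    div_pos (mul_pos (mul_pos hc hS0) hN0) hw0, C / Nat.card (𝓞 K)ˣ * Ideal.absNorm 𝔟 ^ (3 / 4 : ℝ),
    fun u hu => ?_⟩
  have hR1 : 1 ≤ Real.sqrt (Real.exp u * Ideal.absNorm 𝔟) :=
    Real.one_le_sqrt.2 (one_le_mul_of_one_le_of_one_le (Real.one_le_exp hu.le) hN1)
  have h1 := norm_sub_le_of_lattice_bound hw0 hN0 (Real.exp_pos u)
    (h.norm_angularChar_of_isCoprime k h𝔟) (h.tsum_discAngular_eq hdeg himag h𝔟 k hu.le)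
    (hC _ hR1)
  rw [← Real.exp_mul, mul_comm u] at h1
  convert h1 using 4
  by_cases hk : k = 0
  · subst hk
    rw [if_pos rfl, if_pos rfl, hS, h.angularChar_of_isCoprime 0 h𝔟, angular, pow_zero]
    push_cast
    ring
  · rw [if_neg hk, if_neg hk]
    simp

/-- The class of a nonzero ideal, and `1` for the zero ideal. -/
noncomputable def idealClass (𝔞 : Ideal (𝓞 K)) : ClassGroup (𝓞 K) := by
  classical
  exact if h𝔞 : 𝔞 = ⊥ then 1 else ClassGroup.mk0 ⟨𝔞, mem_nonZeroDivisors_of_ne_zero h𝔞⟩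

lemma isPrincipal_mul_pow_iff {𝔞 𝔟 : Ideal (𝓞 K)} (ha : 𝔞 ≠ ⊥) (hb : 𝔟 ≠ ⊥) :
    (𝔞 * 𝔟 ^ (Fintype.card (ClassGroup (𝓞 K)) - 1)).IsPrincipal ↔
      idealClass 𝔞 = idealClass 𝔟 := by
  have ha' := mem_nonZeroDivisors_of_ne_zero ha
  have hb' := mem_nonZeroDivisors_of_ne_zero hb
  rw [← ClassGroup.mk0_eq_one_iff (mul_mem ha' (pow_mem hb' _)), idealClass, idealClass,
    dif_neg ha, dif_neg hb]
  have h1 : (⟨𝔞 * 𝔟 ^ (Fintype.card (ClassGroup (𝓞 K)) - 1), mul_mem ha' (pow_mem hb' _)⟩ :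
      nonZeroDivisors (Ideal (𝓞 K))) =
        ⟨𝔞, ha'⟩ * ⟨𝔟, hb'⟩ ^ (Fintype.card (ClassGroup (𝓞 K)) - 1) :=
    rfl
  have h2 : ClassGroup.mk0 ⟨𝔟, hb'⟩ ^ (Fintype.card (ClassGroup (𝓞 K)) - 1) =
      (ClassGroup.mk0 ⟨𝔟, hb'⟩)⁻¹ := by
    rw [eq_inv_iff_mul_eq_one, pow_sub_one_mul Fintype.card_ne_zero, pow_card_eq_one]
  rw [h1, _root_.map_mul, _root_.map_pow, h2, mul_inv_eq_one]

open scoped Classical in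
lemma exists_hasMean_idealClass (h : IsHeckeCharacter emb 𝔑 ψ) (h𝔑 : 𝔑 ≠ ⊥)
    (hdeg : Module.finrank ℚ K = 2) (himag : IsEmpty (K →+* ℝ)) (k : ℕ) (c : ClassGroup (𝓞 K)) :
    ∃ m : ℝ, 0 ≤ m ∧ (c = 1 → 0 < m) ∧ HasMean
      (fun 𝔞 => if idealClass 𝔞 = c then h.angularChar k 𝔞 else 0) (if k = 0 then m else 0) := by
  by_cases hc : ∃ 𝔟 : Ideal (𝓞 K), IsCoprime 𝔟 𝔑 ∧ idealClass 𝔟 = c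
  · obtain ⟨𝔟, h𝔟, rfl⟩ := hc
    obtain ⟨m, hm, hmean⟩ := h.exists_hasMean_class h𝔑 hdeg himag
      (h𝔟.pow_left (m := Fintype.card (ClassGroup (𝓞 K)) - 1)) k
    refine ⟨m, hm.le, fun _ => hm, ?_⟩
    convert hmean using 1
    funext 𝔞
    by_cases h𝔞 : IsCoprime 𝔞 𝔑
    · simp only [isPrincipal_mul_pow_iff (h.ne_bot h𝔞) (h.ne_bot h𝔟)]
    · simp only [h.angularChar_of_not_isCoprime k h𝔞, ite_self]
  · refine ⟨0, le_rfl, fun hc1 => (hc ⟨⊤, ?_, ?_⟩).elim, 0, fun u hu => ?_⟩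
    · rw [← Ideal.one_eq_top]; exact isCoprime_one_left
    · rw [hc1, idealClass, dif_neg top_ne_bot]
      exact (ClassGroup.mk0_eq_one_iff _).2 top_isPrincipal
    · have h1 : ∀ 𝔞, (if idealClass 𝔞 = c then h.angularChar k 𝔞 else 0) = 0 := fun 𝔞 => by
        split_ifs with h2
        · exact h.angularChar_of_not_isCoprime k fun h3 => hc ⟨𝔞, h3, h2⟩
        · rfl
      simp [partialSum, h1]

theorem exists_hasMean_angularChar (h : IsHeckeCharacter emb 𝔑 ψ) (h𝔑 : 𝔑 ≠ ⊥)
    (hdeg : Module.finrank ℚ K = 2) (himag : IsEmpty (K →+* ℝ)) (k : ℕ) :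
    ∃ m : ℝ, 0 < m ∧ HasMean (h.angularChar k) (if k = 0 then m else 0) := by
  classical
  choose m hm0 hm1 hmean using h.exists_hasMean_idealClass h𝔑 hdeg himag k
  refine ⟨∑ c, m c, Finset.sum_pos' (fun c _ => hm0 c) ⟨1, Finset.mem_univ _, hm1 1 rfl⟩, ?_⟩
  convert HasMean.sum Finset.univ fun c _ => hmean c using 1
  · funext 𝔞
    rw [Finset.sum_ite_eq, if_pos (Finset.mem_univ _)]
  · split_ifs <;> simp

/-- Prime number theorems for the unitary characters attached to a Hecke character. -/
theorem tendsto_prime_sums_angularChar (h : IsHeckeCharacter emb 𝔑 ψ) (h𝔑 : 𝔑 ≠ ⊥)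
    (hdeg : Module.finrank ℚ K = 2) (himag : IsEmpty (K →+* ℝ)) {k : ℕ} (hk : k ≠ 0) :
    Tendsto (fun u => Real.exp (-u) * partialSum (fun p : {𝔭 : Ideal (𝓞 K) // Prime 𝔭} =>
      logNorm p.1) (fun p => logNorm p.1 * ‖h.angularChar k p.1‖) u) atTop (nhds 1) ∧
    Tendsto (fun u => Real.exp (-u) * partialSum (fun p : {𝔭 : Ideal (𝓞 K) // Prime 𝔭} =>
      logNorm p.1) (fun p => logNorm p.1 * (h.angularChar k p.1).re) u) atTop (nhds 0) := by
  obtain ⟨m, hm, C₀, h₀⟩ := h.exists_hasMean_angularChar h𝔑 hdeg himag 0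
  obtain ⟨_, -, C, h₁⟩ := h.exists_hasMean_angularChar h𝔑 hdeg himag k
  obtain ⟨_, -, C₂, h₂⟩ := h.exists_hasMean_angularChar h𝔑 hdeg himag (2 * k)
  rw [if_pos rfl] at h₀
  simp only [if_neg hk, zero_mul, sub_zero] at h₁
  simp only [if_neg (mul_ne_zero two_ne_zero hk), zero_mul, sub_zero] at h₂
  exact tendsto_prime_sums (h.norm_angularChar_eq k) (h.angularChar_zero_eq k)
    (h.angularChar_two_mul k) (by exact_mod_cast hm.ne' : (m : ℂ) ≠ 0) (by norm_num) h₀ h₁ h₂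

end IsHeckeCharacter

section SequenceAverages

lemma partialSum_eq_sum {ι : Type*} {ℓ : ι → ℝ} (b : ι → ℝ) {u : ℝ}
    (hfin : {i | ℓ i ≤ u}.Finite) : partialSum ℓ b u = ∑ i ∈ hfin.toFinset, b i := by
  rw [partialSum, tsum_eq_sum (s := hfin.toFinset)]
  · exact Finset.sum_congr rfl fun i hi => if_pos (by simpa using hi)
  · exact fun i hi => if_neg (by simpa using hi)

lemma abs_sum_range_le_of_partialSum {ℓ a : ℕ → ℝ} (hmono : Monotone ℓ) (hℓ : ∀ i, 0 ≤ ℓ i)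
    (ha : ∀ i, |a i| ≤ 1) (hfin : ∀ u, {i | ℓ i ≤ u}.Finite) {ε δ : ℝ} (hδ : 0 < δ) {m : ℕ}
    (h : |partialSum ℓ (fun i => ℓ i * a i) (ℓ m)| + partialSum ℓ ℓ (ℓ m) ≤
      (1 + ε) * partialSum ℓ ℓ (ℓ m - δ)) (hε : 0 ≤ ε) :
    |∑ i ∈ Finset.range (m + 1), ℓ i * a i| ≤ ε * ∑ i ∈ Finset.range (m + 1), ℓ i := by
  rw [partialSum_eq_sum _ (hfin _), partialSum_eq_sum _ (hfin _),
    partialSum_eq_sum _ (hfin _)] at h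
  have s1 : Finset.range (m + 1) ⊆ (hfin (ℓ m)).toFinset := fun i hi => by
    simpa using hmono (Nat.lt_succ_iff.mp (Finset.mem_range.mp hi))
  have s2 : (hfin (ℓ m - δ)).toFinset ⊆ Finset.range (m + 1) := fun i hi => by
    have h1 : ℓ i ≤ ℓ m - δ := by simpa using hi
    rw [Finset.mem_range]
    by_contra! h2
    have := hmono (by lia : m ≤ i)
    linarith
  have h2 := Finset.sum_le_sum_of_subset_of_nonneg s2 fun i _ _ => hℓ i
  have h3 := Finset.sum_sdiff s1 (f := ℓ)
  have h4 := Finset.sum_sdiff s1 (f := fun i => ℓ i * a i)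
  have h5 : |∑ i ∈ (hfin (ℓ m)).toFinset \ Finset.range (m + 1), ℓ i * a i| ≤
      ∑ i ∈ (hfin (ℓ m)).toFinset \ Finset.range (m + 1), ℓ i := by
    refine (Finset.abs_sum_le_sum_abs _ _).trans (Finset.sum_le_sum fun i _ => ?_)
    rw [abs_mul, abs_of_nonneg (hℓ i)]
    exact mul_le_of_le_one_right (hℓ i) (ha i)
  have h6 := mul_le_mul_of_nonneg_left h2 (by linarith : 0 ≤ 1 + ε)
  rw [abs_le] at h5 ⊢
  have h7 := abs_le.mp (le_refl |∑ i ∈ (hfin (ℓ m)).toFinset, ℓ i * a i|)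
  constructor <;> nlinarith

lemma exists_abs_sum_range_le {ℓ a : ℕ → ℝ} (hmono : Monotone ℓ) (hℓ : ∀ i, 0 ≤ ℓ i)
    (ha : ∀ i, |a i| ≤ 1) (hfin : ∀ u, {i | ℓ i ≤ u}.Finite)
    (hθ : Tendsto (fun u => Real.exp (-u) * partialSum ℓ ℓ u) atTop (nhds 1))
    (hA : Tendsto (fun u => Real.exp (-u) * partialSum ℓ (fun i => ℓ i * a i) u) atTop (nhds 0))
    {ε : ℝ} (hε : 0 < ε) :
    ∃ C, ∀ n, |∑ i ∈ Finset.range n, ℓ i * a i| ≤ ε * (∑ i ∈ Finset.range n, ℓ i) + C := by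
  set δ := Real.log (1 + ε) / 2 with hδ
  have δ0 : 0 < δ := half_pos (Real.log_pos (by linarith))
  have e1 : (1 + ε) * Real.exp (-δ) = Real.exp δ := by
    conv_lhs => rw [← Real.exp_log (by linarith : 0 < 1 + ε), ← Real.exp_add]
    congr 1
    rw [hδ]; ring
  have t1 : Tendsto (fun u => Real.exp (-u) * partialSum ℓ ℓ (u - δ)) atTop
      (nhds (Real.exp (-δ) * 1)) := by
    refine ((hθ.comp (tendsto_atTop_add_const_right _ (-δ) tendsto_id)).const_mul _).congr
      fun u => ?_
    simp only [Function.comp, id, ← sub_eq_add_neg]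
    rw [← mul_assoc, ← Real.exp_add]
    congr 2
    ring
  have t2 := (hA.abs.add hθ).sub (t1.const_mul (1 + ε))
  have hlim : |(0 : ℝ)| + 1 - (1 + ε) * (Real.exp (-δ) * 1) < 0 := by
    rw [mul_one, e1, abs_zero]
    linarith [Real.add_one_lt_exp δ0.ne']
  obtain ⟨U, hU⟩ := eventually_atTop.mp (t2.eventually_lt_const hlim)
  obtain ⟨N, hN⟩ := (hfin U).bddAbove
  refine ⟨∑ i ∈ Finset.range (N + 2), ℓ i, fun n => ?_⟩
  have p0 : 0 ≤ ∑ i ∈ Finset.range n, ℓ i := Finset.sum_nonneg fun i _ => hℓ i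
  have p1 : 0 ≤ ∑ i ∈ Finset.range (N + 2), ℓ i := Finset.sum_nonneg fun i _ => hℓ i
  rcases le_or_gt n (N + 1) with hn | hn
  · have b1 : |∑ i ∈ Finset.range n, ℓ i * a i| ≤ ∑ i ∈ Finset.range n, ℓ i := by
      refine (Finset.abs_sum_le_sum_abs _ _).trans (Finset.sum_le_sum fun i _ => ?_)
      rw [abs_mul, abs_of_nonneg (hℓ i)]
      exact mul_le_of_le_one_right (hℓ i) (ha i)
    have b2 : ∑ i ∈ Finset.range n, ℓ i ≤ ∑ i ∈ Finset.range (N + 2), ℓ i :=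
      Finset.sum_le_sum_of_subset_of_nonneg (Finset.range_mono (by lia)) fun i _ _ => hℓ i
    have := mul_nonneg hε.le p0
    linarith
  · obtain ⟨m, rfl⟩ : ∃ m, n = m + 1 := ⟨n - 1, by lia⟩
    have hm : U ≤ ℓ m := by
      by_contra! h
      have := hN (show m ∈ {i | ℓ i ≤ U} from h.le)
      lia
    have h1 := hU _ hm
    have h2 : |partialSum ℓ (fun i => ℓ i * a i) (ℓ m)| + partialSum ℓ ℓ (ℓ m) ≤
        (1 + ε) * partialSum ℓ ℓ (ℓ m - δ) := by
      simp only [abs_mul, Real.abs_exp] at h1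
      have h3 : Real.exp (-ℓ m) * (|partialSum ℓ (fun i => ℓ i * a i) (ℓ m)| +
          partialSum ℓ ℓ (ℓ m) - (1 + ε) * partialSum ℓ ℓ (ℓ m - δ)) < 0 := by
        linarith
      have := (pos_iff_neg_of_mul_neg h3).mp (Real.exp_pos _)
      linarith
    have := abs_sum_range_le_of_partialSum hmono hℓ ha hfin δ0 h2 hε.le
    linarith

lemma sum_range_le_of_sum_mul_le {ℓ a : ℕ → ℝ} (hmono : Monotone ℓ) (hℓ : ∀ i, 0 < ℓ i)
    {ε C : ℝ} (h : ∀ n, ∑ i ∈ Finset.range n, ℓ i * a i ≤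
      ε * (∑ i ∈ Finset.range n, ℓ i) + C) (n : ℕ) :
    ∑ i ∈ Finset.range n, a i ≤ ε * n + C / ℓ 0 := by
  have key : (ε * (∑ i ∈ Finset.range n, ℓ i) + C - ∑ i ∈ Finset.range n, ℓ i * a i) / ℓ n ≤
      ε * n + C / ℓ 0 - ∑ i ∈ Finset.range n, a i := by
    induction n with
    | zero => simp
    | succ n ih =>
      have h1 := h (n + 1)
      calc _ ≤ (ε * (∑ i ∈ Finset.range (n + 1), ℓ i) + C -
            ∑ i ∈ Finset.range (n + 1), ℓ i * a i) / ℓ n :=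
          div_le_div_of_nonneg_left (by linarith) (hℓ n) (hmono n.le_succ)
        _ = (ε * (∑ i ∈ Finset.range n, ℓ i) + C - ∑ i ∈ Finset.range n, ℓ i * a i) / ℓ n +
            (ε - a n) := by
          have := (hℓ n).ne'
          rw [Finset.sum_range_succ, Finset.sum_range_succ]
          field_simp
          ring
        _ ≤ _ := by
          rw [Finset.sum_range_succ]
          push_cast
          linarith
  have h2 := h n
  have := (div_nonneg (by linarith) (hℓ n).le).trans key
  linarith

/-- If the sums of `ℓ i * a i` over `ℓ i ≤ u` are negligible compared to those of `ℓ i`, then the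
averages of `a` tend to zero. -/
theorem tendsto_average_of_partialSum {ℓ a : ℕ → ℝ} (hmono : Monotone ℓ) (hℓ : ∀ i, 0 < ℓ i)
    (ha : ∀ i, |a i| ≤ 1) (hfin : ∀ u, {i | ℓ i ≤ u}.Finite)
    (hθ : Tendsto (fun u => Real.exp (-u) * partialSum ℓ ℓ u) atTop (nhds 1))
    (hA : Tendsto (fun u => Real.exp (-u) * partialSum ℓ (fun i => ℓ i * a i) u)
      atTop (nhds 0)) :
    Tendsto (fun n : ℕ => (n : ℝ)⁻¹ * ∑ i ∈ Finset.range n, a i) atTop (nhds 0) := by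
  rw [Metric.tendsto_atTop]
  intro ε hε
  obtain ⟨C, hC⟩ := exists_abs_sum_range_le hmono (fun i => (hℓ i).le) ha hfin hθ hA (half_pos hε)
  have h1 := sum_range_le_of_sum_mul_le hmono hℓ fun n => (abs_le.mp (hC n)).2
  have h2 := sum_range_le_of_sum_mul_le (a := fun i => -a i) hmono hℓ (ε := ε / 2) (C := C)
    fun n => by
      have := (abs_le.mp (hC n)).1
      simp only [mul_neg, Finset.sum_neg_distrib]
      linarith
  obtain ⟨N, hN⟩ := exists_nat_gt (C / ℓ 0 / (ε / 2))
  refine ⟨N + 1, fun n hn => ?_⟩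
  have n0 : (0 : ℝ) < n := by exact_mod_cast (by lia : 0 < n)
  rw [Real.dist_0_eq_abs, abs_mul, abs_inv, Nat.abs_cast, inv_mul_lt_iff₀ n0]
  have h3 : C / ℓ 0 < ε / 2 * n := by
    rw [div_lt_iff₀ (half_pos hε)] at hN
    have : (N : ℝ) ≤ n := by exact_mod_cast (by lia : N ≤ n)
    nlinarith
  have h4 := h2 n
  rw [Finset.sum_neg_distrib] at h4
  rw [abs_lt]
  constructor <;> linarith [h1 n]

end SequenceAverages

namespace IsHeckeCharacter

variable {K : Type*} [Field K] [NumberField K] {emb : K →+* ℂ} {𝔑 : Ideal (𝓞 K)}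
  {ψ : Ideal (𝓞 K) → ℂ}

lemma partialSum_prime_eq (h : IsHeckeCharacter emb 𝔑 ψ) (k : ℕ) {𝔭 : ℕ → Ideal (𝓞 K)}
    (hprime : ∀ i, (𝔭 i).IsPrime ∧ 𝔭 i ≠ ⊥ ∧ IsCoprime (𝔭 i) 𝔑)
    (hinj : Function.Injective 𝔭)
    (hsurj : ∀ 𝔮 : Ideal (𝓞 K), 𝔮.IsPrime → 𝔮 ≠ ⊥ → IsCoprime 𝔮 𝔑 → ∃ i, 𝔭 i = 𝔮)
    {c : ℂ → ℝ} (hc : c 0 = 0) (u : ℝ) :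
    partialSum (fun p : {𝔭 : Ideal (𝓞 K) // Prime 𝔭} => logNorm p.1)
      (fun p => logNorm p.1 * c (h.angularChar k p.1)) u =
    partialSum (fun i => logNorm (𝔭 i)) (fun i => logNorm (𝔭 i) * c (angular k (ψ (𝔭 i)))) u := by
  have hp : ∀ i, Prime (𝔭 i) := fun i => Ideal.prime_of_isPrime (hprime i).2.1 (hprime i).1
  set g : ℕ → {𝔭 : Ideal (𝓞 K) // Prime 𝔭} := fun i => ⟨𝔭 i, hp i⟩
  have hg : Function.Injective g := fun i j hij => hinj (congrArg Subtype.val hij)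
  rw [partialSum, partialSum, ← hg.tsum_eq]
  · refine tsum_congr fun i => ?_
    simp only [g, h.angularChar_of_isCoprime k (hprime i).2.2]
  · intro p hpp
    by_cases hcop : IsCoprime p.1 𝔑
    · obtain ⟨i, hi⟩ := hsurj p.1 (Ideal.isPrime_of_prime p.2) p.2.ne_zero hcop
      exact ⟨i, Subtype.ext hi⟩
    · refine absurd ?_ hpp
      simp [h.angularChar_of_not_isCoprime k hcop, hc]

/-- The angles of a Hecke character at the primes ordered by norm have vanishing Weyl sums. -/
theorem tendsto_average_angular (h : IsHeckeCharacter emb 𝔑 ψ) (h𝔑 : 𝔑 ≠ ⊥)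
    (hdeg : Module.finrank ℚ K = 2) (himag : IsEmpty (K →+* ℝ)) {𝔭 : ℕ → Ideal (𝓞 K)}
    (hprime : ∀ i, (𝔭 i).IsPrime ∧ 𝔭 i ≠ ⊥ ∧ IsCoprime (𝔭 i) 𝔑)
    (hinj : Function.Injective 𝔭)
    (hsurj : ∀ 𝔮 : Ideal (𝓞 K), 𝔮.IsPrime → 𝔮 ≠ ⊥ → IsCoprime 𝔮 𝔑 → ∃ i, 𝔭 i = 𝔮)
    (hmono : ∀ i j, i ≤ j → Ideal.absNorm (𝔭 i) ≤ Ideal.absNorm (𝔭 j)) {k : ℕ} (hk : k ≠ 0) :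
    Tendsto (fun n : ℕ => (n : ℝ)⁻¹ * ∑ i ∈ Finset.range n, (angular k (ψ (𝔭 i))).re)
      atTop (nhds 0) := by
  obtain ⟨hθ, hA⟩ := h.tendsto_prime_sums_angularChar h𝔑 hdeg himag hk
  have hn : ∀ i, ‖angular k (ψ (𝔭 i))‖ = 1 := fun i =>
    norm_angular k (h.ne_zero _ (hprime i).2.2)
  have hlog : ∀ i, 0 < logNorm (𝔭 i) := fun i =>
    (Real.log_pos one_lt_two).trans_le (log_two_le_logNorm (hprime i).2.1 (hprime i).1.ne_top)
  refine tendsto_average_of_partialSum (ℓ := fun i => logNorm (𝔭 i)) (fun i j hij => ?_) hlog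
    (fun i => ?_) (fun u => ?_) ?_ ?_
  · have : Ideal.absNorm (𝔭 i) ≠ 0 := by simpa [Ideal.absNorm_eq_zero_iff] using (hprime i).2.1
    exact Real.log_le_log (by positivity) (by exact_mod_cast hmono i j hij)
  · exact (Complex.abs_re_le_norm _).trans (hn i).le
  · exact (finite_logNorm_le K u).preimage hinj.injOn
  · refine hθ.congr fun u => ?_
    rw [h.partialSum_prime_eq k hprime hinj hsurj (c := fun z => ‖z‖) norm_zero]
    simp only [hn, mul_one]
  · refine hA.congr fun u => ?_
    rw [h.partialSum_prime_eq k hprime hinj hsurj (c := Complex.re) Complex.zero_re]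

end IsHeckeCharacter

section ChebyshevEquidistribution

open Polynomial Polynomial.Chebyshev

lemma tendsto_average_pow_mul_T {x : ℕ → ℝ}
    (h : ∀ k : ℕ, k ≠ 0 → Tendsto (fun n : ℕ => (n : ℝ)⁻¹ *
      ∑ i ∈ Finset.range n, (T ℝ k).eval (x i)) atTop (nhds 0)) (j : ℕ) (k : ℤ) :
    Tendsto (fun n : ℕ => (n : ℝ)⁻¹ * ∑ i ∈ Finset.range n, (X ^ j * T ℝ k).eval (x i)) atTop
      (nhds (Real.pi⁻¹ * ∫ t, (X ^ j * T ℝ k).eval t ∂measureT)) := by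
  induction j generalizing k with
  | zero =>
    simp only [pow_zero, one_mul]
    rcases eq_or_ne k 0 with rfl | hk
    · rw [integral_eval_T_real_measureT_zero, inv_mul_cancel₀ Real.pi_ne_zero]
      refine tendsto_const_nhds.congr' ?_
      filter_upwards [eventually_ne_atTop 0] with n hn
      simp [hn]
    · rw [integral_eval_T_real_measureT_of_ne_zero hk, mul_zero]
      simpa only [T_natAbs] using h k.natAbs (by simpa using hk)
  | succ j ih =>
    have e : (X ^ (j + 1) * T ℝ k : ℝ[X]) =
        C (1 / 2) * (X ^ j * T ℝ (k + 1)) + C (1 / 2) * (X ^ j * T ℝ (k - 1)) := by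
      have e2 : (C (1 / 2) * 2 : ℝ[X]) = 1 := by
        rw [← C_ofNat, ← Polynomial.C_mul]; norm_num
      rw [T_add_one]
      linear_combination (-X ^ (j + 1) * T ℝ k) * e2
    have hi : ∀ p : ℝ[X], Integrable (fun t => p.eval t) measureT := fun p =>
      integrable_measureT p.continuous.continuousOn
    have e3 : ∫ t, (X ^ (j + 1) * T ℝ k : ℝ[X]).eval t ∂measureT =
        1 / 2 * ∫ t, (X ^ j * T ℝ (k + 1)).eval t ∂measureT +
        1 / 2 * ∫ t, (X ^ j * T ℝ (k - 1)).eval t ∂measureT := by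
      rw [e, ← integral_const_mul, ← integral_const_mul, ← integral_add ((hi _).const_mul _)
        ((hi _).const_mul _)]
      simp only [eval_add, eval_mul, eval_C]
    rw [e3]
    have := ((ih (k + 1)).const_mul (1 / 2)).add ((ih (k - 1)).const_mul (1 / 2))
    rw [show ∀ a b : ℝ, Real.pi⁻¹ * (1 / 2 * a + 1 / 2 * b) =
      1 / 2 * (Real.pi⁻¹ * a) + 1 / 2 * (Real.pi⁻¹ * b) from fun a b => by ring]
    refine this.congr fun n => ?_
    rw [e]
    simp only [eval_add, eval_mul, eval_C, Finset.sum_add_distrib, ← Finset.mul_sum]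
    ring

lemma tendsto_average_eval {x : ℕ → ℝ}
    (h : ∀ k : ℕ, k ≠ 0 → Tendsto (fun n : ℕ => (n : ℝ)⁻¹ *
      ∑ i ∈ Finset.range n, (T ℝ k).eval (x i)) atTop (nhds 0)) (p : ℝ[X]) :
    Tendsto (fun n : ℕ => (n : ℝ)⁻¹ * ∑ i ∈ Finset.range n, p.eval (x i)) atTop
      (nhds (Real.pi⁻¹ * ∫ t, p.eval t ∂measureT)) := by
  induction p using Polynomial.induction_on' with
  | add p q hp hq =>
    have hi : ∀ p : ℝ[X], Integrable (fun t => p.eval t) measureT := fun p =>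
      integrable_measureT p.continuous.continuousOn
    simp only [eval_add]
    rw [integral_add (hi p) (hi q), mul_add]
    simpa only [Finset.sum_add_distrib, mul_add] using hp.add hq
  | monomial j c =>
    have := (tendsto_average_pow_mul_T h j 0).const_mul c
    simp only [T_zero, mul_one, eval_pow, eval_X] at this
    simp only [eval_monomial, ← Finset.mul_sum, integral_const_mul]
    simpa only [mul_left_comm c] using this

lemma integral_one_measureT : ∫ _, (1 : ℝ) ∂measureT = Real.pi := by
  simpa using integral_eval_T_real_measureT_zero

/-- **Weyl's criterion** for the arcsine distribution, in terms of Chebyshev polynomials. -/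
theorem tendsto_average_of_chebyshev {x : ℕ → ℝ} (hx : ∀ i, x i ∈ Set.Icc (-1 : ℝ) 1)
    (h : ∀ k : ℕ, k ≠ 0 → Tendsto (fun n : ℕ => (n : ℝ)⁻¹ *
      ∑ i ∈ Finset.range n, (T ℝ k).eval (x i)) atTop (nhds 0)) {g : ℝ → ℝ}
    (hg : Continuous g) :
    Tendsto (fun n : ℕ => (n : ℝ)⁻¹ * ∑ i ∈ Finset.range n, g (x i)) atTop
      (nhds (Real.pi⁻¹ * ∫ t, g t ∂measureT)) := by
  rw [Metric.tendsto_atTop]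
  intro ε hε
  obtain ⟨p, hp⟩ := exists_polynomial_near_of_continuousOn (-1) 1 g hg.continuousOn (ε / 3)
    (by positivity)
  obtain ⟨N, hN⟩ := Metric.tendsto_atTop.mp (tendsto_average_eval h p) (ε / 3) (by positivity)
  have hpi : Integrable (fun t => p.eval t) measureT :=
    integrable_measureT p.continuous.continuousOn
  have hgi : Integrable g measureT := integrable_measureT hg.continuousOn
  have b1 : |Real.pi⁻¹ * ∫ t, p.eval t ∂measureT - Real.pi⁻¹ * ∫ t, g t ∂measureT| ≤ ε / 3 := by
    rw [← mul_sub, ← integral_sub hpi hgi, abs_mul, abs_of_pos (inv_pos.mpr Real.pi_pos),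
      inv_mul_le_iff₀ Real.pi_pos]
    have hae : ∀ᵐ t ∂measureT, ‖p.eval t - g t‖ ≤ ε / 3 := by
      rw [measureT]
      filter_upwards [ae_restrict_mem measurableSet_Ioc] with t ht
      exact (hp t ⟨ht.1.le, ht.2⟩).le
    have := norm_integral_le_of_norm_le (integrable_measureT
      (f := fun _ => ε / 3) continuousOn_const) hae
    rw [Real.norm_eq_abs] at this
    refine this.trans_eq ?_
    have e := integral_const_mul (μ := measureT) (ε / 3) fun _ => (1 : ℝ)
    rw [integral_one_measureT] at e
    rw [mul_comm Real.pi, ← e]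
    simp
  refine ⟨N + 1, fun n hn => ?_⟩
  have n0 : (0 : ℝ) < n := by exact_mod_cast (by lia : 0 < n)
  have b2 : |(n : ℝ)⁻¹ * ∑ i ∈ Finset.range n, p.eval (x i) -
      (n : ℝ)⁻¹ * ∑ i ∈ Finset.range n, g (x i)| ≤ ε / 3 := by
    rw [← mul_sub, ← Finset.sum_sub_distrib, abs_mul, abs_of_pos (inv_pos.mpr n0),
      inv_mul_le_iff₀ n0]
    refine (Finset.abs_sum_le_sum_abs _ _).trans ?_
    refine (Finset.sum_le_sum fun i _ => (hp _ (hx i)).le).trans_eq ?_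
    simp
  have b3 := hN n (by lia)
  rw [Real.dist_eq] at b3 ⊢
  rw [abs_lt] at b3 ⊢
  rw [abs_le] at b1 b2
  constructor <;> linarith

lemma integral_cm_measure (f : ℝ → ℂ) :
    ∫ z, f z ∂((volume.restrict (Set.Icc (-2 : ℝ) 2)).withDensity
      (fun z => ENNReal.ofReal (1 / (Real.pi * Real.sqrt (4 - z ^ 2))))) =
    ∫ t in (-1 : ℝ)..1, (Real.pi⁻¹ * √(1 - t ^ 2)⁻¹) • f (2 * t) := by
  rw [integral_withDensity_eq_integral_toReal_smul (by fun_prop)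
    (Eventually.of_forall fun _ => ENNReal.ofReal_lt_top),
    integral_Icc_eq_integral_Ioc, ← intervalIntegral.integral_of_le (by norm_num)]
  have := intervalIntegral.smul_integral_comp_mul_left (a := -1) (b := 1)
    (fun z => (ENNReal.ofReal (1 / (Real.pi * Real.sqrt (4 - z ^ 2)))).toReal • f z) 2
  norm_num at this ⊢
  rw [← this, ← intervalIntegral.integral_const_mul]
  refine intervalIntegral.integral_congr fun t _ => ?_
  have e : √(4 - (2 * t) ^ 2) = 2 * √(1 - t ^ 2) := by
    rw [show 4 - (2 * t) ^ 2 = 2 ^ 2 * (1 - t ^ 2) by ring, Real.sqrt_mul (by positivity),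
      Real.sqrt_sq (by norm_num)]
  simp only [e]
  rw [ENNReal.toReal_ofReal (inv_pos.mpr Real.pi_pos).le]
  push_cast
  rw [mul_inv]
  ring

lemma integral_cm_measure_eq {f : ℝ → ℂ} (hf : Continuous f) :
    ∫ z, f z ∂((volume.restrict (Set.Icc (-2 : ℝ) 2)).withDensity
      (fun z => ENNReal.ofReal (1 / (Real.pi * Real.sqrt (4 - z ^ 2))))) =
    ((Real.pi⁻¹ * ∫ t, (f (2 * t)).re ∂measureT : ℝ) : ℂ) +
      ((Real.pi⁻¹ * ∫ t, (f (2 * t)).im ∂measureT : ℝ) : ℂ) * Complex.I := by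
  have hw : ∀ g : ℝ → ℝ, Continuous g → IntervalIntegrable
      (fun t => ((Real.pi⁻¹ * (g t * √(1 - t ^ 2)⁻¹) : ℝ) : ℂ)) volume (-1) 1 := fun g hg => by
    have := (intervalIntegrable_sqrt_one_sub_sq_inv.continuousOn_mul hg.continuousOn).const_mul
      Real.pi⁻¹
    exact ⟨this.1.ofReal, this.2.ofReal⟩
  have c1 : Continuous fun t => (f (2 * t)).re := by fun_prop
  have c2 : Continuous fun t => (f (2 * t)).im := by fun_prop
  rw [integral_cm_measure, integral_measureT, integral_measureT,
    ← intervalIntegral.integral_const_mul, ← intervalIntegral.integral_const_mul,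
    ← intervalIntegral.integral_ofReal, ← intervalIntegral.integral_ofReal,
    ← intervalIntegral.integral_mul_const,
    ← intervalIntegral.integral_add (hw _ c1) ((hw _ c2).mul_const _)]
  refine intervalIntegral.integral_congr fun t _ => ?_
  apply Complex.ext <;> simp <;> ring

end ChebyshevEquidistribution

lemma re_angular_eq_eval (k : ℕ) {z : ℂ} (hz : z ≠ 0) :
    (angular k z).re = (Polynomial.Chebyshev.T ℝ k).eval (z / ‖z‖).re := by
  have e : z / ‖z‖ = Complex.exp (z.arg * Complex.I) := by
    have : (‖z‖ : ℂ) ≠ 0 := by simpa using hz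
    rw [div_eq_iff this, mul_comm, Complex.norm_mul_exp_arg_mul_I]
  rw [angular, e, ← Complex.exp_nat_mul, Complex.exp_ofReal_mul_I_re,
    Polynomial.Chebyshev.T_real_cos, ← mul_assoc,
    show ((k : ℂ) * z.arg) = ((k * z.arg : ℝ) : ℂ) by push_cast; rfl,
    Complex.exp_ofReal_mul_I_re]
  simp

end SatoTateCM

open SatoTateCM

/-- **Sato–Tate for CM elliptic curves over the CM field.**
Let `K` be an imaginary quadratic field with a fixed complex embedding, `𝔑` a nonzero ideal
of `𝓞 K`, and `ψ` an algebraic Hecke character of `K` modulo `𝔑` of infinity type `1` (such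
as the Hecke character attached by Deuring to a CM elliptic curve over `K` of conductor `𝔑`,
for which `a_𝔭 = ψ(𝔭) + conj(ψ(𝔭))`).  Then, for an enumeration `(𝔭_i)` by norm of the
primes coprime to `𝔑`, the normalized traces `(ψ(𝔭_i) + conj(ψ(𝔭_i)))/√N(𝔭_i)` are
equidistributed on `[-2, 2]` with respect to `μ_cm = (1/π)·dz/√(4 - z²)`. -/
theorem stmt_11 (K : Type*) [Field K] [NumberField K]
    (hdeg : Module.finrank ℚ K = 2) (himag : IsEmpty (K →+* ℝ))
    (emb : K →+* ℂ)
    (𝔑 : Ideal (𝓞 K)) (h𝔑 : 𝔑 ≠ ⊥)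
    (ψ : Ideal (𝓞 K) → ℂ)
    (hmul : ∀ 𝔞 𝔟 : Ideal (𝓞 K), IsCoprime 𝔞 𝔑 → IsCoprime 𝔟 𝔑 →
      ψ (𝔞 * 𝔟) = ψ 𝔞 * ψ 𝔟)
    (hne : ∀ 𝔞 : Ideal (𝓞 K), IsCoprime 𝔞 𝔑 → ψ 𝔞 ≠ 0)
    (halg : ∀ α : 𝓞 K, α - 1 ∈ 𝔑 → ψ (Ideal.span {α}) = emb (α : K))
    (𝔭 : ℕ → Ideal (𝓞 K))
    (hprime : ∀ i, (𝔭 i).IsPrime ∧ 𝔭 i ≠ ⊥ ∧ IsCoprime (𝔭 i) 𝔑)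
    (hinj : Function.Injective 𝔭)
    (hsurj : ∀ 𝔮 : Ideal (𝓞 K), 𝔮.IsPrime → 𝔮 ≠ ⊥ → IsCoprime 𝔮 𝔑 → ∃ i, 𝔭 i = 𝔮)
    (hmono : ∀ i j, i ≤ j → Ideal.absNorm (𝔭 i) ≤ Ideal.absNorm (𝔭 j))
    (f : ℝ → ℂ) (hf : Continuous f) :
    Tendsto (fun n : ℕ =>
        (n : ℂ)⁻¹ * ∑ i ∈ Finset.range n,
          f ((ψ (𝔭 i) + (starRingEnd ℂ) (ψ (𝔭 i))).re /
            Real.sqrt (Ideal.absNorm (𝔭 i))))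
      atTop
      (nhds (∫ z, f z ∂((volume.restrict (Set.Icc (-2 : ℝ) 2)).withDensity
        (fun z => ENNReal.ofReal (1 / (Real.pi * Real.sqrt (4 - z ^ 2))))))) := by
  have h : IsHeckeCharacter emb 𝔑 ψ := ⟨hmul, hne, halg⟩
  have hψ : ∀ i, ψ (𝔭 i) ≠ 0 := fun i => hne _ (hprime i).2.2
  set x : ℕ → ℝ := fun i => (ψ (𝔭 i) / ‖ψ (𝔭 i)‖).re with hxdef
  have hx : ∀ i, x i ∈ Set.Icc (-1 : ℝ) 1 := fun i => by
    have h1 : ‖ψ (𝔭 i) / ‖ψ (𝔭 i)‖‖ = 1 := by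
      simp [hψ i]
    exact abs_le.mp ((Complex.abs_re_le_norm _).trans h1.le)
  have htr : ∀ i, (ψ (𝔭 i) + (starRingEnd ℂ) (ψ (𝔭 i))).re /
      Real.sqrt (Ideal.absNorm (𝔭 i)) = 2 * x i := fun i => by
    rw [← h.sq_norm_eq h𝔑 hdeg himag (hprime i).2.2, Real.sqrt_sq (norm_nonneg _)]
    simp only [hxdef, Complex.div_ofReal_re, Complex.add_re, Complex.conj_re]
    ring
  have hT : ∀ k : ℕ, k ≠ 0 → Tendsto (fun n : ℕ => (n : ℝ)⁻¹ * ∑ i ∈ Finset.range n,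
      (Polynomial.Chebyshev.T ℝ k).eval (x i)) atTop (nhds 0) := fun k hk => by
    simpa only [fun i => re_angular_eq_eval k (hψ i)] using
      h.tendsto_average_angular h𝔑 hdeg himag hprime hinj hsurj hmono hk
  have l1 := tendsto_average_of_chebyshev hx hT (g := fun t => (f (2 * t)).re) (by fun_prop)
  have l2 := tendsto_average_of_chebyshev hx hT (g := fun t => (f (2 * t)).im) (by fun_prop)
  rw [integral_cm_measure_eq hf]
  refine (((Complex.continuous_ofReal.tendsto _).comp l1).add
    (((Complex.continuous_ofReal.tendsto _).comp l2).mul_const Complex.I)).congr fun n => ?_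
  simp only [Function.comp, htr]
  push_cast
  rw [mul_assoc, ← mul_add, Finset.sum_mul, ← Finset.sum_add_distrib]
  simp only [Complex.re_add_im]
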